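/- Let n ≥ 2 and let a_0, …, a_n ≥ 0 be constants with a_0 > 0 and a_n > 0. Then for every smooth immersion c_0 : S¹ → ℝ² and every smooth map u_0 : S¹ → ℝ² there exists a smooth map c : [0,∞) × S¹ → ℝ² such that each c(t,·) is a smooth immersion, c(0,·) = c_0, ∂_t c(0,·) = u_0, and for all t ≥ 0 the geodesic equation holds: ∂_t ( Σ_{j=0}^n (−1)^j a_j |c'| D_s^{2j} c_t ) = −(a_0/2) |c'| D_s(⟨c_t, c_t⟩ v) + Σ_{k=1}^n Σ_{j=1}^{2k−1} (−1)^{k+j} (a_k/2) |c'| D_s(⟨D_s^{2k−j} c_t, D_s^j c_t⟩ v), where c_t = ∂_t c and all quantities |c'|, v, D_s are computed from the curve c(t,·) at time t. -/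

import Mathlib

noncomputable section
open Real MeasureTheory intervalIntegral
open scoped RealInnerProductSpace

/-- We identify the plane with `EuclideanSpace ℝ (Fin 2)`. -/
abbrev R2 := EuclideanSpace ℝ (Fin 2)

/-- A smooth `2π`-periodic map, i.e. a smooth map on the circle `S¹`. -/
def SmoothLoop {E : Type*} [NormedAddCommGroup E] [NormedSpace ℝ E] (f : ℝ → E) : Prop :=
  ContDiff ℝ (⊤ : ℕ∞) f ∧ Function.Periodic f (2 * π)

/-- A smooth immersion `S¹ → ℝ²`: a smooth `2π`-periodic map with nowhere vanishing derivative. -/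
def IsImmersion (c : ℝ → R2) : Prop :=
  SmoothLoop c ∧ ∀ θ : ℝ, deriv c θ ≠ 0

/-- The speed `|c'|`. -/
def speed (c : ℝ → R2) (θ : ℝ) : ℝ := ‖deriv c θ‖

/-- Arc-length derivative `D_s = (1/|c'|) ∂_θ`. -/
def Ds {E : Type*} [NormedAddCommGroup E] [NormedSpace ℝ E] (c : ℝ → R2) (f : ℝ → E) :
    ℝ → E := fun θ => (speed c θ)⁻¹ • deriv f θ

/-- Unit tangent vector `v = c'/|c'|`. -/
def tangentV (c : ℝ → R2) (θ : ℝ) : R2 := (speed c θ)⁻¹ • deriv c θ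

/-- Rotation by `π/2` in the plane: `J(x,y) = (-y,x)`. -/
def Jrot (w : R2) : R2 := (WithLp.equiv 2 (Fin 2 → ℝ)).symm ![-(w 1), w 0]

/-- Unit normal vector `n = J v`. -/
def normalV (c : ℝ → R2) (θ : ℝ) : R2 := Jrot (tangentV c θ)

/-- Curvature `κ = ⟨D_s v, n⟩`. -/
def curv (c : ℝ → R2) (θ : ℝ) : ℝ := ⟪Ds c (tangentV c) θ, normalV c θ⟫

/-- `log |c'|`. -/
def logSpeed (c : ℝ → R2) (θ : ℝ) : ℝ := Real.log (speed c θ)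

/-- Length `ℓ_c = ∫_{S¹} |c'| dθ` of the curve. -/
def len (c : ℝ → R2) : ℝ := ∫ θ in (0:ℝ)..(2 * π), speed c θ

/-- A smooth path of immersions, parametrized by `[0,1]`. -/
def IsImmPath (c : ℝ → ℝ → R2) : Prop :=
  ContDiffOn ℝ (⊤ : ℕ∞) (fun p : ℝ × ℝ => c p.1 p.2) (Set.Icc 0 1 ×ˢ Set.univ) ∧
  ∀ t ∈ Set.Icc (0:ℝ) 1, IsImmersion (c t)

/-- Length `Len^G` of a path with respect to the metric `G`. -/
def pathLen (G : (ℝ → R2) → (ℝ → R2) → (ℝ → R2) → ℝ) (c : ℝ → ℝ → R2) : ℝ :=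
  ∫ t in (0:ℝ)..1,
    Real.sqrt (G (c t) (fun θ => deriv (fun τ => c τ θ) t) (fun θ => deriv (fun τ => c τ θ) t))

/-- Geodesic distance induced by `G`: the infimum of `Len^G` over smooth paths of immersions. -/
def distG (G : (ℝ → R2) → (ℝ → R2) → (ℝ → R2) → ℝ) (c₁ c₂ : ℝ → R2) : ℝ :=
  sInf { L : ℝ | ∃ c : ℝ → ℝ → R2, IsImmPath c ∧ c 0 = c₁ ∧ c 1 = c₂ ∧ L = pathLen G c }

/-- `G` assigns to every smooth immersion a nonnegative symmetric bilinear form on smooth maps. -/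
def IsMetric (G : (ℝ → R2) → (ℝ → R2) → (ℝ → R2) → ℝ) : Prop :=
  ∀ c : ℝ → R2, IsImmersion c →
    (∀ h k : ℝ → R2, SmoothLoop h → SmoothLoop k → G c h k = G c k h) ∧
    (∀ h₁ h₂ k : ℝ → R2, SmoothLoop h₁ → SmoothLoop h₂ → SmoothLoop k →
      G c (h₁ + h₂) k = G c h₁ k + G c h₂ k) ∧
    (∀ (a : ℝ) (h k : ℝ → R2), SmoothLoop h → SmoothLoop k →
      G c (a • h) k = a * G c h k) ∧
    (∀ h : ℝ → R2, SmoothLoop h → 0 ≤ G c h h)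

/-- The metric `G` is bounded below by the Sobolev `H^n(ds)` inner product:
`∫_{S¹} (|h|² + |D_s^n h|²) |c'| dθ ≤ A · G_c(h,h)`. -/
def SobolevBound (n : ℕ) (A : ℝ) (G : (ℝ → R2) → (ℝ → R2) → (ℝ → R2) → ℝ) : Prop :=
  ∀ c h : ℝ → R2, IsImmersion c → SmoothLoop h →
    (∫ θ in (0:ℝ)..(2 * π), (‖h θ‖ ^ 2 + ‖(Ds c)^[n] h θ‖ ^ 2) * speed c θ) ≤ A * G c h h

/-- Time-velocity `c_t = ∂_t c` of a time-dependent curve (time domain `[0,∞)`). -/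
def tvel (c : ℝ → ℝ → R2) (t : ℝ) : ℝ → R2 :=
  fun θ => derivWithin (fun τ => c τ θ) (Set.Ici 0) t

/-- The quantity `Σ_{j=0}^n (−1)^j a_j |c'| D_s^{2j} c_t` whose time derivative is taken in the
geodesic equation. -/
def geodMomentum (a : ℕ → ℝ) (n : ℕ) (c : ℝ → ℝ → R2) (t θ : ℝ) : R2 :=
  ∑ j ∈ Finset.range (n + 1),
    ((-1 : ℝ) ^ j * a j * speed (c t) θ) • (Ds (c t))^[2 * j] (tvel c t) θ

/-- Right-hand side of the geodesic equation:
`−(a_0/2)|c'| D_s(⟨c_t,c_t⟩v) + Σ_{k=1}^n Σ_{j=1}^{2k−1} (−1)^{k+j}(a_k/2)|c'| D_s(⟨D_s^{2k−j}c_t, D_s^j c_t⟩v)`. -/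
def geodRHS (a : ℕ → ℝ) (n : ℕ) (c : ℝ → ℝ → R2) (t θ : ℝ) : R2 :=
  (-(a 0 / 2) * speed (c t) θ) •
      Ds (c t) (fun x => (⟪tvel c t x, tvel c t x⟫ : ℝ) • tangentV (c t) x) θ
    + ∑ k ∈ Finset.Icc 1 n, ∑ j ∈ Finset.Icc 1 (2 * k - 1),
        ((-1 : ℝ) ^ (k + j) * (a k / 2) * speed (c t) θ) •
          Ds (c t) (fun x =>
            (⟪(Ds (c t))^[2 * k - j] (tvel c t) x, (Ds (c t))^[j] (tvel c t) x⟫ : ℝ) •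
              tangentV (c t) x) θ


namespace GP
open Set Filter Topology

section ODE
universe u
variable {X : Type u} [NormedAddCommGroup X] [NormedSpace ℝ X]

/-- `z` solves the autonomous equation `z' = F z` on `I`, inside `U`. -/
def SolOn (F : X → X) (U : Set X) (z : ℝ → X) (I : Set ℝ) : Prop :=
  ∀ t ∈ I, z t ∈ U ∧ HasDerivAt z (F (z t)) t

theorem SolOn.mono {F : X → X} {U : Set X} {z : ℝ → X} {I J : Set ℝ} (h : SolOn F U z I)
    (hJ : J ⊆ I) : SolOn F U z J := fun t ht => h t (hJ ht)

theorem SolOn.congr {F : X → X} {U : Set X} {z w : ℝ → X} {I : Set ℝ} (h : SolOn F U z I)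
    (hI : IsOpen I) (hw : EqOn w z I) : SolOn F U w I := by
  intro t ht
  have e : w =ᶠ[𝓝 t] z := by
    filter_upwards [hI.mem_nhds ht] with s hs using hw hs
  refine ⟨by rw [hw ht]; exact (h t ht).1, ?_⟩
  rw [hw ht]
  exact (h t ht).2.congr_of_eventuallyEq e

theorem SolOn.eqOn {F : X → X} {U : Set X} {z w : ℝ → X} {I : Set ℝ} (hU : IsOpen U)
    (hF : ContDiffOn ℝ 1 F U) (hI : IsOpen I) (hIc : IsPreconnected I) {t₀ : ℝ} (ht₀ : t₀ ∈ I)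
    (hz : SolOn F U z I) (hw : SolOn F U w I) (h0 : z t₀ = w t₀) : EqOn z w I := by
  have key : ∀ t ∈ I, z t = w t → z =ᶠ[𝓝 t] w := by
    intro t ht e
    obtain ⟨K, s, hs, hl⟩ := (hF.contDiffAt (hU.mem_nhds (hz t ht).1)).exists_lipschitzOnWith
    have h1 : ∀ᶠ τ in 𝓝 t, τ ∈ I := hI.mem_nhds ht
    have h2 : ∀ᶠ τ in 𝓝 t, z τ ∈ s := (hz t ht).2.continuousAt.preimage_mem_nhds hs
    have h3 : ∀ᶠ τ in 𝓝 t, w τ ∈ s := (hw t ht).2.continuousAt.preimage_mem_nhds (e ▸ hs)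
    refine ODE_solution_unique_of_eventually (v := fun _ => F) (s := fun _ => s) (K := K)
      (Eventually.of_forall fun _ => hl) ?_ ?_ e
    · filter_upwards [h1, h2] with τ a b using ⟨(hz τ a).2, b⟩
    · filter_upwards [h1, h3] with τ a b using ⟨(hw τ a).2, b⟩
  have sub : I ⊆ {t | z =ᶠ[𝓝 t] w} := by
    refine hIc.subset_of_closure_inter_subset (isOpen_setOfPred_eventually_nhds)
      ⟨t₀, ht₀, key t₀ ht₀ h0⟩ ?_
    rintro t ⟨hc, ht⟩
    refine key t ht ?_
    rw [mem_closure_iff_frequently] at hc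
    exact tendsto_nhds_unique_of_frequently_eq (hz t ht).2.continuousAt (hw t ht).2.continuousAt
      (hc.mono fun τ hτ => hτ.eq_of_nhds)
  exact fun t ht => (sub ht).eq_of_nhds

theorem exists_limit [CompleteSpace X] {z z' : ℝ → X} {a T C : ℝ} (haT : a < T)
    (h : ∀ t ∈ Ico a T, HasDerivAt z (z' t) t) (hC : ∀ t ∈ Ico a T, ‖z' t‖ ≤ C) :
    ∃ x, Tendsto z (𝓝[<] T) (𝓝 x) := by
  have hC0 : 0 ≤ C := (norm_nonneg _).trans (hC a ⟨le_rfl, haT⟩)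
  have hl : LipschitzOnWith ⟨C, hC0⟩ z (Ico a T) :=
    Convex.lipschitzOnWith_of_nnnorm_hasDerivWithin_le (f' := z') (convex_Ico a T)
      (fun t ht => (h t ht).hasDerivWithinAt) (fun t ht => hC t ht)
  have hc : Cauchy (𝓝[Ico a T] T) := by
    have : (𝓝[Ico a T] T).NeBot := by
      rw [← mem_closure_iff_nhdsWithin_neBot, closure_Ico haT.ne]
      exact ⟨haT.le, le_rfl⟩
    exact cauchy_nhds.mono nhdsWithin_le_nhds
  have := hc.map_of_le hl.uniformContinuousOn (by
    exact inf_le_right)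
  rw [nhdsWithin_Ico_eq_nhdsLT haT] at this
  obtain ⟨x, hx⟩ := CompleteSpace.complete this
  exact ⟨x, hx⟩

theorem exists_local [CompleteSpace X] {F : X → X} {U : Set X} (hU : IsOpen U)
    (hF : ContDiffOn ℝ 1 F U) {x : X} (hx : x ∈ U) (t₀ : ℝ) :
    ∃ z : ℝ → X, ∃ ε > 0, z t₀ = x ∧ SolOn F U z (Ioo (t₀ - ε) (t₀ + ε)) := by
  obtain ⟨α, h0, ε, hε, hα⟩ :=
    (hF.contDiffAt (hU.mem_nhds hx)).exists_forall_mem_closedBall_exists_eq_forall_mem_Ioo_hasDerivAt₀ t₀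
  have hc : ContinuousAt α t₀ := (hα t₀ ⟨by linarith, by linarith⟩).continuousAt
  have hn : α ⁻¹' U ∈ 𝓝 t₀ := hc.preimage_mem_nhds (by rw [h0]; exact hU.mem_nhds hx)
  obtain ⟨δ, hδ, hb⟩ := Metric.mem_nhds_iff.1 hn
  refine ⟨α, min ε δ, lt_min hε hδ, h0, fun t ht => ⟨?_, hα t ?_⟩⟩
  · apply hb
    rw [Real.ball_eq_Ioo]
    exact ⟨by linarith [ht.1, min_le_right ε δ], by linarith [ht.2, min_le_right ε δ]⟩
  · exact ⟨by linarith [ht.1, min_le_left ε δ], by linarith [ht.2, min_le_left ε δ]⟩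

theorem SolOn.extend [CompleteSpace X] {F : X → X} {U : Set X} (hU : IsOpen U)
    (hF : ContDiffOn ℝ 1 F U) {z : ℝ → X} {a T : ℝ} (haT : a < T)
    (hz : SolOn F U z (Ioo a T)) {x : X} (hx : x ∈ U) (hlim : Tendsto z (𝓝[<] T) (𝓝 x)) :
    ∃ T' > T, ∃ z' : ℝ → X, EqOn z' z (Iio T) ∧ SolOn F U z' (Ioo a T') := by
  obtain ⟨w, ε, hε, hw0, hw⟩ := exists_local hU hF hx T
  refine ⟨T + ε, by linarith, fun t => if t < T then z t else w t, ?_, ?_⟩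
  · intro t ht
    have : t < T := ht
    simp [this]
  intro t ht
  rcases lt_trichotomy t T with h | h | h
  · have e : (fun t => if t < T then z t else w t) =ᶠ[𝓝 t] z := by
      filter_upwards [Iio_mem_nhds h] with s hs
      have : s < T := hs
      simp [this]
    have := hz t ⟨ht.1, h⟩
    simp only [h, if_true]
    exact ⟨this.1, this.2.congr_of_eventuallyEq e⟩
  · subst h
    simp only [lt_irrefl, if_false]
    refine ⟨by rw [hw0]; exact hx, ?_⟩
    have hwt := (hw t ⟨by linarith, by linarith⟩).2
    have hFc : ContinuousAt F x := (hF.contDiffAt (hU.mem_nhds hx)).continuousAt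
    have hL : HasDerivWithinAt (fun s => if s < t then z s else w s) (F (w t)) (Iic t) t := by
      have hd : ∀ s ∈ Ioo a t, HasDerivAt (fun s => if s < t then z s else w s) (F (z s)) s := by
        intro s hs
        refine (hz s hs).2.congr_of_eventuallyEq ?_
        filter_upwards [Iio_mem_nhds hs.2] with r hr
        have : r < t := hr
        simp [this]
      refine hasDerivWithinAt_Iic_of_tendsto_deriv (s := Ioo a t) ?_ ?_ (Ioo_mem_nhdsLT haT) ?_
      · exact fun s hs => (hd s hs).differentiableAt.differentiableWithinAt
      · have : Tendsto (fun s => if s < t then z s else w s) (𝓝[Ioo a t] t) (𝓝 (w t)) := by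
          rw [hw0, nhdsWithin_Ioo_eq_nhdsLT haT]
          refine hlim.congr' ?_
          filter_upwards [self_mem_nhdsWithin] with s hs
          have : s < t := hs
          simp [this]
        simpa [ContinuousWithinAt] using this
      · have : Tendsto (fun s => F (z s)) (𝓝[<] t) (𝓝 (F (w t))) := by
          rw [hw0]; exact hFc.tendsto.comp hlim
        refine this.congr' ?_
        filter_upwards [Ioo_mem_nhdsLT haT] with s hs
        exact (hd s hs).deriv.symm
    have hR : HasDerivWithinAt (fun s => if s < t then z s else w s) (F (w t)) (Ici t) t := by
      refine hwt.hasDerivWithinAt.congr ?_ ?_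
      · intro s hs
        have : ¬ s < t := not_lt.2 hs
        simp [this]
      · simp
    have := hL.union hR
    rwa [Iic_union_Ici, hasDerivWithinAt_univ] at this
  · have e : (fun t => if t < T then z t else w t) =ᶠ[𝓝 t] w := by
      filter_upwards [Ioi_mem_nhds h] with s hs
      have : ¬ s < T := not_lt.2 (le_of_lt hs)
      simp [this]
    have := hw t ⟨by linarith, ht.2⟩
    simp only [not_lt.2 h.le, if_false]
    exact ⟨this.1, this.2.congr_of_eventuallyEq e⟩

theorem exists_global [CompleteSpace X] {F : X → X} {U : Set X} (hU : IsOpen U)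
    (hF : ContDiffOn ℝ 1 F U) {z₀ : X} (hz₀ : z₀ ∈ U)
    (H : ∀ T > 0, ∀ ε > 0, ∀ z : ℝ → X, z 0 = z₀ → SolOn F U z (Ioo (-ε) T) →
      ∃ x ∈ U, Tendsto z (𝓝[<] T) (𝓝 x)) :
    ∃ ε > 0, ∃ z : ℝ → X, z 0 = z₀ ∧ SolOn F U z (Ioi (-ε)) := by
  obtain ⟨w, ε, hε, hw0, hw⟩ := exists_local hU hF hz₀ 0
  simp only [zero_sub, zero_add] at hw
  let S : Set ℝ := {T | 0 < T ∧ ∃ z : ℝ → X, z 0 = z₀ ∧ SolOn F U z (Ioo (-ε) T)}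
  have hεS : ε ∈ S := ⟨hε, w, hw0, hw⟩
  have hch : ∀ T : ℝ, ∃ z : ℝ → X, T ∈ S → z 0 = z₀ ∧ SolOn F U z (Ioo (-ε) T) := by
    intro T
    by_cases hT : T ∈ S
    · obtain ⟨z, hz⟩ := hT.2
      exact ⟨z, fun _ => hz⟩
    · exact ⟨fun _ => 0, fun h => absurd h hT⟩
  choose zz hzz using hch
  have hag : ∀ T₁ ∈ S, ∀ T₂ ∈ S, ∀ t, -ε < t → t < T₁ → t < T₂ → zz T₁ t = zz T₂ t := by
    intro T₁ h1 T₂ h2 t ht0 ht1 ht2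
    have hh1 := (hzz T₁ h1).2.mono (Ioo_subset_Ioo_right (min_le_left T₁ T₂))
    have hh2 := (hzz T₂ h2).2.mono (Ioo_subset_Ioo_right (min_le_right T₁ T₂))
    refine SolOn.eqOn hU hF isOpen_Ioo isPreconnected_Ioo (t₀ := 0)
      ⟨by linarith, lt_min h1.1 h2.1⟩ hh1 hh2 ?_ ⟨ht0, lt_min ht1 ht2⟩
    rw [(hzz T₁ h1).1, (hzz T₂ h2).1]
  have hsel : ∀ t : ℝ, ∃ T, (∃ T' ∈ S, t < T') → T ∈ S ∧ t < T := by
    intro t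
    by_cases h : ∃ T' ∈ S, t < T'
    · obtain ⟨T, hT, hl⟩ := h
      exact ⟨T, fun _ => ⟨hT, hl⟩⟩
    · exact ⟨0, fun h' => absurd h' h⟩
  choose sel hsel using hsel
  let z : ℝ → X := fun t => zz (sel t) t
  have hzT : ∀ T ∈ S, EqOn z (zz T) (Ioo (-ε) T) := by
    intro T hT t ht
    have := hsel t ⟨T, hT, ht.2⟩
    exact hag _ this.1 _ hT t ht.1 this.2 ht.2
  have hz0 : z 0 = z₀ := by
    rw [hzT ε hεS ⟨by linarith, hε⟩]; exact (hzz ε hεS).1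
  have hzsol : ∀ T ∈ S, SolOn F U z (Ioo (-ε) T) := fun T hT =>
    (hzz T hT).2.congr isOpen_Ioo (hzT T hT)
  refine ⟨ε, hε, z, hz0, ?_⟩
  by_cases hb : BddAbove S
  · exfalso
    let T := sSup S
    have hTpos : 0 < T := lt_of_lt_of_le hε (le_csSup hb hεS)
    have hsol : SolOn F U z (Ioo (-ε) T) := by
      intro t ht
      obtain ⟨T', hT', hl⟩ := exists_lt_of_lt_csSup ⟨ε, hεS⟩ ht.2
      exact hzsol T' hT' t ⟨ht.1, hl⟩
    obtain ⟨x, hxU, hlim⟩ := H T hTpos ε hε z hz0 hsol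
    obtain ⟨T', hT', z', he, hz'⟩ := hsol.extend hU hF (by linarith) hxU hlim
    have : T' ∈ S := ⟨by linarith, z', by rw [he (show (0:ℝ) < T from hTpos)]; exact hz0, hz'⟩
    exact absurd (le_csSup hb this) (not_le.2 hT')
  · intro t ht
    rw [not_bddAbove_iff] at hb
    obtain ⟨T, hT, hl⟩ := hb t
    exact hzsol T hT t ⟨ht, hl⟩

end ODE
end GP

namespace GP
open Set Filter Topology

section Reg
universe u

/-- A strongly continuous one-parameter group of linear isometries. -/
structure Grp (X : Type u) [NormedAddCommGroup X] [NormedSpace ℝ X] where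
  T : ℝ → X →L[ℝ] X
  zero : ∀ x, T 0 x = x
  add : ∀ h k x, T (h + k) x = T h (T k x)
  norm : ∀ h x, ‖T h x‖ = ‖x‖
  cont : ∀ x, Continuous fun h => T h x

variable {X : Type u} [NormedAddCommGroup X] [NormedSpace ℝ X]
variable {Y : Type u} [NormedAddCommGroup Y] [NormedSpace ℝ Y]

theorem Grp.continuous (G : Grp X) : Continuous fun p : ℝ × X => G.T p.1 p.2 := by
  rw [continuous_iff_continuousAt]
  rintro ⟨h, x⟩
  have h1 : Tendsto (fun p : ℝ × X => G.T p.1 (p.2 - x)) (𝓝 (h, x)) (𝓝 0) := by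
    rw [tendsto_zero_iff_norm_tendsto_zero]
    simp only [G.norm]
    have : Continuous fun p : ℝ × X => ‖p.2 - x‖ := by fun_prop
    have := this.tendsto (h, x)
    simpa using this
  have h2 : Tendsto (fun p : ℝ × X => G.T p.1 x) (𝓝 (h, x)) (𝓝 (G.T h x)) :=
    ((G.cont x).comp continuous_fst).tendsto (h, x)
  have := h1.add h2
  simp only [map_sub, sub_add_cancel, zero_add] at this
  exact this

/-- Product group. -/
def Grp.prod (G : Grp X) (H : Grp Y) : Grp (X × Y) where
  T h := (G.T h).prodMap (H.T h)
  zero x := Prod.ext (G.zero _) (H.zero _)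
  add h k x := Prod.ext (G.add _ _ _) (H.add _ _ _)
  norm h x := by simp [Prod.norm_def, G.norm, H.norm]
  cont x := (G.cont x.1).prodMk (H.cont x.2)

theorem Grp.hasDerivAt_of_zero (G : Grp X) {x y : X} (h : HasDerivAt (fun k => G.T k x) y 0)
    (k : ℝ) : HasDerivAt (fun k => G.T k x) (G.T k y) k := by
  have h1 : HasDerivAt (fun s => G.T (s - k) x) y k := by
    have := HasDerivAt.comp_sub_const (f := fun k => G.T k x) k k (by simpa using h)
    exact this
  have h2 := (G.T k).hasFDerivAt.comp_hasDerivAt k h1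
  refine h2.congr_of_eventuallyEq (Eventually.of_forall fun s => ?_)
  simp only [Function.comp]
  rw [← G.add]; congr 2; ring

/-- Data: an equivariant smooth vector field. -/
structure EqVF (G : Grp X) (F : X → X) (U : Set X) : Prop where
  isOpen : IsOpen U
  smooth : ContDiffOn ℝ (⊤ : ℕ∞) F U
  inv : ∀ h, ∀ x ∈ U, G.T h x ∈ U
  eqv : ∀ h, ∀ x ∈ U, F (G.T h x) = G.T h (F x)

/-- tangent vector field -/
def tanF (F : X → X) (p : X × X) : X × X := (F p.1, fderiv ℝ F p.1 p.2)

theorem EqVF.diffAt {G : Grp X} {F : X → X} {U : Set X} (h : EqVF G F U) {x : X} (hx : x ∈ U) :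
    HasFDerivAt F (fderiv ℝ F x) x :=
  ((h.smooth.contDiffAt (h.isOpen.mem_nhds hx)).differentiableAt (by simp)).hasFDerivAt

theorem EqVF.fderiv_smooth {G : Grp X} {F : X → X} {U : Set X} (h : EqVF G F U) :
    ContDiffOn ℝ (⊤ : ℕ∞) (fderiv ℝ F) U :=
  ((contDiffOn_infty_iff_fderiv_of_isOpen h.isOpen).1 h.smooth).2

theorem EqVF.tan {G : Grp X} {F : X → X} {U : Set X} (h : EqVF G F U) :
    EqVF (G.prod G) (tanF F) (U ×ˢ univ) where
  isOpen := h.isOpen.prod isOpen_univ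
  smooth := by
    have h1 : ContDiffOn ℝ (⊤ : ℕ∞) (fun p : X × X => F p.1) (U ×ˢ univ) :=
      h.smooth.comp contDiff_fst.contDiffOn (fun p hp => hp.1)
    have h2 : ContDiffOn ℝ (⊤ : ℕ∞) (fun p : X × X => fderiv ℝ F p.1) (U ×ˢ univ) :=
      h.fderiv_smooth.comp contDiff_fst.contDiffOn (fun p hp => hp.1)
    exact h1.prodMk (h2.clm_apply contDiff_snd.contDiffOn)
  inv k x hx := ⟨h.inv k _ hx.1, trivial⟩
  eqv k x hx := by
    have e1 := (h.diffAt (h.inv k _ hx.1)).comp x.1 (G.T k).hasFDerivAt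
    have e2 := (G.T k).hasFDerivAt.comp x.1 (h.diffAt hx.1)
    have e3 := e1.congr_of_eventuallyEq (f₁ := (G.T k) ∘ F) (by
      filter_upwards [h.isOpen.mem_nhds hx.1] with s hs
      exact (h.eqv k s hs).symm)
    have e4 := congrArg (fun L : X →L[ℝ] X => L x.2) (e3.unique e2)
    simp only [ContinuousLinearMap.comp_apply] at e4
    exact Prod.ext (h.eqv k _ hx.1) e4

theorem EqVF.one {G : Grp X} {F : X → X} {U : Set X} (h : EqVF G F U) : ContDiffOn ℝ 1 F U :=
  h.smooth.of_le (by norm_cast <;> exact le_top)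

theorem exists_tangent [CompleteSpace X] {G : Grp X} {F : X → X} {U : Set X} (h : EqVF G F U)
    {z : ℝ → X} {ε : ℝ} (hε : 0 < ε) (hz : SolOn F U z (Ioi (-ε))) (y₀ : X) :
    ∃ ε' > 0, ∃ y : ℝ → X, y 0 = y₀ ∧
      SolOn (tanF F) (U ×ˢ univ) (fun t => (z t, y t)) (Ioi (-ε')) := by
  have agree : ∀ (I : Set ℝ) (w : ℝ → X × X), IsOpen I → IsPreconnected I → (0:ℝ) ∈ I →
      I ⊆ Ioi (-ε) → w 0 = (z 0, y₀) → SolOn (tanF F) (U ×ˢ univ) w I →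
      EqOn (fun t => (w t).1) z I := by
    intro I w hI hIc h0 hIε hw0 hw
    refine SolOn.eqOn h.isOpen h.one hI hIc h0 (fun t ht => ?_) (hz.mono hIε) (by simp [hw0])
    exact ⟨(hw t ht).1.1, (hw t ht).2.fst⟩
  obtain ⟨ε₁, hε₁, w, hw0, hw⟩ := exists_global (h.tan).isOpen (h.tan).one (z₀ := (z 0, y₀))
    ⟨(hz 0 (by simpa using hε)).1, trivial⟩ (by
      intro T hT ε₁ hε₁ w hw0 hw
      have hm : 0 < min ε ε₁ := lt_min hε hε₁
      have e := agree (Ioo (-(min ε ε₁)) T) w isOpen_Ioo isPreconnected_Ioo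
        ⟨by linarith, hT⟩ (fun t ht => lt_of_le_of_lt (neg_le_neg (min_le_left _ _)) ht.1) hw0
        (hw.mono (Ioo_subset_Ioo_left (neg_le_neg (min_le_right _ _))))
      have hzc : ContinuousOn z (Icc 0 T) := fun t ht =>
        (hz t (by simp only [mem_Ioi]; linarith [ht.1])).2.continuousAt.continuousWithinAt
      have hDc : ContinuousOn (fun t => fderiv ℝ F (z t)) (Icc 0 T) :=
        h.fderiv_smooth.continuousOn.comp hzc
          (fun t ht => (hz t (by simp only [mem_Ioi]; linarith [ht.1])).1)
      obtain ⟨M, hM⟩ := isCompact_Icc.exists_bound_of_continuousOn hDc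
      have hM0 : 0 ≤ M := (norm_nonneg _).trans (hM 0 ⟨le_rfl, hT.le⟩)
      have hd : ∀ t ∈ Ico 0 T, HasDerivAt (fun t => (w t).2) (fderiv ℝ F (z t) (w t).2) t := by
        intro t ht
        have := (hw t ⟨by linarith [ht.1], ht.2⟩).2.snd
        have e' := e (show t ∈ Ioo (-(min ε ε₁)) T from ⟨by linarith [ht.1], ht.2⟩)
        simp only at e'
        rw [← e']
        exact this
      have hb : ∀ t ∈ Ico 0 T, ‖(w t).2‖ ≤ ‖y₀‖ * Real.exp (M * T) := by
        intro t ht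
        have := norm_le_gronwallBound_of_norm_deriv_right_le (f := fun t => (w t).2)
          (f' := fun t => fderiv ℝ F (z t) (w t).2) (δ := ‖y₀‖) (K := M) (ε := 0) (a := 0) (b := t)
          (fun s hs => (hd s ⟨hs.1, hs.2.trans_lt ht.2⟩).continuousAt.continuousWithinAt)
          (fun s hs => (hd s ⟨hs.1, hs.2.trans ht.2⟩).hasDerivWithinAt)
          (by simp [hw0])
          (fun s hs => by
            rw [add_zero]
            exact (ContinuousLinearMap.le_opNorm _ _).trans (mul_le_mul_of_nonneg_right
              (hM s ⟨hs.1, (hs.2.trans ht.2).le⟩) (norm_nonneg _))) t ⟨ht.1, le_rfl⟩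
        rw [gronwallBound_ε0, sub_zero] at this
        refine this.trans ?_
        gcongr
        exact ht.2.le
      obtain ⟨x, hx⟩ := exists_limit hT hd (C := M * (‖y₀‖ * Real.exp (M * T))) (fun t ht =>
        (ContinuousLinearMap.le_opNorm _ _).trans (mul_le_mul (hM t ⟨ht.1, ht.2.le⟩) (hb t ht)
          (norm_nonneg _) hM0))
      have hT' := hz T (by simp only [mem_Ioi]; linarith)
      refine ⟨(z T, x), ⟨hT'.1, trivial⟩, ?_⟩
      have l1 : Tendsto (fun t => (w t).1) (𝓝[<] T) (𝓝 (z T)) := by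
        refine (hT'.2.continuousAt.tendsto.mono_left nhdsWithin_le_nhds).congr' ?_
        filter_upwards [Ioo_mem_nhdsLT hT] with t ht
        exact (e ⟨by linarith [ht.1], ht.2⟩).symm
      exact l1.prodMk_nhds hx)
  have hm : 0 < min ε ε₁ := lt_min hε hε₁
  have e := agree (Ioi (-(min ε ε₁))) w isOpen_Ioi isPreconnected_Ioi
    (by simpa using hm) (Ioi_subset_Ioi (neg_le_neg (min_le_left _ _))) hw0
    (hw.mono (Ioi_subset_Ioi (neg_le_neg (min_le_right _ _))))
  refine ⟨min ε ε₁, hm, fun t => (w t).2, by simp [hw0], ?_⟩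
  refine (hw.mono (Ioi_subset_Ioi (neg_le_neg (min_le_right _ _)))).congr isOpen_Ioi ?_
  intro t ht
  have := e ht
  simp only at this
  simp [← this]

theorem hasDerivAt_orbit {G : Grp X} {F : X → X} {U : Set X} (h : EqVF G F U)
    {z y : ℝ → X} {ε : ℝ} (hε : 0 < ε)
    (hzy : SolOn (tanF F) (U ×ˢ univ) (fun t => (z t, y t)) (Ioi (-ε)))
    (h0 : HasDerivAt (fun k => G.T k (z 0)) (y 0) 0) {t₁ : ℝ} (ht₁ : 0 ≤ t₁) :
    HasDerivAt (fun k => G.T k (z t₁)) (y t₁) 0 := by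
  have mem : ∀ t ∈ Icc 0 t₁, t ∈ Ioi (-ε) := fun t ht => by simp only [mem_Ioi]; linarith [ht.1]
  have hzU : ∀ t ∈ Icc 0 t₁, z t ∈ U := fun t ht => (hzy t (mem t ht)).1.1
  have hzd : ∀ t ∈ Icc 0 t₁, HasDerivAt z (F (z t)) t := fun t ht => (hzy t (mem t ht)).2.fst
  have hyd : ∀ t ∈ Icc 0 t₁, HasDerivAt y (fderiv ℝ F (z t) (y t)) t :=
    fun t ht => (hzy t (mem t ht)).2.snd
  have hzc : ContinuousOn z (Icc 0 t₁) := fun t ht => (hzd t ht).continuousAt.continuousWithinAt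
  have hyc : ContinuousOn y (Icc 0 t₁) := fun t ht => (hyd t ht).continuousAt.continuousWithinAt
  obtain ⟨M, hM⟩ := isCompact_Icc.exists_bound_of_continuousOn
    (h.fderiv_smooth.continuousOn.comp hzc hzU)
  obtain ⟨Y, hY⟩ := isCompact_Icc.exists_bound_of_continuousOn hyc
  have hM0 : 0 ≤ M := (norm_nonneg _).trans (hM 0 ⟨le_rfl, ht₁⟩)
  have hY0 : 0 ≤ Y := (norm_nonneg _).trans (hY 0 ⟨le_rfl, ht₁⟩)
  -- uniform first order expansion
  have key : ∀ η > 0, ∀ᶠ k in 𝓝 (0:ℝ), ∀ t ∈ Icc 0 t₁,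
      ‖F (G.T k (z t)) - F (z t) - fderiv ℝ F (z t) (G.T k (z t) - z t)‖ ≤
        η * ‖G.T k (z t) - z t‖ := by
    intro η hη
    refine isCompact_Icc.eventually_forall_of_forall_eventually (fun t ht => ?_)
    have hs : HasStrictFDerivAt F (fderiv ℝ F (z t)) (z t) :=
      (h.smooth.contDiffAt (h.isOpen.mem_nhds (hzU t ht))).hasStrictFDerivAt (by simp)
    have c2 : Tendsto (fun p : ℝ × ℝ => z p.2) (𝓝 (0, t)) (𝓝 (z t)) :=
      (hzd t ht).continuousAt.tendsto.comp continuous_snd.continuousAt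
    have c1 : Tendsto (fun p : ℝ × ℝ => G.T p.1 (z p.2)) (𝓝 (0, t)) (𝓝 (z t)) := by
      have c3 : Tendsto (fun p : ℝ × ℝ => (p.1, z p.2)) (𝓝 (0, t)) (𝓝 (0, z t)) :=
        continuous_fst.continuousAt.tendsto.prodMk_nhds c2
      have := (G.continuous.tendsto (0, z t)).comp c3
      simp only [G.zero] at this
      exact this
    have s1 := (hs.isLittleO.bound (half_pos hη))
    have s2 := (c1.prodMk_nhds c2).eventually s1
    have s3 : ∀ᶠ p : ℝ × ℝ in 𝓝 (0, t), ‖fderiv ℝ F (z p.2) - fderiv ℝ F (z t)‖ < η / 2 := by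
      have : ContinuousAt (fderiv ℝ F) (z t) :=
        h.fderiv_smooth.continuousOn.continuousAt (h.isOpen.mem_nhds (hzU t ht))
      have := (this.tendsto.comp c2).eventually (Metric.ball_mem_nhds _ (half_pos hη))
      filter_upwards [this] with p hp
      simpa [dist_eq_norm] using hp
    filter_upwards [s2, s3] with p h2 h3
    have : F (G.T p.1 (z p.2)) - F (z p.2) - fderiv ℝ F (z p.2) (G.T p.1 (z p.2) - z p.2)
      = (F (G.T p.1 (z p.2)) - F (z p.2) - fderiv ℝ F (z t) (G.T p.1 (z p.2) - z p.2))
        - (fderiv ℝ F (z p.2) - fderiv ℝ F (z t)) (G.T p.1 (z p.2) - z p.2) := by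
      simp only [sub_apply]; abel
    rw [this]
    refine (norm_sub_le _ _).trans ?_
    have h4 : ‖(fderiv ℝ F (z p.2) - fderiv ℝ F (z t)) (G.T p.1 (z p.2) - z p.2)‖ ≤
        η / 2 * ‖G.T p.1 (z p.2) - z p.2‖ :=
      (ContinuousLinearMap.le_opNorm _ _).trans
        (mul_le_mul_of_nonneg_right h3.le (norm_nonneg _))
    linarith
  rw [hasDerivAt_iff_isLittleO, Asymptotics.isLittleO_iff]
  intro η' hη'
  set B := gronwallBound 1 (M + 1) Y t₁ with hB
  have hB0 : 0 ≤ B := by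
    have h1 := gronwallBound_mono (zero_le_one) hY0 (by linarith : 0 ≤ M + 1) ht₁
    rw [gronwallBound_x0] at h1
    linarith
  obtain ⟨η, hη, hη1, hηB⟩ : ∃ η > 0, η ≤ 1 ∧ η * B ≤ η' := by
    refine ⟨min 1 (η' / (B + 1)), by positivity, min_le_left _ _, ?_⟩
    calc min 1 (η' / (B + 1)) * B ≤ η' / (B + 1) * B := by gcongr; exact min_le_right _ _
      _ ≤ η' / (B + 1) * (B + 1) := by gcongr; linarith
      _ = η' := by field_simp
  rw [hasDerivAt_iff_isLittleO, Asymptotics.isLittleO_iff] at h0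
  filter_upwards [key η hη, h0 hη] with k hk hk0
  simp only [G.zero, sub_zero] at hk0 ⊢
  have main := norm_le_gronwallBound_of_norm_deriv_right_le
    (f := fun t => G.T k (z t) - z t - k • y t)
    (f' := fun t => F (G.T k (z t)) - F (z t) - k • fderiv ℝ F (z t) (y t))
    (δ := η * ‖k‖) (K := M + 1) (ε := η * ‖k‖ * Y) (a := 0) (b := t₁)
    (by
      refine ContinuousOn.sub (ContinuousOn.sub ?_ hzc) (hyc.const_smul k)
      exact (G.T k).continuous.comp_continuousOn hzc)
    (fun t ht => by
      have ht' : t ∈ Icc 0 t₁ := ⟨ht.1, ht.2.le⟩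
      have d1 := (G.T k).hasFDerivAt.comp_hasDerivAt t (hzd t ht')
      rw [h.eqv k _ (hzU t ht')]
      exact ((d1.sub (hzd t ht')).sub ((hyd t ht').const_smul k)).hasDerivWithinAt)
    hk0
    (fun t ht => by
      have ht' : t ∈ Icc 0 t₁ := ⟨ht.1, ht.2.le⟩
      set r := G.T k (z t) - z t - k • y t with hr
      set d := G.T k (z t) - z t with hd
      have e1 : F (G.T k (z t)) - F (z t) - k • fderiv ℝ F (z t) (y t) =
          (F (G.T k (z t)) - F (z t) - fderiv ℝ F (z t) d) + fderiv ℝ F (z t) r := by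
        rw [hr]; simp only [map_sub, map_smul]; abel
      have e2 : ‖d‖ ≤ ‖r‖ + ‖k‖ * Y := by
        have : d = r + k • y t := by rw [hr]; abel
        rw [this]
        refine (norm_add_le _ _).trans ?_
        rw [norm_smul]
        gcongr
        exact hY t ht'
      have e3 : ‖fderiv ℝ F (z t) r‖ ≤ M * ‖r‖ :=
        (ContinuousLinearMap.le_opNorm _ _).trans
          (mul_le_mul_of_nonneg_right (hM t ht') (norm_nonneg _))
      rw [e1]
      refine (norm_add_le _ _).trans ?_
      have e4 := hk t ht'
      have e5 : η * ‖d‖ ≤ η * (‖r‖ + ‖k‖ * Y) := by gcongr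
      have e6 : η * ‖r‖ ≤ 1 * ‖r‖ := by gcongr
      nlinarith)
    t₁ ⟨ht₁, le_rfl⟩
  simp only [sub_zero] at main
  have hsc : gronwallBound (η * ‖k‖) (M + 1) (η * ‖k‖ * Y) t₁ = η * ‖k‖ * B := by
    rw [hB, gronwallBound_of_K_ne_0 (by linarith), gronwallBound_of_K_ne_0 (by linarith)]
    ring
  rw [hsc] at main
  refine main.trans ?_
  calc η * ‖k‖ * B = η * B * ‖k‖ := by ring
    _ ≤ η' * ‖k‖ := by gcongr

theorem Grp.hasFDerivAt_joint (G : Grp X) {z : ℝ → X} {t h : ℝ} {z' y : X}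
    (hz : HasDerivAt z z' t) (hy : HasDerivAt (fun k => G.T k (z t)) y h) :
    HasFDerivAt (fun p : ℝ × ℝ => G.T p.2 (z p.1))
      ((ContinuousLinearMap.fst ℝ ℝ ℝ).smulRight (G.T h z') +
        (ContinuousLinearMap.snd ℝ ℝ ℝ).smulRight y) (t, h) := by
  rw [hasFDerivAt_iff_isLittleO, Asymptotics.isLittleO_iff]
  rw [hasDerivAt_iff_isLittleO, Asymptotics.isLittleO_iff] at hz hy
  intro η hη
  have hη3 : 0 < η / 3 := by linarith
  have a1 := (continuous_fst (X := ℝ) (Y := ℝ)).continuousAt (x := (t, h)) |>.eventually (hz hη3)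
  have a2 := (continuous_snd (X := ℝ) (Y := ℝ)).continuousAt (x := (t, h)) |>.eventually (hy hη3)
  have a3 : ∀ᶠ p : ℝ × ℝ in 𝓝 (t, h), ‖G.T p.2 z' - G.T h z'‖ < η / 3 := by
    have := ((G.cont z').comp continuous_snd).tendsto (t, h) |>.eventually
      (Metric.ball_mem_nhds _ hη3)
    filter_upwards [this] with p hp
    simpa [dist_eq_norm] using hp
  filter_upwards [a1, a2, a3] with p h1 h2 h3
  have n1 : ‖p.1 - t‖ ≤ ‖p - (t, h)‖ := norm_fst_le (p - (t, h))
  have n2 : ‖p.2 - h‖ ≤ ‖p - (t, h)‖ := norm_snd_le (p - (t, h))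
  have e : G.T p.2 (z p.1) - G.T h (z t) -
      ((ContinuousLinearMap.fst ℝ ℝ ℝ).smulRight (G.T h z') +
        (ContinuousLinearMap.snd ℝ ℝ ℝ).smulRight y) (p - (t, h)) =
      G.T p.2 (z p.1 - z t - (p.1 - t) • z') + (p.1 - t) • (G.T p.2 z' - G.T h z') +
        (G.T p.2 (z t) - G.T h (z t) - (p.2 - h) • y) := by
    simp only [add_apply, ContinuousLinearMap.smulRight_apply, map_sub,
      map_smul, ContinuousLinearMap.coe_fst', ContinuousLinearMap.coe_snd', Prod.fst_sub,
      Prod.snd_sub, smul_sub, sub_smul]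
    module
  rw [e]
  refine (norm_add₃_le).trans ?_
  rw [G.norm, norm_smul]
  have : ‖p.1 - t‖ * ‖G.T p.2 z' - G.T h z'‖ ≤ ‖p - (t, h)‖ * (η / 3) := by gcongr
  nlinarith

theorem reg_nat (k : ℕ) : ∀ (X : Type u) [NormedAddCommGroup X] [NormedSpace ℝ X]
    [CompleteSpace X] (G : Grp X) (F : X → X) (U : Set X) (_ : EqVF G F U) (z : ℝ → X) (ε : ℝ)
    (_ : 0 < ε) (_ : SolOn F U z (Ioi (-ε))) (_ : ContDiff ℝ (⊤ : ℕ∞) (fun h => G.T h (z 0))),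
    ContDiffOn ℝ k (fun p : ℝ × ℝ => G.T p.2 (z p.1)) (Ici 0 ×ˢ univ) := by
  induction k with
  | zero =>
    intro X _ _ _ G F U h z ε hε hz h0
    rw [Nat.cast_zero, contDiffOn_zero]
    intro p hp
    have hp1 : (0:ℝ) ≤ p.1 := hp.1
    have c1 : ContinuousAt z p.1 := (hz p.1 (by simp only [mem_Ioi]; linarith)).2.continuousAt
    have c2 : ContinuousAt (fun p : ℝ × ℝ => (p.2, z p.1)) p :=
      continuousAt_snd.prodMk (c1.comp continuousAt_fst)
    exact (G.continuous.continuousAt.comp c2).continuousWithinAt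
  | succ k ih =>
    intro X _ _ _ G F U h z ε hε hz h0
    set y₀ := deriv (fun h => G.T h (z 0)) 0 with hy₀
    have hd0 : HasDerivAt (fun h => G.T h (z 0)) y₀ 0 :=
      ((h0.differentiable (by simp)) 0).hasDerivAt
    obtain ⟨ε', hε', y, hy0, hzy⟩ := exists_tangent h hε hz y₀
    have h0' : HasDerivAt (fun h => G.T h (z 0)) (y 0) 0 := by rw [hy0]; exact hd0
    have dd : ∀ k, HasDerivAt (fun h => G.T h (z 0)) (G.T k (y 0)) k :=
      G.hasDerivAt_of_zero h0'
    have hs : ContDiff ℝ (⊤ : ℕ∞) (fun k => G.T k (y 0)) := by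
      have := (contDiff_infty_iff_deriv.1 h0).2
      have e : deriv (fun h => G.T h (z 0)) = fun k => G.T k (y 0) := funext fun k => (dd k).deriv
      rwa [e] at this
    have i1 := ih X G F U h z ε hε hz h0
    have i2 := ih (X × X) (G.prod G) (tanF F) (U ×ˢ univ) h.tan (fun t => (z t, y t)) ε' hε' hzy
      (h0.prodMk hs)
    have i3 : ContDiffOn ℝ k (fun p : ℝ × ℝ => G.T p.2 (y p.1)) (Ici 0 ×ˢ univ) := i2.snd
    have i4 : ContDiffOn ℝ k (fun p : ℝ × ℝ => F (G.T p.2 (z p.1))) (Ici 0 ×ˢ univ) := by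
      refine (h.smooth.of_le (by norm_cast <;> exact le_top)).comp i1 (fun p hp => ?_)
      have hp1 : (0:ℝ) ≤ p.1 := hp.1
      exact h.inv _ _ (hz p.1 (by simp only [mem_Ioi]; linarith)).1
    push_cast
    rw [contDiffOn_succ_iff_hasFDerivWithinAt_of_uniqueDiffOn
      ((uniqueDiffOn_Ici 0).prod uniqueDiffOn_univ)]
    refine ⟨fun hh => by simp at hh, fun p =>
      (ContinuousLinearMap.fst ℝ ℝ ℝ).smulRight (F (G.T p.2 (z p.1))) +
        (ContinuousLinearMap.snd ℝ ℝ ℝ).smulRight (G.T p.2 (y p.1)), ?_, ?_⟩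
    · exact (contDiffOn_const.smulRight i4).add (contDiffOn_const.smulRight i3)
    · intro p hp
      have hp1 : (0:ℝ) ≤ p.1 := hp.1
      have hzp := hz p.1 (by simp only [mem_Ioi]; linarith)
      simp only [h.eqv _ _ hzp.1]
      exact (G.hasFDerivAt_joint hzp.2
        (G.hasDerivAt_of_zero (hasDerivAt_orbit h hε' hzy h0' hp1) p.2)).hasFDerivWithinAt

/-- Regularity of equivariant flows. -/
theorem reg [CompleteSpace X] {G : Grp X} {F : X → X} {U : Set X} (h : EqVF G F U) {z : ℝ → X}
    {ε : ℝ} (hε : 0 < ε) (hz : SolOn F U z (Ioi (-ε)))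
    (h0 : ContDiff ℝ (⊤ : ℕ∞) (fun h => G.T h (z 0))) :
    ContDiffOn ℝ (⊤ : ℕ∞) (fun p : ℝ × ℝ => G.T p.2 (z p.1)) (Ici 0 ×ˢ univ) :=
  contDiffOn_infty.2 fun k => reg_nat k X G F U h z ε hε hz h0

end Reg
end GP

set_option linter.unusedSectionVars false
set_option linter.unusedSimpArgs false
set_option linter.unnecessarySeqFocus false
namespace GP
open Set Filter Topology

section Circle

instance instFactTwoPi : Fact (0 < 2 * π) := ⟨Real.two_pi_pos⟩

/-- The circle of length `2π`. -/
abbrev K := AddCircle (2 * π)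

variable {E : Type} [NormedAddCommGroup E] [NormedSpace ℝ E]
variable {F : Type} [NormedAddCommGroup F] [NormedSpace ℝ F]
variable {G : Type} [NormedAddCommGroup G] [NormedSpace ℝ G]

theorem ext_lift {f g : C(K, E)} (h : ∀ θ : ℝ, f (θ : K) = g (θ : K)) : f = g := by
  ext x
  obtain ⟨θ, rfl⟩ := QuotientAddGroup.mk_surjective x
  exact h θ

theorem lift_continuous (f : C(K, E)) : Continuous fun θ : ℝ => f (θ : K) :=
  f.continuous.comp (AddCircle.continuous_mk' _)

theorem lift_periodic (f : C(K, E)) : Function.Periodic (fun θ : ℝ => f (θ : K)) (2 * π) := by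
  intro θ
  simp only
  congr 1
  simp

/-- A continuous periodic function as a function on the circle. -/
def ofPer (g : ℝ → E) (hc : Continuous g) (hp : Function.Periodic g (2 * π)) : C(K, E) :=
  ⟨hp.lift, continuous_quot_lift _ hc⟩

@[simp] theorem ofPer_apply (g : ℝ → E) (hc : Continuous g) (hp : Function.Periodic g (2 * π))
    (θ : ℝ) : ofPer g hc hp (θ : K) = g θ := rfl

/-- pointwise bilinear operation -/
def bl (B : E →L[ℝ] F →L[ℝ] G) : C(K, E) →L[ℝ] C(K, F) →L[ℝ] C(K, G) :=
  LinearMap.mkContinuous₂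
    (LinearMap.mk₂ ℝ (fun (f : C(K, E)) (g : C(K, F)) =>
        (⟨fun x => B (f x) (g x), by fun_prop⟩ : C(K, G)))
      (fun f f' g => by ext x; simp) (fun c f g => by ext x; simp)
      (fun f g g' => by ext x; simp) (fun c f g => by ext x; simp)) ‖B‖ (by
    intro f g
    rw [ContinuousMap.norm_le _ (by positivity)]
    intro x
    simp only [LinearMap.mk₂_apply, ContinuousMap.coe_mk]
    refine (B.le_opNorm₂ _ _).trans ?_
    gcongr
    · exact f.norm_coe_le_norm x
    · exact g.norm_coe_le_norm x)

@[simp] theorem bl_apply (B : E →L[ℝ] F →L[ℝ] G) (f : C(K, E)) (g : C(K, F)) (x : K) :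
    bl B f g x = B (f x) (g x) := rfl

/-- pointwise linear operation -/
def pc (L : E →L[ℝ] F) : C(K, E) →L[ℝ] C(K, F) := L.compLeftContinuous ℝ K

@[simp] theorem pc_apply (L : E →L[ℝ] F) (f : C(K, E)) (x : K) : pc L f x = L (f x) := rfl

/-- constant functions -/
def cst : E →L[ℝ] C(K, E) := ContinuousLinearMap.const ℝ K

@[simp] theorem cst_apply (e : E) (x : K) : (cst e : C(K, E)) x = e := rfl

/-- translation -/
def tr (h : ℝ) : C(K, E) →L[ℝ] C(K, E) :=
  LinearMap.mkContinuous
    { toFun := fun f => (⟨fun x => f (x + (h : K)), by fun_prop⟩ : C(K, E))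
      map_add' := fun f g => by ext x; simp
      map_smul' := fun c f => by ext x; simp } 1 (by
    intro f
    rw [one_mul, ContinuousMap.norm_le _ (norm_nonneg _)]
    intro x
    exact f.norm_coe_le_norm _)

@[simp] theorem tr_apply (h : ℝ) (f : C(K, E)) (x : K) : tr h f x = f (x + (h : K)) := rfl

theorem tr_add (h k : ℝ) (f : C(K, E)) : tr (h + k) f = tr h (tr k f) := by
  ext x
  simp only [tr_apply, AddCircle.coe_add]
  congr 1
  abel

theorem tr_zero (f : C(K, E)) : tr 0 f = f := by
  ext x
  simp

theorem tr_norm_le (h : ℝ) (f : C(K, E)) : ‖tr h f‖ ≤ ‖f‖ := by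
  rw [ContinuousMap.norm_le _ (norm_nonneg _)]
  intro x
  exact f.norm_coe_le_norm _

theorem tr_cont (f : C(K, E)) : Continuous fun h => tr h f := by
  apply ContinuousMap.continuous_of_continuous_uncurry
  simp only [Function.uncurry_def, tr_apply]
  exact f.continuous.comp (continuous_snd.add ((AddCircle.continuous_mk' _).comp continuous_fst))

/-- The translation group. -/
def trG (E : Type) [NormedAddCommGroup E] [NormedSpace ℝ E] : Grp C(K, E) where
  T := tr
  zero := tr_zero
  add := tr_add
  norm h f := by
    refine le_antisymm (tr_norm_le h f) ?_
    have := tr_norm_le (-h) (tr h f)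
    rwa [← tr_add, neg_add_cancel, tr_zero] at this
  cont := tr_cont

theorem tr_bl (h : ℝ) (B : E →L[ℝ] F →L[ℝ] G) (f : C(K, E)) (g : C(K, F)) :
    tr h (bl B f g) = bl B (tr h f) (tr h g) := rfl

theorem tr_pc (h : ℝ) (L : E →L[ℝ] F) (f : C(K, E)) : tr h (pc L f) = pc L (tr h f) := rfl

theorem tr_cst (h : ℝ) (e : E) : tr h (cst e) = cst e := rfl

theorem tr_zero_apply (θ : ℝ) (f : C(K, E)) : tr θ f 0 = f (θ : K) := by simp

/-- integral over the circle -/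
def intg : C(K, E) →L[ℝ] E :=
  LinearMap.mkContinuous
    { toFun := fun f => ∫ θ in (0:ℝ)..(2 * π), f (θ : K)
      map_add' := fun f g => by
        simp only [ContinuousMap.add_apply]
        exact intervalIntegral.integral_add ((lift_continuous f).intervalIntegrable _ _)
          ((lift_continuous g).intervalIntegrable _ _)
      map_smul' := fun c f => by
        simp only [ContinuousMap.smul_apply]
        exact intervalIntegral.integral_smul _ _ } (2 * π) (by
    intro f
    have := intervalIntegral.norm_integral_le_of_norm_le_const (a := 0) (b := 2 * π)
      (f := fun θ : ℝ => f (θ : K)) (C := ‖f‖) (fun x _ => f.norm_coe_le_norm _)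
    rw [sub_zero, abs_of_pos Real.two_pi_pos] at this
    exact this.trans (mul_comm _ _).le)

theorem intg_apply (f : C(K, E)) : intg f = ∫ θ in (0:ℝ)..(2 * π), f (θ : K) := rfl

/-- The resolvent `(∂ - 1)⁻¹`. -/
def Lam : C(K, E) →L[ℝ] C(K, E) :=
  LinearMap.mkContinuous
    { toFun := fun f => (-(1 - Real.exp (-(2 * π)))⁻¹) •
        ∫ τ in (0:ℝ)..(2 * π), Real.exp (-τ) • tr τ f
      map_add' := fun f g => by
        rw [← smul_add, ← intervalIntegral.integral_add]
        · simp only [map_add, smul_add]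
        · exact ((by fun_prop : Continuous fun τ : ℝ => Real.exp (-τ)).smul
            (tr_cont f)).intervalIntegrable _ _
        · exact ((by fun_prop : Continuous fun τ : ℝ => Real.exp (-τ)).smul
            (tr_cont g)).intervalIntegrable _ _
      map_smul' := fun c f => by
        simp only [map_smul, RingHom.id_apply]
        rw [smul_comm c, ← intervalIntegral.integral_smul c]
        simp only [smul_comm c] } (|(1 - Real.exp (-(2 * π)))⁻¹| * (2 * π)) (by
    intro f
    have := intervalIntegral.norm_integral_le_of_norm_le_const (a := 0) (b := 2 * π)
      (f := fun τ : ℝ => Real.exp (-τ) • tr τ f) (C := ‖f‖) (fun x hx => by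
        rw [uIoc_of_le Real.two_pi_pos.le] at hx
        rw [norm_smul, Real.norm_eq_abs, abs_of_pos (Real.exp_pos _)]
        refine (mul_le_mul (Real.exp_le_one_iff.2 (by linarith [hx.1])) (tr_norm_le x f)
          (norm_nonneg _) zero_le_one).trans (by simp))
    rw [sub_zero, abs_of_pos Real.two_pi_pos] at this
    simp only [LinearMap.coe_mk, AddHom.coe_mk]
    rw [norm_smul, norm_neg, Real.norm_eq_abs, mul_assoc]
    gcongr
    linarith)

theorem Lam_apply (f : C(K, E)) : Lam f = (-(1 - Real.exp (-(2 * π)))⁻¹) •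
    ∫ τ in (0:ℝ)..(2 * π), Real.exp (-τ) • tr τ f := rfl

theorem kap_pos : 0 < 1 - Real.exp (-(2 * π)) := by
  have : Real.exp (-(2 * π)) < 1 := Real.exp_lt_one_iff.2 (by linarith [Real.two_pi_pos])
  linarith

variable [CompleteSpace E]

theorem tr_Lam (h : ℝ) (f : C(K, E)) : tr h (Lam f) = Lam (tr h f) := by
  rw [Lam_apply, Lam_apply, map_smul]
  rw [← ContinuousLinearMap.intervalIntegral_comp_comm]
  · congr 2
    funext τ
    rw [map_smul, ← tr_add, ← tr_add, add_comm]
  · exact ((by fun_prop : Continuous fun τ : ℝ => Real.exp (-τ)).smul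
      (tr_cont f)).intervalIntegrable _ _

theorem tr_period (s : ℝ) (f : C(K, E)) : tr (s + 2 * π) f = tr s f := by
  ext x
  simp

theorem hasDerivAt_tr_Lam (f : C(K, E)) (h : ℝ) :
    HasDerivAt (fun h => tr h (Lam f)) (tr h (f + Lam f)) h := by
  set φ : ℝ → C(K, E) := fun s => Real.exp (-s) • tr s f with hφ
  have hφc : Continuous φ := (by fun_prop : Continuous fun τ : ℝ => Real.exp (-τ)).smul (tr_cont f)
  set κ := (1 - Real.exp (-(2 * π)))⁻¹ with hκ
  have hκ0 : 1 - Real.exp (-(2 * π)) ≠ 0 := kap_pos.ne'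
  have e : ∀ h, tr h (Lam f) = (-κ * Real.exp h) •
      ((∫ s in (0:ℝ)..(h + 2 * π), φ s) - ∫ s in (0:ℝ)..h, φ s) := by
    intro h
    rw [tr_Lam, Lam_apply]
    rw [intervalIntegral.integral_interval_sub_left (hφc.intervalIntegrable _ _)
      (hφc.intervalIntegrable _ _)]
    have := intervalIntegral.integral_comp_add_right (a := 0) (b := 2 * π) φ h
    rw [zero_add, add_comm (2 * π) h] at this
    rw [← this, mul_smul, ← intervalIntegral.integral_smul (Real.exp h)]
    congr 2
    funext τ
    simp only [hφ]
    rw [smul_smul, ← Real.exp_add, tr_add]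
    congr 2
    ring
  have d1 : HasDerivAt (fun h => ∫ s in (0:ℝ)..(h + 2 * π), φ s) (φ (h + 2 * π)) h := by
    have := intervalIntegral.integral_hasDerivAt_right (hφc.intervalIntegrable 0 (h + 2 * π))
      (hφc.stronglyMeasurableAtFilter _ _) hφc.continuousAt
    exact HasDerivAt.comp_add_const (f := fun u => ∫ s in (0:ℝ)..u, φ s) h (2 * π) this
  have d2 : HasDerivAt (fun h => ∫ s in (0:ℝ)..h, φ s) (φ h) h :=
    intervalIntegral.integral_hasDerivAt_right (hφc.intervalIntegrable 0 h)
      (hφc.stronglyMeasurableAtFilter _ _) hφc.continuousAt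
  have d3 : HasDerivAt (fun h => -κ * Real.exp h) (-κ * Real.exp h) h :=
    (Real.hasDerivAt_exp h).const_mul _
  have d4 := d3.smul (d1.sub d2)
  refine (d4.congr_deriv ?_).congr_of_eventuallyEq (Eventually.of_forall e)
  rw [map_add, e h, add_comm (tr h f), add_comm]
  congr 1
  simp only [hφ, tr_period]
  rw [← sub_smul, smul_smul]
  have : -κ * Real.exp h * (Real.exp (-(h + 2 * π)) - Real.exp (-h)) = 1 := by
    rw [neg_add, Real.exp_add, Real.exp_neg h]
    have := Real.exp_pos h
    rw [hκ]
    field_simp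
    ring
  rw [this, one_smul]

/-- `g` is the derivative of `f`. -/
def Der (f g : C(K, E)) : Prop := ∀ θ : ℝ, HasDerivAt (fun x : ℝ => f (x : K)) (g (θ : K)) θ

theorem hasDerivAt_of_tr {f g : C(K, E)} (h : ∀ k, HasDerivAt (fun h => tr h f) (tr k g) k) :
    Der f g := by
  intro θ
  have := (ContinuousMap.evalCLM ℝ (0 : K)).hasFDerivAt.comp_hasDerivAt θ (h θ)
  simpa [Function.comp_def, ContinuousMap.evalCLM] using this

theorem Der_Lam (f : C(K, E)) : Der (Lam f) (f + Lam f) :=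
  hasDerivAt_of_tr (hasDerivAt_tr_Lam f)

theorem Der.add {f g f' g' : C(K, E)} (h : Der f f') (h' : Der g g') : Der (f + g) (f' + g') :=
  fun θ => (h θ).add (h' θ)

theorem Der.sub {f g f' g' : C(K, E)} (h : Der f f') (h' : Der g g') : Der (f - g) (f' - g') :=
  fun θ => (h θ).sub (h' θ)

theorem Der.eq_zero {f : C(K, E)} (h : Der f f) : f = 0 := by
  have c : ∀ θ : ℝ, HasDerivAt (fun x : ℝ => Real.exp (-x) • f (x : K)) 0 θ := by
    intro θ
    have h1 : HasDerivAt (fun x : ℝ => Real.exp (-x)) (-Real.exp (-θ)) θ := by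
      have := (Real.hasDerivAt_exp (-θ)).comp θ (hasDerivAt_neg θ)
      rw [mul_neg, mul_one] at this
      exact this
    refine (h1.smul (h θ)).congr_deriv ?_
    simp
  have c2 : ∀ x y : ℝ, Real.exp (-x) • f (x : K) = Real.exp (-y) • f (y : K) :=
    is_const_of_deriv_eq_zero (fun θ => (c θ).differentiableAt) (fun θ => (c θ).deriv)
  have hp := lift_periodic f
  apply ext_lift
  intro θ
  have h1 := c2 (θ + 2 * π) θ
  have h2 : f ((θ + 2 * π : ℝ) : K) = f (θ : K) := hp θ
  rw [h2, ← sub_eq_zero, ← sub_smul, smul_eq_zero] at h1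
  rcases h1 with h1 | h1
  · exfalso
    have : Real.exp (-(θ + 2 * π)) < Real.exp (-θ) := Real.exp_lt_exp.2 (by
      linarith [Real.two_pi_pos])
    linarith
  · simpa using h1

theorem der_iff {f g : C(K, E)} : Der f g ↔ f = Lam (g - f) := by
  constructor
  · intro h
    have h1 := h.sub (Der_Lam (g - f))
    have e : g - (g - f + Lam (g - f)) = f - Lam (g - f) := by abel
    rw [e] at h1
    exact sub_eq_zero.1 h1.eq_zero
  · intro h
    have h1 := Der_Lam (g - f)
    have e : g - f + Lam (g - f) = g := by rw [← h]; abel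
    rw [e, ← h] at h1
    exact h1

theorem Der.tr {f g : C(K, E)} (h : Der f g) (k : ℝ) :
    HasDerivAt (fun h => tr h f) (tr k g) k := by
  have e := der_iff.1 h
  have h1 := hasDerivAt_tr_Lam (g - f) k
  rw [← e] at h1
  simpa using h1

theorem Der.time {f g : ℝ → C(K, E)} {f' g' : C(K, E)} {t : ℝ} (hf : HasDerivAt f f' t)
    (hg : HasDerivAt g g' t) (h : ∀ᶠ s in 𝓝 t, Der (f s) (g s)) : Der f' g' := by
  rw [der_iff]
  have h1 : HasDerivAt (fun s => Lam (g s - f s)) (Lam (g' - f')) t :=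
    (Lam (E := E)).hasFDerivAt.comp_hasDerivAt t (hg.sub hf)
  refine hf.unique (h1.congr_of_eventuallyEq ?_)
  filter_upwards [h] with s hs using der_iff.1 hs

theorem Der.intg {f g : C(K, E)} (h : Der f g) : intg g = 0 := by
  rw [intg_apply, intervalIntegral.integral_eq_sub_of_hasDerivAt (fun x _ => h x)
    ((lift_continuous g).intervalIntegrable _ _)]
  have := lift_periodic f 0
  simp only [zero_add] at this
  rw [this, sub_self]

theorem Der.bl (B : E →L[ℝ] F →L[ℝ] G) {f f' : C(K, E)} {g g' : C(K, F)} (h : Der f f')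
    (h' : Der g g') : Der (bl B f g) (bl B f' g + bl B f g') := by
  intro θ
  have := B.hasDerivAt_of_bilinear (fun _ => h θ) (fun _ => h' θ)
  refine this.congr_deriv ?_
  simp [add_comm]

theorem Der.pc (L : E →L[ℝ] F) {f f' : C(K, E)} (h : Der f f') : Der (pc L f) (pc L f') :=
  fun θ => L.hasFDerivAt.comp_hasDerivAt θ (h θ)

theorem Der.unique {f g g' : C(K, E)} (h : Der f g) (h' : Der f g') : g = g' :=
  ext_lift fun θ => (h θ).unique (h' θ)

theorem tr_contDiff {f : C(K, E)} (hf : ContDiff ℝ (⊤ : ℕ∞) fun θ : ℝ => f (θ : K)) :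
    ContDiff ℝ (⊤ : ℕ∞) fun h => tr h f := by
  rw [contDiff_infty]
  intro n
  induction n generalizing f with
  | zero =>
    rw [Nat.cast_zero, contDiff_zero]
    exact tr_cont f
  | succ n ih =>
    have hd := (contDiff_infty_iff_deriv.1 hf).2
    have hp : Function.Periodic (deriv fun θ : ℝ => f (θ : K)) (2 * π) := by
      intro θ
      rw [← deriv_comp_add_const]
      congr 1
      funext x
      exact lift_periodic f x
    set g : C(K, E) := ofPer _ hd.continuous hp with hg
    have hder : Der f g := fun θ => by
      rw [hg, ofPer_apply]
      exact ((hf.differentiable (by simp)) θ).hasDerivAt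
    push_cast
    rw [contDiff_succ_iff_deriv]
    refine ⟨fun k => (hder.tr k).differentiableAt, by simp, ?_⟩
    have e : deriv (fun h => tr h f) = fun k => tr k g := funext fun k => (hder.tr k).deriv
    rw [e]
    exact ih (f := g) (by simpa only [hg, ofPer_apply] using hd)

end Circle
end GP

set_option linter.unusedSectionVars false
set_option linter.unusedSimpArgs false
set_option linter.unnecessarySeqFocus false
namespace GP
open Set Filter Topology

section Lin

/-- positive functions -/
def Pos : Set C(K, ℝ) := {ρ | ∀ x, 0 < ρ x}

theorem isOpen_Pos : IsOpen Pos := by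
  have := ContinuousMap.isOpen_setOfPred_mapsTo (X := K) (Y := ℝ) isCompact_univ
    (isOpen_Ioi (a := (0:ℝ)))
  convert this using 1
  ext ρ
  simp [Pos, MapsTo]

variable {E : Type} [NormedAddCommGroup E] [NormedSpace ℝ E]

/-- pointwise scalar multiplication -/
def sm : C(K, ℝ) →L[ℝ] C(K, E) →L[ℝ] C(K, E) := bl (ContinuousLinearMap.lsmul ℝ ℝ)

@[simp] theorem sm_apply (ρ : C(K, ℝ)) (w : C(K, E)) (x : K) : sm ρ w x = ρ x • w x := rfl

/-- The operator `1 - Λ (ρ A - 1)`. -/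
def Mop (A : E →L[ℝ] E) (ρ : C(K, ℝ)) : C(K, E) →L[ℝ] C(K, E) :=
  1 - Lam ∘L ((sm ρ) ∘L (pc A) - 1)

theorem Mop_apply (A : E →L[ℝ] E) (ρ : C(K, ℝ)) (W : C(K, E)) :
    Mop A ρ W = W - Lam (sm ρ (pc A W) - W) := rfl

variable [CompleteSpace E]

theorem der_Mop_iff (A : E →L[ℝ] E) (ρ : C(K, ℝ)) (W f : C(K, E)) :
    Der W (sm ρ (pc A W) + f) ↔ Mop A ρ W = Lam f := by
  rw [der_iff, Mop_apply]
  have : sm ρ (pc A W) + f - W = (sm ρ (pc A W) - W) + f := by abel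
  rw [this, map_add]
  constructor
  · intro h
    nth_rw 1 [h]; abel
  · intro h
    rw [← h]; abel

/-- Non-resonance: no nontrivial periodic solutions of the homogeneous system. -/
def NonRes (A : E →L[ℝ] E) : Prop :=
  ∀ ρ ∈ Pos, ∀ W : C(K, E), Der W (sm ρ (pc A W)) → W = 0

theorem exp_der (A : E →L[ℝ] E) {s : ℝ → ℝ} {s' θ : ℝ} (hs : HasDerivAt s s' θ) :
    HasDerivAt (fun θ => NormedSpace.exp (s θ • A)) (s' • (A * NormedSpace.exp (s θ • A))) θ := by
  have := (hasDerivAt_exp_smul_const' (𝕂 := ℝ) A (s θ)).scomp θ hs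
  exact this

theorem exp_add' (A : E →L[ℝ] E) (s t : ℝ) :
    NormedSpace.exp ((s + t) • A) = NormedSpace.exp (s • A) * NormedSpace.exp (t • A) := by
  let _ : NormedAlgebra ℚ (E →L[ℝ] E) := NormedAlgebra.restrictScalars ℚ ℝ _
  have hc : Commute (s • A) (t • A) := ((Commute.refl A).smul_left _).smul_right _
  rw [← NormedSpace.exp_add_of_commute hc, ← add_smul]

theorem exp_neg_mul (A : E →L[ℝ] E) (s : ℝ) :
    NormedSpace.exp ((-s) • A) * NormedSpace.exp (s • A) = 1 := by
  rw [← exp_add']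
  simp

theorem exp_mul_neg (A : E →L[ℝ] E) (s : ℝ) :
    NormedSpace.exp (s • A) * NormedSpace.exp ((-s) • A) = 1 := by
  have := exp_neg_mul A (-s)
  rwa [neg_neg] at this

theorem exp_comm' (A : E →L[ℝ] E) (s : ℝ) :
    A * NormedSpace.exp (s • A) = NormedSpace.exp (s • A) * A :=
  (((Commute.refl A).smul_right s).exp_right)

/-- homogeneous solutions are exponentials -/
theorem hom_sol (A : E →L[ℝ] E) {s r : ℝ → ℝ} (hs : ∀ θ, HasDerivAt s (r θ) θ) {D : ℝ → E}
    (hD : ∀ θ, HasDerivAt D (r θ • A (D θ)) θ) (h0 : D 0 = 0) : ∀ θ, D θ = 0 := by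
  have c : ∀ θ : ℝ, HasDerivAt (fun x : ℝ => NormedSpace.exp ((-s x) • A) (D x)) 0 θ := by
    intro θ
    have h1 := (exp_der A (hs θ).neg).clm_apply (hD θ)
    refine h1.congr_deriv ?_
    simp only [Pi.neg_apply]
    rw [exp_comm']
    simp [mul_apply_eq_comp]
  have c2 : ∀ x y : ℝ, NormedSpace.exp ((-s x) • A) (D x) = NormedSpace.exp ((-s y) • A) (D y) :=
    is_const_of_deriv_eq_zero (fun θ => (c θ).differentiableAt) (fun θ => (c θ).deriv)
  intro θ
  have h1 := c2 θ 0
  rw [h0, map_zero] at h1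
  have h2 : (NormedSpace.exp (s θ • A) * NormedSpace.exp ((-s θ) • A)) (D θ) = 0 := by
    rw [mul_apply_eq_comp, h1, map_zero]
  rw [exp_mul_neg] at h2
  simpa using h2

theorem solve [FiniteDimensional ℝ E] {A : E →L[ℝ] E} (hA : NonRes A) {ρ : C(K, ℝ)}
    (hρ : ρ ∈ Pos) (f : C(K, E)) : ∃ W : C(K, E), Der W (sm ρ (pc A W) + f) := by
  set s : ℝ → ℝ := fun θ => ∫ x in (0:ℝ)..θ, ρ (x : K) with hs
  have hρc := lift_continuous ρ
  have hsd : ∀ θ : ℝ, HasDerivAt s (ρ (θ : K)) θ := fun θ =>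
    intervalIntegral.integral_hasDerivAt_right (hρc.intervalIntegrable 0 θ)
      (hρc.stronglyMeasurableAtFilter _ _) hρc.continuousAt
  have hs0 : s 0 = 0 := by simp [hs]
  set ℓ := s (2 * π) with hℓ
  have hsp : ∀ θ, s (θ + 2 * π) = s θ + ℓ := by
    intro θ
    have hd : ∀ x : ℝ, HasDerivAt (fun x => s (x + 2 * π) - s x) 0 x := by
      intro x
      have h1 := HasDerivAt.comp_add_const (f := s) x (2 * π) (hsd (x + 2 * π))
      refine (h1.sub (hsd x)).congr_deriv ?_
      have := lift_periodic ρ x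
      simp only at this
      rw [this, sub_self]
    have := is_const_of_deriv_eq_zero (fun θ => (hd θ).differentiableAt) (fun θ => (hd θ).deriv)
      θ 0
    simp only [zero_add, hs0, sub_zero] at this
    linarith
  -- injectivity of `1 - exp(ℓ A)`
  have hinj : ∀ x : E, NormedSpace.exp (ℓ • A) x = x → x = 0 := by
    intro x hx
    have hd : ∀ θ : ℝ, HasDerivAt (fun θ => NormedSpace.exp (s θ • A) x)
        (ρ (θ : K) • A (NormedSpace.exp (s θ • A) x)) θ := by
      intro θ
      have := (exp_der A (hsd θ)).clm_apply (hasDerivAt_const θ x)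
      simpa using this
    have hp : Function.Periodic (fun θ => NormedSpace.exp (s θ • A) x) (2 * π) := by
      intro θ
      simp only
      rw [hsp, exp_add', mul_apply_eq_comp, hx]
    have h1 := hA ρ hρ (ofPer _ (continuous_iff_continuousAt.2 fun θ => (hd θ).continuousAt) hp)
      (fun θ => hd θ)
    have h2 := congrArg (fun W : C(K, E) => W ((0:ℝ) : K)) h1
    simp only [ofPer_apply, hs0] at h2
    simpa using h2
  set fl : ℝ → E := fun θ => NormedSpace.exp ((-s θ) • A) (f (θ : K)) with hfl
  have hflc : Continuous fl := by
    have : Continuous fun θ => NormedSpace.exp ((-s θ) • A) :=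
      continuous_iff_continuousAt.2 fun θ => (exp_der A (hsd θ).neg).continuousAt
    exact this.clm_apply (lift_continuous f)
  set y : ℝ → E := fun θ => ∫ x in (0:ℝ)..θ, fl x with hy
  have hyd : ∀ θ, HasDerivAt y (fl θ) θ := fun θ =>
    intervalIntegral.integral_hasDerivAt_right (hflc.intervalIntegrable 0 θ)
      (hflc.stronglyMeasurableAtFilter _ _) hflc.continuousAt
  obtain ⟨x, hx⟩ : ∃ x : E, x - NormedSpace.exp (ℓ • A) x = NormedSpace.exp (ℓ • A) (y (2 * π)) := by
    have hi : Function.Injective (((1 : E →L[ℝ] E) - NormedSpace.exp (ℓ • A) : E →L[ℝ] E) :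
        E →ₗ[ℝ] E) := by
      rw [injective_iff_map_eq_zero]
      intro x hx
      apply hinj
      have hx' : x - NormedSpace.exp (ℓ • A) x = 0 := hx
      exact (sub_eq_zero.1 hx').symm
    obtain ⟨x, hx⟩ := (LinearMap.injective_iff_surjective.1 hi) (NormedSpace.exp (ℓ • A) (y (2 * π)))
    exact ⟨x, hx⟩
  set V : ℝ → E := fun θ => NormedSpace.exp (s θ • A) (x + y θ) with hV
  have hVd : ∀ θ : ℝ, HasDerivAt V (ρ (θ : K) • A (V θ) + f (θ : K)) θ := by
    intro θ
    have := (exp_der A (hsd θ)).clm_apply ((hyd θ).const_add x)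
    refine this.congr_deriv ?_
    simp only [hfl]
    rw [← mul_apply_eq_comp (NormedSpace.exp (s θ • A)), exp_mul_neg]
    simp [hV]
  have hVp : Function.Periodic V (2 * π) := by
    have := hom_sol A hsd (D := fun θ => V (θ + 2 * π) - V θ) (fun θ => by
      have h1 := HasDerivAt.comp_add_const (f := V) θ (2 * π) (hVd (θ + 2 * π))
      refine (h1.sub (hVd θ)).congr_deriv ?_
      have e1 := lift_periodic ρ θ
      have e2 := lift_periodic f θ
      simp only at e1 e2
      rw [e1, e2, map_sub, smul_sub]
      abel) (by
      simp only [zero_add, hV, hs0]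
      simp only [zero_smul, NormedSpace.exp_zero, ← hℓ, map_add, ← hx]
      have : y 0 = 0 := by simp [hy]
      rw [this]
      simp)
    intro θ
    exact sub_eq_zero.1 (this θ)
  refine ⟨ofPer V (continuous_iff_continuousAt.2 fun θ => (hVd θ).continuousAt) hVp, fun θ => ?_⟩
  exact hVd θ

theorem isUnit_Mop [FiniteDimensional ℝ E] {A : E →L[ℝ] E} (hA : NonRes A) {ρ : C(K, ℝ)}
    (hρ : ρ ∈ Pos) : IsUnit (Mop A ρ) := by
  rw [ContinuousLinearMap.isUnit_iff_bijective]
  constructor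
  · rw [injective_iff_map_eq_zero]
    intro W hW
    have := (der_Mop_iff A ρ W 0).2 (by rw [hW, map_zero])
    rw [add_zero] at this
    exact hA ρ hρ W this
  · intro H
    obtain ⟨V, hV⟩ := solve hA hρ (sm ρ (pc A H) - H)
    rw [der_Mop_iff] at hV
    refine ⟨H + V, ?_⟩
    rw [map_add, hV, Mop_apply]
    abel

theorem Mop_contDiff (A : E →L[ℝ] E) : ContDiff ℝ (⊤ : ℕ∞) (Mop A) := by
  have h1 : ContDiff ℝ (⊤ : ℕ∞) (fun ρ : C(K, ℝ) => (sm ρ : C(K, E) →L[ℝ] C(K, E))) :=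
    ContinuousLinearMap.contDiff (sm (E := E))
  have h2 : ContDiff ℝ (⊤ : ℕ∞) (fun ρ : C(K, ℝ) =>
      (Lam (E := E)) ∘L ((sm ρ) ∘L (pc A) - 1)) :=
    contDiff_const.clm_comp ((h1.clm_comp contDiff_const).sub contDiff_const)
  exact contDiff_const.sub h2

/-- inverse of `Mop` -/
def Minv (A : E →L[ℝ] E) (ρ : C(K, ℝ)) : C(K, E) →L[ℝ] C(K, E) := Ring.inverse (Mop A ρ)

theorem Minv_contDiffAt [FiniteDimensional ℝ E] {A : E →L[ℝ] E} (hA : NonRes A) {ρ : C(K, ℝ)}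
    (hρ : ρ ∈ Pos) : ContDiffAt ℝ (⊤ : ℕ∞) (Minv A) ρ := by
  obtain ⟨u, hu⟩ := isUnit_Mop hA hρ
  have h1 : ContDiffAt ℝ (⊤ : ℕ∞) Ring.inverse (Mop A ρ) := by
    rw [← hu]
    exact contDiffAt_ringInverse ℝ u
  exact h1.comp ρ (Mop_contDiff A).contDiffAt

/-- solution operator -/
def Wsol (A : E →L[ℝ] E) (ρ : C(K, ℝ)) (f : C(K, E)) : C(K, E) := Minv A ρ (Lam f)

theorem Wsol_der [FiniteDimensional ℝ E] {A : E →L[ℝ] E} (hA : NonRes A) {ρ : C(K, ℝ)}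
    (hρ : ρ ∈ Pos) (f : C(K, E)) :
    Der (Wsol A ρ f) (sm ρ (pc A (Wsol A ρ f)) + f) := by
  rw [der_Mop_iff, Wsol, Minv, ← mul_apply_eq_comp,
    Ring.mul_inverse_cancel _ (isUnit_Mop hA hρ)]
  rfl

theorem Wsol_unique [FiniteDimensional ℝ E] {A : E →L[ℝ] E} (hA : NonRes A) {ρ : C(K, ℝ)}
    (hρ : ρ ∈ Pos) {f W : C(K, E)} (h : Der W (sm ρ (pc A W) + f)) : W = Wsol A ρ f := by
  rw [der_Mop_iff] at h
  rw [Wsol, Minv, ← h, ← mul_apply_eq_comp,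
    Ring.inverse_mul_cancel _ (isUnit_Mop hA hρ)]
  rfl

theorem Der.shift {f g : C(K, E)} (h : Der f g) (k : ℝ) : Der (GP.tr k f) (GP.tr k g) := by
  intro θ
  have := HasDerivAt.comp_add_const (f := fun x : ℝ => f (x : K)) θ k (h (θ + k))
  simpa only [tr_apply, AddCircle.coe_add] using this

theorem Pos_tr {ρ : C(K, ℝ)} (hρ : ρ ∈ Pos) (k : ℝ) : tr k ρ ∈ Pos := fun _ => hρ _

theorem Wsol_tr [FiniteDimensional ℝ E] {A : E →L[ℝ] E} (hA : NonRes A) {ρ : C(K, ℝ)}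
    (hρ : ρ ∈ Pos) (f : C(K, E)) (k : ℝ) :
    Wsol A (tr k ρ) (tr k f) = tr k (Wsol A ρ f) := by
  symm
  apply Wsol_unique hA (Pos_tr hρ k)
  have := (Wsol_der hA hρ f).shift k
  rw [map_add] at this
  exact this

end Lin
end GP

set_option linter.unusedSectionVars false
set_option linter.unusedSimpArgs false
set_option linter.unnecessarySeqFocus false
namespace GP
open Set Filter Topology

section Sys

/-- pointwise inner product -/
def ip : C(K, R2) →L[ℝ] C(K, R2) →L[ℝ] C(K, ℝ) := bl (innerSL ℝ)

@[simp] theorem ip_apply (f g : C(K, R2)) (x : K) : ip f g x = ⟪f x, g x⟫ := rfl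

theorem ip_comm (f g : C(K, R2)) : ip f g = ip g f := by
  ext x; simp [real_inner_comm]

/-- weighted pairing -/
def PP (ρ : C(K, ℝ)) (f g : C(K, R2)) : ℝ := intg (sm ρ (ip f g))

theorem PP_eq_right (ρ : C(K, ℝ)) (f g : C(K, R2)) : PP ρ f g = intg (ip f (sm ρ g)) := by
  unfold PP; congr 1; ext x; simp [inner_smul_right]

theorem PP_eq_left (ρ : C(K, ℝ)) (f g : C(K, R2)) : PP ρ f g = intg (ip (sm ρ f) g) := by
  unfold PP; congr 1; ext x; simp [inner_smul_left]

theorem PP_comm (ρ : C(K, ℝ)) (f g : C(K, R2)) : PP ρ f g = PP ρ g f := by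
  unfold PP; rw [ip_comm]

theorem ibp {f g f' g' : C(K, R2)} (hf : Der f f') (hg : Der g g') :
    intg (ip f' g) + intg (ip f g') = 0 := by
  rw [← map_add]
  exact (Der.bl (innerSL ℝ) hf hg).intg

theorem ibp' {ρ : C(K, ℝ)} {f g f' g' : C(K, R2)} (hf : Der f (sm ρ f')) (hg : Der g (sm ρ g')) :
    PP ρ f' g = - PP ρ f g' := by
  rw [PP_eq_left, PP_eq_right]
  linarith [ibp hf hg]

/-- The elliptic system. -/
structure Sys (a : ℕ → ℝ) (n : ℕ) (ρ : C(K, ℝ)) (q : C(K, R2)) (p : R2)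
    (w : ℕ → C(K, R2)) (m : C(K, R2)) : Prop where
  dw : ∀ j, j + 1 ≤ 2 * n - 1 → Der (w j) (sm ρ (w (j + 1)))
  dm : Der m (cst p - a 0 • sm ρ (w 0))
  alg : ∑ j ∈ Finset.Icc 1 n, ((-1 : ℝ) ^ j * a j) • w (2 * j - 1) = m + q

variable {a : ℕ → ℝ} {n : ℕ} {ρ : C(K, ℝ)} {q : C(K, R2)} {p : R2}
    {w : ℕ → C(K, R2)} {m : C(K, R2)}

theorem Sys.pp (h : Sys a n ρ q p w m) {i j : ℕ} (hi : i + 1 ≤ 2 * n - 1) (hj : j + 1 ≤ 2 * n - 1) :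
    PP ρ (w (i + 1)) (w j) = - PP ρ (w i) (w (j + 1)) :=
  ibp' (h.dw i hi) (h.dw j hj)

theorem Sys.pp_shift (h : Sys a n ρ q p w m) {k : ℕ} (hk : 1 ≤ k) (hkn : k ≤ n) :
    ∀ i, i + 1 ≤ k → PP ρ (w (2 * k - 1)) (w 1) = (-1) ^ i * PP ρ (w (2 * k - 1 - i)) (w (1 + i)) := by
  intro i
  induction i with
  | zero => intro _; simp
  | succ i ih =>
    intro hi
    rw [ih (by omega)]
    have := h.pp (i := 2 * k - 1 - (i + 1)) (j := 1 + i) (by omega) (by omega)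
    rw [show 2 * k - 1 - (i + 1) + 1 = 2 * k - 1 - i by omega] at this
    rw [this, show 1 + i + 1 = 1 + (i + 1) by omega]
    ring

theorem Sys.pp_mid (h : Sys a n ρ q p w m) {k : ℕ} (hk : 1 ≤ k) (hkn : k ≤ n) :
    (-1) ^ k * PP ρ (w (2 * k - 1)) (w 1) = - PP ρ (w k) (w k) := by
  rw [h.pp_shift hk hkn (k - 1) (by omega)]
  rw [show 2 * k - 1 - (k - 1) = k by omega, show 1 + (k - 1) = k by omega]
  obtain ⟨l, rfl⟩ : ∃ l, k = l + 1 := ⟨k - 1, by omega⟩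
  have : (-1 : ℝ) ^ l * (-1) ^ l = 1 := by rw [← mul_pow]; simp
  simp only [Nat.add_sub_cancel, pow_succ]
  linear_combination (-PP ρ (w (l + 1)) (w (l + 1))) * this

theorem PP_add_left (ρ : C(K, ℝ)) (f f' g : C(K, R2)) : PP ρ (f + f') g = PP ρ f g + PP ρ f' g := by
  simp [PP]

theorem PP_smul_left (ρ : C(K, ℝ)) (r : ℝ) (f g : C(K, R2)) : PP ρ (r • f) g = r * PP ρ f g := by
  simp [PP]

theorem PP_sum_left {ι : Type} (s : Finset ι) (ρ : C(K, ℝ)) (f : ι → C(K, R2)) (g : C(K, R2)) :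
    PP ρ (∑ i ∈ s, f i) g = ∑ i ∈ s, PP ρ (f i) g := by
  simp [PP]

/-- energy -/
def En (a : ℕ → ℝ) (n : ℕ) (ρ : C(K, ℝ)) (w : ℕ → C(K, R2)) : ℝ :=
  ∑ j ∈ Finset.range (n + 1), a j * PP ρ (w j) (w j)

theorem range_eq_Icc (n : ℕ) (f : ℕ → ℝ) :
    ∑ j ∈ Finset.range (n + 1), f j = f 0 + ∑ j ∈ Finset.Icc 1 n, f j := by
  rw [Finset.sum_range_succ', add_comm]
  congr 1
  rw [Finset.range_eq_Ico, Finset.sum_Ico_add' f 0 n 1]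
  rfl

theorem Sys.energy (h : Sys a n ρ q p w m) (hn : 2 ≤ n) :
    En a n ρ w = intg (ip (cst p) (w 0)) - PP ρ q (w 1) := by
  have h1 : PP ρ (∑ j ∈ Finset.Icc 1 n, ((-1 : ℝ) ^ j * a j) • w (2 * j - 1)) (w 1)
      = - ∑ j ∈ Finset.Icc 1 n, a j * PP ρ (w j) (w j) := by
    rw [PP_sum_left, ← Finset.sum_neg_distrib]
    refine Finset.sum_congr rfl fun j hj => ?_
    rw [Finset.mem_Icc] at hj
    rw [PP_smul_left]
    linear_combination a j * h.pp_mid hj.1 hj.2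
  rw [h.alg, PP_add_left] at h1
  have h2 := ibp h.dm (h.dw 0 (by omega))
  rw [← PP_eq_right] at h2
  have h3 : intg (ip (cst p - a 0 • sm ρ (w 0)) (w 0)) =
      intg (ip (cst p) (w 0)) - a 0 * PP ρ (w 0) (w 0) := by
    rw [PP_eq_left]; simp
  rw [En, range_eq_Icc]
  simp only [zero_add] at h2
  linarith

theorem intg_nonneg {f : C(K, ℝ)} (h : ∀ x, 0 ≤ f x) : 0 ≤ intg f := by
  rw [intg_apply]
  exact intervalIntegral.integral_nonneg (by positivity) fun x _ => h _

theorem PP_self_nonneg (hρ : ρ ∈ Pos) (f : C(K, R2)) : 0 ≤ PP ρ f f := by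
  refine intg_nonneg fun x => ?_
  simp only [sm_apply, ip_apply, smul_eq_mul, real_inner_self_eq_norm_sq]
  have := hρ x
  positivity

theorem exists_rep (x : K) : ∃ θ ∈ Ioc (0:ℝ) (2 * π), (θ : K) = x := by
  have h := AddCircle.coe_image_Ioc_eq (p := 2 * π) 0
  have hx : x ∈ (univ : Set K) := mem_univ x
  rw [← h] at hx
  obtain ⟨θ, hθ, e⟩ := hx
  rw [zero_add] at hθ
  exact ⟨θ, hθ, e⟩

theorem intg_eq_zero {f : C(K, ℝ)} (h : ∀ x, 0 ≤ f x) (h0 : intg f = 0) : f = 0 := by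
  rw [intg_apply] at h0
  have hc := lift_continuous f
  have h1 := (intervalIntegral.integral_eq_zero_iff_of_le_of_nonneg_ae (μ := volume)
    (f := fun x : ℝ => f (x : K)) (a := 0) (b := 2 * π) (by positivity)
    (Eventually.of_forall fun x => h _) (hc.intervalIntegrable _ _)).1 h0
  have h2 := MeasureTheory.Measure.eqOn_Ioc_of_ae_eq _ h1 hc.continuousOn continuousOn_const
  ext x
  obtain ⟨θ, hθ, rfl⟩ := exists_rep x
  exact h2 hθ

theorem PP_self_eq_zero (hρ : ρ ∈ Pos) {f : C(K, R2)} (h : PP ρ f f = 0) : f = 0 := by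
  have h1 := intg_eq_zero (f := sm ρ (ip f f)) (fun x => by
    simp only [sm_apply, ip_apply, smul_eq_mul, real_inner_self_eq_norm_sq]
    have := hρ x
    positivity) h
  ext1 x
  have h2 := congrArg (fun F : C(K, ℝ) => F x) h1
  have := hρ x
  simpa [this.ne'] using h2

theorem sm_eq_zero (hρ : ρ ∈ Pos) {f : C(K, R2)} (h : sm ρ f = 0) : f = 0 := by
  ext1 x
  have h2 := congrArg (fun F : C(K, R2) => F x) h
  have := hρ x
  simpa [this.ne'] using h2

theorem Der.zero {E : Type} [NormedAddCommGroup E] [NormedSpace ℝ E] : Der (0 : C(K, E)) 0 :=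
  fun θ => hasDerivAt_const θ (0 : E)

theorem Sys.trivial (h : Sys a n ρ 0 0 w m) (hρ : ρ ∈ Pos) (hn : 2 ≤ n) (ha : ∀ j ≤ n, 0 ≤ a j)
    (ha0 : 0 < a 0) : (∀ j ≤ 2 * n - 1, w j = 0) ∧ m = 0 := by
  have h1 := h.energy hn
  have h2 : En a n ρ w = 0 := by
    rw [h1]; simp [PP]
  rw [En, Finset.sum_eq_zero_iff_of_nonneg (fun j hj => mul_nonneg (ha j (by
    rw [Finset.mem_range] at hj; omega)) (PP_self_nonneg hρ _))] at h2
  have h3 := h2 0 (by simp)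
  have h4 : w 0 = 0 := PP_self_eq_zero hρ (by simpa [ha0.ne'] using h3)
  have h5 : ∀ j ≤ 2 * n - 1, w j = 0 := by
    intro j
    induction j with
    | zero => intro _; exact h4
    | succ j ih =>
      intro hj
      have := h.dw j hj
      rw [ih (by omega)] at this
      exact sm_eq_zero hρ (this.unique Der.zero)
  refine ⟨h5, ?_⟩
  have := h.alg
  rw [add_zero] at this
  rw [← this]
  refine Finset.sum_eq_zero fun j hj => ?_
  rw [Finset.mem_Icc] at hj
  rw [h5 _ (by omega)]
  exact smul_zero (M := ℝ) (A := C(K, R2)) _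

/-! ### first order form -/

/-- phase space of the first order system -/
abbrev EE (n : ℕ) := Fin (2 * n) → R2

/-- coordinate projection -/
def pr (n i : ℕ) : EE n →L[ℝ] R2 :=
  if h : i < 2 * n then ContinuousLinearMap.proj (R := ℝ) (φ := fun _ : Fin (2 * n) => R2) ⟨i, h⟩
    else 0

theorem pr_apply {n i : ℕ} (h : i < 2 * n) (W : EE n) : pr n i W = W ⟨i, h⟩ := by
  simp [pr, h]

/-- leading coefficient -/
def bb (a : ℕ → ℝ) (n : ℕ) : ℝ := ((-1) ^ n * a n)⁻¹

/-- top derivative -/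
def topL (a : ℕ → ℝ) (n : ℕ) : EE n →L[ℝ] R2 :=
  bb a n • (pr n (2 * n - 1) - ∑ j ∈ Finset.Ico 1 n, ((-1 : ℝ) ^ j * a j) • pr n (2 * j - 1))

/-- coefficient matrix -/
def AA (a : ℕ → ℝ) (n : ℕ) : EE n →L[ℝ] EE n :=
  ContinuousLinearMap.pi fun i : Fin (2 * n) =>
    if (i : ℕ) < 2 * n - 2 then pr n (i + 1) else if (i : ℕ) = 2 * n - 2 then topL a n
      else (- a 0) • pr n 0

/-- forcing matrix -/
def BB (a : ℕ → ℝ) (n : ℕ) : R2 →L[ℝ] EE n :=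
  ContinuousLinearMap.pi fun i : Fin (2 * n) =>
    if (i : ℕ) = 2 * n - 2 then bb a n • ContinuousLinearMap.id ℝ R2 else 0

/-- constant forcing -/
def beta (n : ℕ) : R2 →L[ℝ] EE n :=
  ContinuousLinearMap.pi fun i : Fin (2 * n) =>
    if (i : ℕ) = 2 * n - 1 then ContinuousLinearMap.id ℝ R2 else 0

/-- forcing term -/
def forc (a : ℕ → ℝ) (n : ℕ) (p : R2) (ρ : C(K, ℝ)) (q : C(K, R2)) : C(K, EE n) :=
  sm ρ (pc (BB a n) q) + cst (beta n p)

/-- the derivatives, read off from the first order vector -/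
def rd (a : ℕ → ℝ) (n : ℕ) (q : C(K, R2)) (W : C(K, EE n)) (j : ℕ) : C(K, R2) :=
  if j < 2 * n - 1 then pc (pr n j) W else pc (topL a n) W + bb a n • q

theorem Der_pi {n : ℕ} {W V : C(K, EE n)} :
    Der W V ↔ ∀ i < 2 * n, Der (pc (pr n i) W) (pc (pr n i) V) := by
  constructor
  · intro h i _
    exact h.pc _
  · intro h θ
    rw [hasDerivAt_pi]
    intro i
    have := h i i.2 θ
    simpa only [pc_apply, pr_apply i.2] using this

theorem sys_of_W (hn : 2 ≤ n) (han : 0 < a n) {W : C(K, EE n)}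
    (h : Der W (sm ρ (pc (AA a n) W) + forc a n p ρ q)) :
    Sys a n ρ q p (rd a n q W) (pc (pr n (2 * n - 1)) W) := by
  rw [Der_pi] at h
  refine ⟨?_, ?_, ?_⟩
  · intro j hj
    have h1 := h j (by omega)
    rw [rd, if_pos (by omega)]
    convert h1 using 1
    ext1 x
    by_cases hj' : j < 2 * n - 2
    · rw [rd, if_pos (by omega)]
      simp [pr_apply (show j < 2 * n by omega), AA, forc, BB, beta, hj', hj'.ne,
        (show j ≠ 2 * n - 1 by omega)]
    · have e : j = 2 * n - 2 := by omega
      rw [rd, if_neg (by omega)]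
      simp [pr_apply (show 2 * n - 2 < 2 * n by omega), AA, forc, BB, beta, hj', e,
        (show 2 * n - 2 ≠ 2 * n - 1 by omega)]
      rw [smul_comm]
  · have h1 := h (2 * n - 1) (by omega)
    convert h1 using 1
    ext1 x
    rw [rd, if_pos (by omega)]
    simp [pr_apply (show 2 * n - 1 < 2 * n by omega), AA, forc, BB, beta,
        (show ¬ (2 * n - 1 < 2 * n - 2) by omega), (show (2 * n - 1 ≠ 2 * n - 2) by omega)]
    rw [smul_comm]
    abel
  · have e : Finset.Icc 1 n = insert n (Finset.Ico 1 n) := by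
      ext i; simp; omega
    rw [e, Finset.sum_insert (by simp)]
    have e2 : ∑ j ∈ Finset.Ico 1 n, ((-1 : ℝ) ^ j * a j) • rd a n q W (2 * j - 1) =
        ∑ j ∈ Finset.Ico 1 n, ((-1 : ℝ) ^ j * a j) • pc (pr n (2 * j - 1)) W := by
      refine Finset.sum_congr rfl fun j hj => ?_
      rw [Finset.mem_Ico] at hj
      rw [rd, if_pos (by omega)]
    rw [e2, rd, if_neg (by omega)]
    have hb : ((-1) ^ n * a n) * bb a n = 1 := by
      rw [bb, mul_inv_cancel₀]
      simp [han.ne']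
    ext1 x
    simp only [topL, ContinuousMap.add_apply, ContinuousMap.smul_apply, pc_apply,
      smul_add, ContinuousMap.sum_apply, smul_apply, sub_apply, sum_apply, smul_smul, hb, one_smul]
    abel

theorem W_of_sys (hn : 2 ≤ n) (han : 0 < a n) (h : Sys a n ρ q p w m) :
    ∃ W : C(K, EE n), Der W (sm ρ (pc (AA a n) W) + forc a n p ρ q) ∧
      (∀ j ≤ 2 * n - 1, rd a n q W j = w j) ∧ pc (pr n (2 * n - 1)) W = m := by
  let W : C(K, EE n) := ⟨fun x i => if (i : ℕ) < 2 * n - 1 then w i x else m x, by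
    refine continuous_pi fun i => ?_
    split_ifs <;> fun_prop⟩
  have hW : ∀ x i, W x i = if (i : ℕ) < 2 * n - 1 then w i x else m x := fun x i => rfl
  have hWm : pc (pr n (2 * n - 1)) W = m := by
    ext1 x
    rw [pc_apply, pr_apply (by omega), hW, if_neg (by simp)]
  have hWj : ∀ j < 2 * n - 1, pc (pr n j) W = w j := by
    intro j hj
    ext1 x
    rw [pc_apply, pr_apply (by omega), hW, if_pos (by simpa using hj)]
  have hWt : pc (topL a n) W + bb a n • q = w (2 * n - 1) := by
    have h1 := h.alg
    have e : Finset.Icc 1 n = insert n (Finset.Ico 1 n) := by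
      ext i; simp; omega
    rw [e, Finset.sum_insert (by simp)] at h1
    have h2 : pc (topL a n) W = bb a n • (pc (pr n (2 * n - 1)) W -
        ∑ j ∈ Finset.Ico 1 n, ((-1 : ℝ) ^ j * a j) • pc (pr n (2 * j - 1)) W) := by
      ext1 x
      simp only [topL, pc_apply, ContinuousMap.smul_apply, ContinuousMap.sub_apply,
        ContinuousMap.sum_apply, smul_apply, sub_apply, sum_apply]
    rw [h2, hWm]
    have e2 : ∑ j ∈ Finset.Ico 1 n, ((-1 : ℝ) ^ j * a j) • pc (pr n (2 * j - 1)) W =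
        ∑ j ∈ Finset.Ico 1 n, ((-1 : ℝ) ^ j * a j) • w (2 * j - 1) := by
      refine Finset.sum_congr rfl fun j hj => ?_
      rw [Finset.mem_Ico] at hj
      rw [hWj _ (by omega)]
    have hb : bb a n * ((-1) ^ n * a n) = 1 := by
      rw [bb, inv_mul_cancel₀]
      simp [han.ne']
    rw [e2, ← smul_add, sub_add_eq_add_sub, ← h1, add_sub_cancel_right, smul_smul, hb, one_smul]
  have hrd : ∀ j ≤ 2 * n - 1, rd a n q W j = w j := by
    intro j hj
    rw [rd]
    split_ifs with hj'
    · exact hWj j hj'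
    · rw [hWt, show j = 2 * n - 1 by omega]
  refine ⟨W, ?_, hrd, hWm⟩
  rw [Der_pi]
  intro j hj
  by_cases hj1 : j < 2 * n - 2
  · rw [hWj j (by omega)]
    convert h.dw j (by omega) using 1
    ext1 x
    rw [← hWj (j + 1) (by omega)]
    simp [pr_apply hj, AA, forc, BB, beta, hj1, hj1.ne, (show j ≠ 2 * n - 1 by omega)]
  · by_cases hj2 : j = 2 * n - 2
    · rw [hWj j (by omega)]
      convert h.dw j (by omega) using 1
      ext1 x
      rw [show j + 1 = 2 * n - 1 by omega, ← hWt]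
      simp [pr_apply (show 2 * n - 2 < 2 * n by omega), AA, forc, BB, beta, hj2,
        (show 2 * n - 2 ≠ 2 * n - 1 by omega)]
      rw [smul_comm]
    · have e : j = 2 * n - 1 := by omega
      subst e
      rw [hWm]
      convert h.dm using 1
      ext1 x
      rw [← hWj 0 (by omega)]
      simp [pr_apply hj, AA, forc, BB, beta, hj1, hj2]
      rw [smul_comm]
      abel

theorem nonRes (hn : 2 ≤ n) (ha : ∀ j ≤ n, 0 ≤ a j) (ha0 : 0 < a 0) (han : 0 < a n) :
    NonRes (AA a n) := by
  intro ρ hρ W hW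
  have h0 : forc a n 0 ρ 0 = 0 := by simp [forc]
  have h := sys_of_W (q := 0) (p := 0) hn han (by rw [h0, add_zero]; exact hW)
  obtain ⟨h1, h2⟩ := h.trivial hρ hn ha ha0
  ext1 x
  funext i
  by_cases hi : (i : ℕ) < 2 * n - 1
  · have := h1 i hi.le
    rw [rd, if_pos hi] at this
    have := congrArg (fun F : C(K, R2) => F x) this
    simp only [pc_apply, pr_apply i.2] at this
    exact this
  · have := congrArg (fun F : C(K, R2) => F x) h2
    have e : (i : ℕ) = 2 * n - 1 := by have := i.2; omega
    rw [← e] at this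
    simp only [pc_apply, pr_apply i.2] at this
    exact this

/-- solution of the elliptic system -/
def Wf (a : ℕ → ℝ) (n : ℕ) (p : R2) (ρ : C(K, ℝ)) (q : C(K, R2)) : C(K, EE n) :=
  Wsol (AA a n) ρ (forc a n p ρ q)

/-- the functions `D_s^j u` -/
def wf (a : ℕ → ℝ) (n : ℕ) (p : R2) (ρ : C(K, ℝ)) (q : C(K, R2)) (j : ℕ) : C(K, R2) :=
  rd a n q (Wf a n p ρ q) j

/-- the auxiliary function `m` -/
def mf (a : ℕ → ℝ) (n : ℕ) (p : R2) (ρ : C(K, ℝ)) (q : C(K, R2)) : C(K, R2) :=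
  pc (pr n (2 * n - 1)) (Wf a n p ρ q)

variable (hn : 2 ≤ n) (ha : ∀ j ≤ n, 0 ≤ a j) (ha0 : 0 < a 0) (han : 0 < a n)

theorem sys_wf (hn : 2 ≤ n) (ha : ∀ j ≤ n, 0 ≤ a j) (ha0 : 0 < a 0) (han : 0 < a n)
    (hρ : ρ ∈ Pos) : Sys a n ρ q p (wf a n p ρ q) (mf a n p ρ q) :=
  sys_of_W hn han (Wsol_der (nonRes hn ha ha0 han) hρ _)

theorem sys_unique (hn : 2 ≤ n) (ha : ∀ j ≤ n, 0 ≤ a j) (ha0 : 0 < a 0) (han : 0 < a n)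
    (hρ : ρ ∈ Pos) (h : Sys a n ρ q p w m) :
    (∀ j ≤ 2 * n - 1, wf a n p ρ q j = w j) ∧ mf a n p ρ q = m := by
  obtain ⟨W, h1, h2, h3⟩ := W_of_sys hn han h
  have e := Wsol_unique (nonRes hn ha ha0 han) hρ h1
  refine ⟨fun j hj => ?_, ?_⟩
  · rw [← h2 j hj, e]; rfl
  · rw [← h3, e]; rfl

theorem forc_tr (k : ℝ) : forc a n p (tr k ρ) (tr k q) = tr k (forc a n p ρ q) := rfl

theorem Wf_tr (hn : 2 ≤ n) (ha : ∀ j ≤ n, 0 ≤ a j) (ha0 : 0 < a 0) (han : 0 < a n)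
    (hρ : ρ ∈ Pos) (k : ℝ) : Wf a n p (tr k ρ) (tr k q) = tr k (Wf a n p ρ q) := by
  rw [Wf, forc_tr, Wsol_tr (nonRes hn ha ha0 han) hρ]
  rfl

theorem wf_tr (hn : 2 ≤ n) (ha : ∀ j ≤ n, 0 ≤ a j) (ha0 : 0 < a 0) (han : 0 < a n)
    (hρ : ρ ∈ Pos) (k : ℝ) (j : ℕ) : wf a n p (tr k ρ) (tr k q) j = tr k (wf a n p ρ q j) := by
  rw [wf, Wf_tr hn ha ha0 han hρ, wf, rd, rd]
  split_ifs <;> rfl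

theorem Wf_contDiffAt (hn : 2 ≤ n) (ha : ∀ j ≤ n, 0 ≤ a j) (ha0 : 0 < a 0) (han : 0 < a n)
    (hρ : ρ ∈ Pos) : ContDiffAt ℝ (⊤ : ℕ∞) (fun r : C(K, ℝ) × C(K, R2) => Wf a n p r.1 r.2)
      (ρ, q) := by
  have h1 : ContDiffAt ℝ (⊤ : ℕ∞) (fun r : C(K, ℝ) × C(K, R2) => Minv (AA a n) r.1) (ρ, q) :=
    ContDiffAt.comp (g := Minv (AA a n)) (ρ, q) (Minv_contDiffAt (nonRes hn ha ha0 han) hρ)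
      contDiffAt_fst
  have h2 : ContDiff ℝ (⊤ : ℕ∞) (fun r : C(K, ℝ) × C(K, R2) => Lam (forc a n p r.1 r.2)) := by
    refine (Lam (E := EE n)).contDiff.comp ?_
    have h3 : ContDiff ℝ (⊤ : ℕ∞) (fun r : C(K, ℝ) × C(K, R2) => (sm (E := EE n)) r.1) :=
      (sm (E := EE n)).contDiff.comp contDiff_fst
    have h4 : ContDiff ℝ (⊤ : ℕ∞) (fun r : C(K, ℝ) × C(K, R2) => pc (BB a n) r.2) :=
      (pc (BB a n)).contDiff.comp contDiff_snd
    exact (h3.clm_apply h4).add contDiff_const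
  exact h1.clm_apply h2.contDiffAt

theorem wf_contDiffAt (hn : 2 ≤ n) (ha : ∀ j ≤ n, 0 ≤ a j) (ha0 : 0 < a 0) (han : 0 < a n)
    (hρ : ρ ∈ Pos) (j : ℕ) :
    ContDiffAt ℝ (⊤ : ℕ∞) (fun r : C(K, ℝ) × C(K, R2) => wf a n p r.1 r.2 j) (ρ, q) := by
  have h := Wf_contDiffAt (p := p) (q := q) hn ha ha0 han hρ
  by_cases hj : j < 2 * n - 1
  · have : (fun r : C(K, ℝ) × C(K, R2) => wf a n p r.1 r.2 j) =
        fun r => pc (pr n j) (Wf a n p r.1 r.2) := by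
      funext r; rw [wf, rd, if_pos hj]
    rw [this]
    exact (pc (pr n j)).contDiff.contDiffAt.comp (ρ, q) h
  · have : (fun r : C(K, ℝ) × C(K, R2) => wf a n p r.1 r.2 j) =
        fun r => pc (topL a n) (Wf a n p r.1 r.2) + bb a n • r.2 := by
      funext r; rw [wf, rd, if_neg hj]
    rw [this]
    exact ((pc (topL a n)).contDiff.contDiffAt.comp (ρ, q) h).add
      (contDiffAt_snd.const_smul (bb a n))

end Sys
end GP

set_option linter.unusedSectionVars false
set_option linter.unusedSimpArgs false
set_option linter.unnecessarySeqFocus false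
namespace GP
open Set Filter Topology

section Energy

/-- the nonlinear stress -/
def SS (a : ℕ → ℝ) (n : ℕ) (w : ℕ → C(K, R2)) : C(K, ℝ) :=
  (-(a 0 / 2)) • ip (w 0) (w 0) + ∑ k ∈ Finset.Icc 1 n, ∑ j ∈ Finset.Icc 1 (2 * k - 1),
    ((-1 : ℝ) ^ (k + j) * (a k / 2)) • ip (w (2 * k - j)) (w j)

theorem PP_add_right (ρ : C(K, ℝ)) (f g g' : C(K, R2)) : PP ρ f (g + g') = PP ρ f g + PP ρ f g' := by
  simp [PP]

theorem PP_deriv {ρ : ℝ → C(K, ℝ)} {f h : ℝ → C(K, R2)} {ρ' : C(K, ℝ)} {f' h' : C(K, R2)} {t : ℝ}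
    (hρ : HasDerivAt ρ ρ' t) (hf : HasDerivAt f f' t) (hh : HasDerivAt h h' t) :
    HasDerivAt (fun s => PP (ρ s) (f s) (h s))
      (PP ρ' (f t) (h t) + PP (ρ t) f' (h t) + PP (ρ t) (f t) h') t := by
  have h1 := (ip).hasDerivAt_of_bilinear (fun _ => hf) (fun _ => hh)
  have h2 := (sm (E := ℝ)).hasDerivAt_of_bilinear (fun _ => hρ) (fun _ => h1)
  have h3 := (intg (E := ℝ)).hasFDerivAt.comp_hasDerivAt t h2
  refine h3.congr_deriv ?_
  simp only [PP, map_add]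
  ring

theorem PP_sm (ρ g : C(K, ℝ)) (f h : C(K, R2)) : PP (sm ρ g) f h = PP ρ f (sm g h) := by
  unfold PP; congr 1; ext x; simp [inner_smul_right]; ring

theorem PP_sm_comm (ρ g : C(K, ℝ)) (f h : C(K, R2)) : PP ρ f (sm g h) = PP ρ h (sm g f) := by
  rw [← PP_sm, ← PP_sm, PP_comm]

theorem sum_sym (k : ℕ) (hk : 1 ≤ k) (f : ℕ → ℝ) (hf : ∀ j, 1 ≤ j → j ≤ 2 * k - 1 → f (2 * k - j) = f j) :
    ∑ j ∈ Finset.Icc 1 (2 * k - 1), f j = 2 * ∑ j ∈ Finset.Icc 1 k, f j - f k := by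
  obtain ⟨l, rfl⟩ : ∃ l, k = l + 1 := ⟨k - 1, by omega⟩
  have e : ∀ N, ∑ j ∈ Finset.Icc 1 N, f j = ∑ i ∈ Finset.range N, f (i + 1) := by
    intro N
    rw [Finset.range_eq_Ico, Finset.sum_Ico_add' f 0 N 1]
    rfl
  rw [e, e, show 2 * (l + 1) - 1 = (l + 1) + l by omega, Finset.sum_range_add]
  have : ∑ x ∈ Finset.range l, f (l + 1 + x + 1) = ∑ i ∈ Finset.range l, f (i + 1) := by
    rw [← Finset.sum_range_reflect (fun i => f (i + 1))]
    refine Finset.sum_congr rfl fun i hi => ?_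
    rw [Finset.mem_range] at hi
    have := hf (l + 1 + i + 1) (by omega) (by omega)
    rw [← this]
    congr 1
    omega
  rw [this, Finset.sum_range_succ]
  ring

variable {a : ℕ → ℝ} {n : ℕ} {p : R2}

theorem shift_e {ρ g : C(K, ℝ)} {w wd : ℕ → C(K, R2)}
    (hw : ∀ j, j + 1 ≤ 2 * n - 1 → Der (w j) (sm ρ (w (j + 1))))
    (hwd : ∀ j, j + 1 ≤ 2 * n - 1 → Der (wd j) (sm ρ (sm g (w (j + 1)) + wd (j + 1))))
    {k : ℕ} (hk : 1 ≤ k) (hkn : k ≤ n) : ∀ i, i + 1 ≤ k →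
    PP ρ (w (2 * k - 1)) (sm g (w 1) + wd 1) =
      (-1) ^ i * PP ρ (w (2 * k - (1 + i))) (sm g (w (1 + i)) + wd (1 + i))
      - ∑ j ∈ Finset.Icc 1 i, (-1) ^ j * PP ρ (w (2 * k - j)) (sm g (w j)) := by
  intro i
  induction i with
  | zero => intro _; simp
  | succ i ih =>
    intro hi
    rw [ih (by omega), Finset.sum_Icc_succ_top (by omega)]
    have := ibp' (hw (2 * k - (1 + (i + 1))) (by omega)) (hwd (1 + i) (by omega))
    rw [show 2 * k - (1 + (i + 1)) + 1 = 2 * k - (1 + i) by omega] at this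
    rw [PP_add_right, this, show 1 + i + 1 = 1 + (i + 1) by omega, show i + 1 = 1 + i by omega]
    ring

theorem mid_e {ρ g : C(K, ℝ)} {w wd : ℕ → C(K, R2)}
    (hw : ∀ j, j + 1 ≤ 2 * n - 1 → Der (w j) (sm ρ (w (j + 1))))
    (hwd : ∀ j, j + 1 ≤ 2 * n - 1 → Der (wd j) (sm ρ (sm g (w (j + 1)) + wd (j + 1))))
    {k : ℕ} (hk : 1 ≤ k) (hkn : k ≤ n) :
    (-1) ^ k * PP ρ (w (2 * k - 1)) (sm g (w 1) + wd 1) =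
      - PP ρ (w k) (wd k) - 1 / 2 * PP ρ (w k) (sm g (w k)) -
      1 / 2 * ∑ j ∈ Finset.Icc 1 (2 * k - 1), (-1) ^ (k + j) * PP ρ (w (2 * k - j)) (sm g (w j)) := by
  have hpow : ∀ l : ℕ, (-1 : ℝ) ^ (l + l) = 1 := fun l => by
    rw [← two_mul, pow_mul]; norm_num
  rw [sum_sym k hk (fun j => (-1) ^ (k + j) * PP ρ (w (2 * k - j)) (sm g (w j)))]
  · rw [shift_e hw hwd hk hkn (k - 1) (by omega)]
    obtain ⟨l, rfl⟩ : ∃ l, k = l + 1 := ⟨k - 1, by omega⟩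
    simp only [Nat.add_sub_cancel]
    rw [Finset.sum_Icc_succ_top (by omega), show 2 * (l + 1) - (1 + l) = l + 1 by omega,
      show 2 * (l + 1) - (l + 1) = l + 1 by omega, hpow (l + 1), PP_add_right, add_comm 1 l]
    rw [mul_sub, Finset.mul_sum]
    have e1 : ∀ j ∈ Finset.Icc 1 l, (-1 : ℝ) ^ (l + 1) * ((-1) ^ j *
        PP ρ (w (2 * (l + 1) - j)) (sm g (w j))) = (-1) ^ (l + 1 + j) *
        PP ρ (w (2 * (l + 1) - j)) (sm g (w j)) := fun j _ => by rw [pow_add]; ring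
    rw [Finset.sum_congr rfl e1]
    have e2 : (-1 : ℝ) ^ l * (-1) ^ l = 1 := by rw [← pow_add, hpow]
    rw [pow_succ]
    linear_combination (-(PP ρ (w (l + 1)) (sm g (w (l + 1))) + PP ρ (w (l + 1)) (wd (l + 1)))) * e2
  · intro j h1 h2
    rw [show 2 * k - (2 * k - j) = j by omega, PP_sm_comm]
    congr 1
    have : (-1 : ℝ) ^ (k + (2 * k - j)) * (-1) ^ (j + j) = (-1) ^ (k + j) := by
      rw [← pow_add, show k + (2 * k - j) + (j + j) = (k + k) + (k + j) by omega, pow_add, hpow, one_mul]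
    rw [← this, hpow, mul_one]

theorem PP_SS (ρ g : C(K, ℝ)) (w : ℕ → C(K, R2)) (v : C(K, R2)) (hg : g = ip (w 1) v) :
    PP ρ (sm (SS a n w) v) (w 1) = -(a 0 / 2) * PP ρ (w 0) (sm g (w 0)) +
      ∑ k ∈ Finset.Icc 1 n, ∑ j ∈ Finset.Icc 1 (2 * k - 1),
      ((-1 : ℝ) ^ (k + j) * (a k / 2)) * PP ρ (w (2 * k - j)) (sm g (w j)) := by
  let L : C(K, ℝ) →L[ℝ] ℝ := intg ∘L (sm (sm ρ g))
  have h1 : PP ρ (sm (SS a n w) v) (w 1) = L (SS a n w) := by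
    change intg _ = intg _
    congr 1; ext x; simp [hg, inner_smul_left, real_inner_comm]; ring
  have h2 : ∀ f h : C(K, R2), L (ip f h) = PP ρ f (sm g h) := by
    intro f h
    rw [← PP_sm]; rfl
  rw [h1, SS, map_add, map_smul, map_sum, h2, smul_eq_mul]
  congr 1
  refine Finset.sum_congr rfl fun k _ => ?_
  rw [map_sum]
  refine Finset.sum_congr rfl fun j _ => ?_
  rw [map_smul, h2, smul_eq_mul]

/-- A trajectory of the system. -/
structure Traj (a : ℕ → ℝ) (n : ℕ) (p : R2) (I : Set ℝ) (ρ : ℝ → C(K, ℝ)) (v q : ℝ → C(K, R2))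
    (w : ℝ → ℕ → C(K, R2)) (m : ℝ → C(K, R2)) (wd : ℝ → ℕ → C(K, R2)) : Prop where
  pos : ∀ t ∈ I, ρ t ∈ Pos
  sys : ∀ t ∈ I, Sys a n (ρ t) (q t) p (w t) (m t)
  dρ : ∀ t ∈ I, HasDerivAt ρ (sm (ρ t) (ip (w t 1) (v t))) t
  dv : ∀ t ∈ I, HasDerivAt v (w t 1 - sm (ip (w t 1) (v t)) (v t)) t
  dq : ∀ t ∈ I, HasDerivAt q (sm (SS a n (w t)) (v t)) t
  dw : ∀ t ∈ I, ∀ j, HasDerivAt (fun s => w s j) (wd t j) t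

variable {I : Set ℝ} {ρ : ℝ → C(K, ℝ)} {v q : ℝ → C(K, R2)}
    {w : ℝ → ℕ → C(K, R2)} {m : ℝ → C(K, R2)} {wd : ℝ → ℕ → C(K, R2)}

theorem Traj.energy (h : Traj a n p I ρ v q w m wd) (hn : 2 ≤ n) (hI : IsOpen I) {t : ℝ}
    (ht : t ∈ I) : HasDerivAt (fun s => En a n (ρ s) (w s)) 0 t := by
  have hnh : ∀ᶠ s in 𝓝 t, s ∈ I := hI.mem_nhds ht
  set g := ip (w t 1) (v t) with hg
  have hw := (h.sys t ht).dw
  have hwd : ∀ j, j + 1 ≤ 2 * n - 1 →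
      Der (wd t j) (sm (ρ t) (sm g (w t (j + 1)) + wd t (j + 1))) := by
    intro j hj
    have h1 := (sm (E := R2)).hasDerivAt_of_bilinear (fun _ => h.dρ t ht) (fun _ => h.dw t ht (j + 1))
    have h2 := Der.time (h.dw t ht j) h1 (hnh.mono fun s hs => (h.sys s hs).dw j hj)
    convert h2 using 1
    ext1 x
    simp [hg, smul_smul]
    abel
  -- first formula
  have d1 : HasDerivAt (fun s => En a n (ρ s) (w s)) (∑ j ∈ Finset.range (n + 1),
      a j * (PP (ρ t) (w t j) (sm g (w t j)) + 2 * PP (ρ t) (w t j) (wd t j))) t := by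
    have := HasDerivAt.fun_sum (u := Finset.range (n + 1)) (fun j (_ : j ∈ Finset.range (n + 1)) =>
      (PP_deriv (h.dρ t ht) (h.dw t ht j) (h.dw t ht j)).const_mul (a j))
    refine this.congr_deriv (Finset.sum_congr rfl fun j _ => ?_)
    rw [PP_sm, PP_comm (ρ t) (wd t j)]
    ring
  -- second formula
  have d2 : HasDerivAt (fun s => En a n (ρ s) (w s)) (intg (ip (cst p) (wd t 0)) -
      (PP (ρ t) (q t) (sm g (w t 1)) + PP (ρ t) (sm (SS a n (w t)) (v t)) (w t 1)
        + PP (ρ t) (q t) (wd t 1))) t := by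
    have e1 : HasDerivAt (fun s => intg (ip (cst p) (w s 0))) (intg (ip (cst p) (wd t 0))) t :=
      ((intg (E := ℝ)) ∘L (ip (cst p))).hasFDerivAt.comp_hasDerivAt t (h.dw t ht 0)
    have e2 := PP_deriv (h.dρ t ht) (h.dq t ht) (h.dw t ht 1)
    rw [PP_sm] at e2
    refine (e1.sub e2).congr_of_eventuallyEq (hnh.mono fun s hs => ?_)
    exact (h.sys s hs).energy hn
  have h3 := ibp (h.sys t ht).dm (hwd 0 (by omega))
  rw [← PP_eq_right] at h3
  have h4 : intg (ip (cst p - a 0 • sm (ρ t) (w t 0)) (wd t 0)) =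
      intg (ip (cst p) (wd t 0)) - a 0 * PP (ρ t) (w t 0) (wd t 0) := by
    rw [PP_eq_left]; simp
  have h5 : PP (ρ t) (m t + q t) (sm g (w t 1) + wd t 1) = ∑ k ∈ Finset.Icc 1 n,
      a k * (- PP (ρ t) (w t k) (wd t k) - 1 / 2 * PP (ρ t) (w t k) (sm g (w t k)) -
      1 / 2 * ∑ j ∈ Finset.Icc 1 (2 * k - 1),
        (-1) ^ (k + j) * PP (ρ t) (w t (2 * k - j)) (sm g (w t j))) := by
    rw [← (h.sys t ht).alg, PP_sum_left]
    refine Finset.sum_congr rfl fun k hk => ?_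
    rw [Finset.mem_Icc] at hk
    rw [PP_smul_left, ← mid_e hw hwd hk.1 hk.2]
    ring
  have h6 := PP_SS (a := a) (n := n) (ρ t) g (w t) (v t) hg
  have h7 : ∑ k ∈ Finset.Icc 1 n, ∑ j ∈ Finset.Icc 1 (2 * k - 1),
      ((-1 : ℝ) ^ (k + j) * (a k / 2)) * PP (ρ t) (w t (2 * k - j)) (sm g (w t j)) =
      ∑ k ∈ Finset.Icc 1 n, a k * (1 / 2 * ∑ j ∈ Finset.Icc 1 (2 * k - 1),
        (-1) ^ (k + j) * PP (ρ t) (w t (2 * k - j)) (sm g (w t j))) := by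
    refine Finset.sum_congr rfl fun k _ => ?_
    rw [Finset.mul_sum, Finset.mul_sum]
    refine Finset.sum_congr rfl fun j _ => ?_
    ring
  have h8 := d1.unique d2
  rw [range_eq_Icc] at h8
  have h9 : ∑ j ∈ Finset.Icc 1 n,
      a j * (PP (ρ t) (w t j) (sm g (w t j)) + 2 * PP (ρ t) (w t j) (wd t j)) =
      - 2 * PP (ρ t) (m t + q t) (sm g (w t 1) + wd t 1) - 2 *
      ∑ k ∈ Finset.Icc 1 n, a k * (1 / 2 * ∑ j ∈ Finset.Icc 1 (2 * k - 1),
        (-1) ^ (k + j) * PP (ρ t) (w t (2 * k - j)) (sm g (w t j))) := by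
    rw [h5, Finset.mul_sum, Finset.mul_sum, ← Finset.sum_sub_distrib]
    refine Finset.sum_congr rfl fun j _ => ?_
    ring
  refine d1.congr_deriv ?_
  rw [range_eq_Icc]
  rw [h7] at h6
  rw [PP_add_left, PP_add_right (ρ t) (q t)] at h9
  rw [zero_add] at h3
  linarith

end Energy
end GP

set_option linter.unusedSectionVars false
set_option linter.unusedSimpArgs false
set_option linter.unnecessarySeqFocus false
namespace GP
open Set Filter Topology

section VField

/-- the state space `(c, ρ, v, q)` -/
abbrev ZZ := C(K, R2) × C(K, ℝ) × C(K, R2) × C(K, R2)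

/-- admissible states -/
def UU : Set ZZ := {z | z.2.1 ∈ Pos}

/-- translation group on states -/
def GZ : Grp ZZ := (trG R2).prod ((trG ℝ).prod ((trG R2).prod (trG R2)))

theorem GZ_T (h : ℝ) (z : ZZ) : GZ.T h z = (tr h z.1, tr h z.2.1, tr h z.2.2.1, tr h z.2.2.2) := rfl

/-- the `w_j` as functions of the state -/
def wz (a : ℕ → ℝ) (n : ℕ) (p : R2) (z : ZZ) (j : ℕ) : C(K, R2) := wf a n p z.2.1 z.2.2.2 j

/-- the vector field -/
def VF (a : ℕ → ℝ) (n : ℕ) (p : R2) (z : ZZ) : ZZ :=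
  (wz a n p z 0, sm z.2.1 (ip (wz a n p z 1) z.2.2.1),
    wz a n p z 1 - sm (ip (wz a n p z 1) z.2.2.1) z.2.2.1, sm (SS a n (wz a n p z)) z.2.2.1)

variable {a : ℕ → ℝ} {n : ℕ} {p : R2}

theorem isOpen_UU : IsOpen UU := isOpen_Pos.preimage (continuous_fst.comp continuous_snd)

theorem wz_contDiffAt (hn : 2 ≤ n) (ha : ∀ j ≤ n, 0 ≤ a j) (ha0 : 0 < a 0) (han : 0 < a n)
    {z : ZZ} (hz : z ∈ UU) (j : ℕ) : ContDiffAt ℝ (⊤ : ℕ∞) (fun z => wz a n p z j) z := by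
  have h1 : ContDiffAt ℝ (⊤ : ℕ∞) (fun z : ZZ => (z.2.1, z.2.2.2)) z :=
    (contDiff_fst.comp contDiff_snd).contDiffAt.prodMk
      (contDiff_snd.comp (contDiff_snd.comp contDiff_snd)).contDiffAt
  have h0 : z.2.1 ∈ Pos := hz
  have h2 := wf_contDiffAt (p := p) (q := z.2.2.2) hn ha ha0 han h0 j
  have h3 := ContDiffAt.comp (g := fun r : C(K, ℝ) × C(K, R2) => wf a n p r.1 r.2 j)
    (f := fun z : ZZ => (z.2.1, z.2.2.2)) z h2 h1
  exact h3

theorem contDiffAt_bil {X E F G : Type} [NormedAddCommGroup X] [NormedSpace ℝ X]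
    [NormedAddCommGroup E] [NormedSpace ℝ E] [NormedAddCommGroup F] [NormedSpace ℝ F]
    [NormedAddCommGroup G] [NormedSpace ℝ G] (B : E →L[ℝ] F →L[ℝ] G) {f : X → E} {g : X → F}
    {x : X} (hf : ContDiffAt ℝ (⊤ : ℕ∞) f x) (hg : ContDiffAt ℝ (⊤ : ℕ∞) g x) :
    ContDiffAt ℝ (⊤ : ℕ∞) (fun x => B (f x) (g x)) x :=
  (B.contDiff.contDiffAt.comp x hf).clm_apply hg

theorem SS_contDiffAt {X : Type} [NormedAddCommGroup X] [NormedSpace ℝ X] {w : X → ℕ → C(K, R2)}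
    {x : X} (hw : ∀ j, ContDiffAt ℝ (⊤ : ℕ∞) (fun x => w x j) x) :
    ContDiffAt ℝ (⊤ : ℕ∞) (fun x => SS a n (w x)) x := by
  unfold SS
  refine ((contDiffAt_bil ip (hw 0) (hw 0)).const_smul _).add ?_
  refine ContDiffAt.sum fun k _ => ContDiffAt.sum fun j _ => ?_
  exact (contDiffAt_bil ip (hw _) (hw _)).const_smul _

theorem VF_contDiffAt (hn : 2 ≤ n) (ha : ∀ j ≤ n, 0 ≤ a j) (ha0 : 0 < a 0) (han : 0 < a n)
    {z : ZZ} (hz : z ∈ UU) : ContDiffAt ℝ (⊤ : ℕ∞) (VF a n p) z := by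
  have hw := fun j => wz_contDiffAt (p := p) hn ha ha0 han hz j
  have hρ : ContDiffAt ℝ (⊤ : ℕ∞) (fun z : ZZ => z.2.1) z := by fun_prop
  have hv : ContDiffAt ℝ (⊤ : ℕ∞) (fun z : ZZ => z.2.2.1) z := by fun_prop
  have hg := contDiffAt_bil ip (hw 1) hv
  refine (hw 0).prodMk ((contDiffAt_bil sm hρ hg).prodMk
    (((hw 1).sub (contDiffAt_bil sm hg hv)).prodMk (contDiffAt_bil sm (SS_contDiffAt hw) hv)))

theorem wz_tr (hn : 2 ≤ n) (ha : ∀ j ≤ n, 0 ≤ a j) (ha0 : 0 < a 0) (han : 0 < a n)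
    {z : ZZ} (hz : z ∈ UU) (h : ℝ) (j : ℕ) : wz a n p (GZ.T h z) j = tr h (wz a n p z j) :=
  wf_tr hn ha ha0 han hz h j

theorem SS_tr (w : ℕ → C(K, R2)) (h : ℝ) : SS a n (fun j => tr h (w j)) = tr h (SS a n w) := by
  simp only [SS, map_add, map_smul, map_sum]
  rfl

theorem eqVF (hn : 2 ≤ n) (ha : ∀ j ≤ n, 0 ≤ a j) (ha0 : 0 < a 0) (han : 0 < a n) :
    EqVF GZ (VF a n p) UU where
  isOpen := isOpen_UU
  smooth := fun z hz => (VF_contDiffAt hn ha ha0 han hz).contDiffWithinAt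
  inv h z hz := Pos_tr hz h
  eqv h z hz := by
    have hw : wz a n p (GZ.T h z) = fun j => tr h (wz a n p z j) := by
      funext j; exact wz_tr hn ha ha0 han hz h j
    rw [VF, hw, SS_tr, GZ_T, GZ_T]
    rfl

theorem traj_of_sol (hn : 2 ≤ n) (ha : ∀ j ≤ n, 0 ≤ a j) (ha0 : 0 < a 0) (han : 0 < a n)
    {z : ℝ → ZZ} {I : Set ℝ} (hz : SolOn (VF a n p) UU z I) :
    ∃ wd, Traj a n p I (fun t => (z t).2.1) (fun t => (z t).2.2.1) (fun t => (z t).2.2.2)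
      (fun t => wz a n p (z t)) (fun t => mf a n p (z t).2.1 (z t).2.2.2) wd := by
  refine ⟨fun t j => fderiv ℝ (fun z => wz a n p z j) (z t) (VF a n p (z t)), ?_⟩
  refine ⟨fun t ht => (hz t ht).1, fun t ht => sys_wf hn ha ha0 han (hz t ht).1,
    fun t ht => ?_, fun t ht => ?_, fun t ht => ?_, fun t ht j => ?_⟩
  · exact (hz t ht).2.snd.fst
  · exact (hz t ht).2.snd.snd.fst
  · exact (hz t ht).2.snd.snd.snd
  · exact (((wz_contDiffAt (p := p) hn ha ha0 han (hz t ht).1 j).differentiableAt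
      (by simp)).hasFDerivAt).comp_hasDerivAt t (hz t ht).2

end VField
end GP

set_option linter.unusedSectionVars false
set_option linter.unusedSimpArgs false
set_option linter.unnecessarySeqFocus false
namespace GP
open Set Filter Topology

section Static

theorem intg_mono {f g : C(K, ℝ)} (h : ∀ x, f x ≤ g x) : intg f ≤ intg g := by
  have := intg_nonneg (f := g - f) (fun x => by simpa using h x)
  rw [map_sub] at this
  linarith

theorem osc {h h' k : C(K, ℝ)} (hd : Der h h') (hk : ∀ x, |h' x| ≤ k x) (x y : K) :
    |h x - h y| ≤ intg k := by
  obtain ⟨s, hs, rfl⟩ := exists_rep x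
  obtain ⟨t, ht, rfl⟩ := exists_rep y
  have hkc := lift_continuous k
  have key : ∀ s t : ℝ, s ∈ Ioc 0 (2 * π) → t ∈ Ioc 0 (2 * π) → t ≤ s →
      |h (s : K) - h (t : K)| ≤ intg k := by
    intro s t hs ht hts
    have h1 := intervalIntegral.integral_eq_sub_of_hasDerivAt (a := t) (b := s) (fun x _ => hd x)
      ((lift_continuous h').intervalIntegrable _ _)
    rw [← h1, intg_apply]
    calc |∫ x in t..s, h' (x : K)| ≤ ∫ x in t..s, |h' (x : K)| :=
          intervalIntegral.abs_integral_le_integral_abs hts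
      _ ≤ ∫ x in t..s, k (x : K) := by
          refine intervalIntegral.integral_mono_on hts ?_ (hkc.intervalIntegrable _ _)
            fun x _ => hk _
          exact ((lift_continuous h').abs).intervalIntegrable _ _
      _ ≤ ∫ x in (0:ℝ)..(2 * π), k (x : K) := by
          refine intervalIntegral.integral_mono_interval ht.1.le hts hs.2 ?_
            (hkc.intervalIntegrable _ _)
          exact Eventually.of_forall fun x => (abs_nonneg _).trans (hk _)
  rcases le_total t s with hts | hst
  · exact key s t hs ht hts
  · rw [abs_sub_comm]; exact key t s ht hs hst

theorem exists_zero {ρ f : C(K, ℝ)} (hρ : ρ ∈ Pos) (h : intg (sm ρ f) = 0) : ∃ y, f y = 0 := by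
  have h1 : ∃ y, f y ≤ 0 := by
    by_contra! hc
    have := intg_eq_zero (f := sm ρ f) (fun x => (mul_pos (hρ x) (hc x)).le) h
    have := congrArg (fun F : C(K, ℝ) => F 0) this
    have h2 := mul_pos (hρ 0) (hc 0)
    simp only [sm_apply, smul_eq_mul, ContinuousMap.zero_apply] at this
    linarith
  have h2 : ∃ y, 0 ≤ f y := by
    by_contra! hc
    have := intg_eq_zero (f := sm ρ (-f)) (fun x => (mul_pos (hρ x) (neg_pos.2 (hc x))).le)
      (by rw [map_neg, map_neg, h, neg_zero])
    have := congrArg (fun F : C(K, ℝ) => F 0) this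
    have h2 := mul_pos (hρ 0) (neg_pos.2 (hc 0))
    simp only [sm_apply, smul_eq_mul, ContinuousMap.zero_apply, ContinuousMap.neg_apply] at this
    linarith
  exact mem_range_of_exists_le_of_exists_ge f.continuous h1 h2

/-- pointwise bound for functions with zero mean -/
theorem zero_mean {ρ k : C(K, ℝ)} {F f f' : C(K, R2)} (hρ : ρ ∈ Pos) (hF : Der F (sm ρ f))
    (hf : Der f (sm ρ f')) (hk : ∀ x, 2 * (‖f x‖ * ‖f' x‖) ≤ k x) (x : K) :
    ‖f x‖ ^ 2 ≤ intg (sm ρ k) := by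
  set e := f x with he
  by_cases h0 : e = 0
  · rw [h0, norm_zero]
    simp only [ne_eq, OfNat.ofNat_ne_zero, not_false_eq_true, zero_pow]
    refine intg_nonneg fun y => mul_nonneg (hρ y).le (le_trans (by positivity) (hk y))
  have hpos : 0 < ‖e‖ ^ 2 := by positivity
  have h1 : Der (pc (innerSL ℝ e) F) (pc (innerSL ℝ e) (sm ρ f)) := hF.pc _
  have h2 : intg (sm ρ (pc (innerSL ℝ e) f)) = 0 := by
    rw [← h1.intg]
    congr 1
    ext y; simp [inner_smul_right]
  obtain ⟨y, hy⟩ := exists_zero hρ h2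
  have h3 : Der (pc (innerSL ℝ e) f) (pc (innerSL ℝ e) (sm ρ f')) := hf.pc _
  have h4 := Der.bl (ContinuousLinearMap.mul ℝ ℝ) h3 h3
  have h5 := osc h4 (k := ‖e‖ ^ 2 • sm ρ k) (fun y => by
    simp only [ContinuousMap.add_apply, bl_apply, ContinuousLinearMap.mul_apply', pc_apply,
      innerSL_apply_apply, sm_apply, ContinuousMap.smul_apply, smul_eq_mul, inner_smul_right]
    have a1 : |⟪e, f y⟫| ≤ ‖e‖ * ‖f y‖ := abs_real_inner_le_norm _ _
    have a2 : |⟪e, f' y⟫| ≤ ‖e‖ * ‖f' y‖ := abs_real_inner_le_norm _ _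
    have a3 := mul_le_mul a1 a2 (abs_nonneg _) (by positivity)
    have a4 : ρ y * ⟪e, f' y⟫ * ⟪e, f y⟫ + ⟪e, f y⟫ * (ρ y * ⟪e, f' y⟫) =
      2 * ρ y * (⟪e, f y⟫ * ⟪e, f' y⟫) := by ring
    rw [a4, abs_mul, abs_mul (⟪e, f y⟫), abs_of_pos (by have := hρ y; positivity)]
    calc 2 * ρ y * (|⟪e, f y⟫| * |⟪e, f' y⟫|) ≤ 2 * ρ y * (‖e‖ * ‖f y‖ * (‖e‖ * ‖f' y‖)) := by
          have := hρ y; gcongr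
      _ = ‖e‖ ^ 2 * (ρ y * (2 * (‖f y‖ * ‖f' y‖))) := by ring
      _ ≤ _ := by have := hρ y; have := hk y; gcongr) x y
  simp only [pc_apply, innerSL_apply_apply] at hy
  simp only [bl_apply, pc_apply, innerSL_apply_apply, ContinuousLinearMap.mul_apply', hy, ← he,
    real_inner_self_eq_norm_sq, mul_zero, sub_zero, map_smul, smul_eq_mul] at h5
  rw [abs_of_pos (by positivity)] at h5
  exact le_of_mul_le_mul_left h5 hpos

/-- pointwise bound for general functions -/
theorem gen_bound {ρ : C(K, ℝ)} {f f' : C(K, R2)} (hρ : ρ ∈ Pos)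
    (hf : Der f (sm ρ f')) (x : K) :
    intg ρ * (‖f x‖ ^ 2 - (PP ρ f f + PP ρ f' f')) ≤ PP ρ f f := by
  have h4 : Der (ip f f) (ip (sm ρ f') f + ip f (sm ρ f')) := Der.bl (innerSL ℝ) hf hf
  have h5 : ∀ y, ‖f x‖ ^ 2 - (PP ρ f f + PP ρ f' f') ≤ ‖f y‖ ^ 2 := by
    intro y
    have := osc h4 (k := sm ρ (ip f f) + sm ρ (ip f' f')) (fun y => by
      simp only [ContinuousMap.add_apply, sm_apply, smul_eq_mul,
        inner_smul_right, inner_smul_left, ip_apply, real_inner_self_eq_norm_sq]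
      have a1 : |⟪f y, f' y⟫| ≤ ‖f y‖ * ‖f' y‖ := abs_real_inner_le_norm _ _
      rw [real_inner_comm (f y) (f' y)]
      simp only [conj_trivial]
      rw [show ρ y * ⟪f y, f' y⟫ + ρ y * ⟪f y, f' y⟫ = ρ y * (2 * ⟪f y, f' y⟫) by ring, ← mul_add,
        abs_mul, abs_of_pos (hρ y), abs_mul, abs_two]
      have := hρ y
      gcongr
      nlinarith [sq_nonneg (‖f y‖ - ‖f' y‖)]) x y
    simp only [ip_apply, real_inner_self_eq_norm_sq, map_add] at this
    have := (abs_le.1 this).2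
    unfold PP
    linarith
  have h6 := intg_mono (f := (‖f x‖ ^ 2 - (PP ρ f f + PP ρ f' f')) • ρ) (g := sm ρ (ip f f))
    (fun y => by
      simp only [ContinuousMap.smul_apply, smul_eq_mul, sm_apply, ip_apply,
        real_inner_self_eq_norm_sq]
      rw [mul_comm]
      exact mul_le_mul_of_nonneg_left (h5 y) (hρ y).le)
  rw [map_smul, smul_eq_mul, mul_comm] at h6
  exact h6

theorem PP_cs {ρ : C(K, ℝ)} (hρ : ρ ∈ Pos) (f g : C(K, R2)) :
    - (2 * PP ρ f g) ≤ PP ρ f f + PP ρ g g := by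
  have := PP_self_nonneg hρ (f + g)
  rw [PP_add_left, PP_add_right, PP_add_right, PP_comm ρ g f] at this
  linarith

theorem disc_conv {x : ℕ → ℝ} {X : ℝ} {n : ℕ} (h0 : x 0 ≤ X) (hn : x n ≤ X)
    (hc : ∀ j, j + 2 ≤ n → 2 * x (j + 1) ≤ x j + x (j + 2)) : ∀ j ≤ n, x j ≤ X := by
  by_contra! hcon
  classical
  have hf := Nat.find_spec hcon
  have hmin : ∀ i < Nat.find hcon, x i ≤ X := by
    intro i hi
    by_contra! hx
    exact Nat.find_min hcon hi ⟨by omega, hx⟩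
  set j := Nat.find hcon with hj
  obtain ⟨l, hl⟩ : ∃ l, j = l + 1 := by
    rcases Nat.eq_zero_or_pos j with h | h
    · rw [h] at hf; linarith [hf.2]
    · exact ⟨j - 1, by omega⟩
  have key : ∀ i, l + 1 + i ≤ n → X < x (l + 1 + i) ∧ x (l + i) < x (l + 1 + i) := by
    intro i
    induction i with
    | zero =>
      intro _
      have h1 := hmin l (by omega)
      rw [hl] at hf
      simp only [add_zero]
      exact ⟨hf.2, by linarith [hf.2]⟩
    | succ i ih =>
      intro hi
      obtain ⟨h1, h2⟩ := ih (by omega)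
      have h3 := hc (l + i) (by omega)
      rw [show l + i + 1 = l + 1 + i by omega, show l + i + 2 = l + 1 + (i + 1) by omega] at h3
      rw [show l + (i + 1) = l + 1 + i by omega]
      constructor <;> linarith
  have := (key (n - (l + 1)) (by omega)).1
  rw [show l + 1 + (n - (l + 1)) = n by omega] at this
  linarith

variable {a : ℕ → ℝ} {n : ℕ} {ρ : C(K, ℝ)} {q : C(K, R2)} {p : R2}
    {w : ℕ → C(K, R2)} {m : C(K, R2)}

theorem Sys.x_bound (h : Sys a n ρ q p w m) (hρ : ρ ∈ Pos) (hn : 2 ≤ n) (ha : ∀ j ≤ n, 0 ≤ a j)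
    (ha0 : 0 < a 0) (han : 0 < a n) :
    ∀ j ≤ n, PP ρ (w j) (w j) ≤ En a n ρ w / a 0 + En a n ρ w / a n := by
  have h1 : ∀ i ≤ n, a i * PP ρ (w i) (w i) ≤ En a n ρ w := by
    intro i hi
    exact Finset.single_le_sum (f := fun j => a j * PP ρ (w j) (w j)) (fun j hj => mul_nonneg (ha j (by
      rw [Finset.mem_range] at hj; omega)) (PP_self_nonneg hρ _)) (by simp; omega)
  have hE : 0 ≤ En a n ρ w := le_trans (mul_nonneg ha0.le (PP_self_nonneg hρ (w 0))) (h1 0 (by omega))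
  refine disc_conv (x := fun j => PP ρ (w j) (w j)) ?_ ?_ ?_
  · have := (le_div_iff₀' ha0).2 (h1 0 (by omega))
    have h3 : 0 ≤ En a n ρ w / a n := by positivity
    linarith
  · have := (le_div_iff₀' han).2 (h1 n le_rfl)
    have h3 : 0 ≤ En a n ρ w / a 0 := by positivity
    linarith
  · intro j hj
    have := h.pp (i := j) (j := j + 1) (by omega) (by omega)
    have h2 := PP_cs hρ (w j) (w (j + 2))
    have h3 : j + 1 + 1 = j + 2 := rfl
    rw [h3] at this
    linarith

theorem two_mul_le (x y : ℝ) : 2 * (x * y) ≤ x ^ 2 + y ^ 2 := by nlinarith [sq_nonneg (x - y)]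

theorem Sys.w_mid (h : Sys a n ρ q p w m) (hρ : ρ ∈ Pos) (hn : 2 ≤ n) {j : ℕ} (hj : 1 ≤ j)
    (hjn : j + 1 ≤ n) (x : K) : ‖w j x‖ ^ 2 ≤ PP ρ (w j) (w j) + PP ρ (w (j + 1)) (w (j + 1)) := by
  have hF := h.dw (j - 1) (by omega)
  rw [show j - 1 + 1 = j by omega] at hF
  have := zero_mean (k := ip (w j) (w j) + ip (w (j + 1)) (w (j + 1))) hρ hF (h.dw j (by omega))
    (fun x => by
      simp only [ContinuousMap.add_apply, ip_apply, real_inner_self_eq_norm_sq]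
      exact two_mul_le _ _) x
  rw [map_add, map_add] at this
  exact this

theorem Sys.w_n (h : Sys a n ρ q p w m) (hρ : ρ ∈ Pos) (hn : 2 ≤ n) (x : K) :
    ‖w n x‖ ^ 2 ≤ ‖w (n + 1)‖ * (intg ρ + PP ρ (w n) (w n)) := by
  have hF := h.dw (n - 1) (by omega)
  rw [show n - 1 + 1 = n by omega] at hF
  have := zero_mean (k := ‖w (n + 1)‖ • (cst 1 + ip (w n) (w n))) hρ hF (h.dw n (by omega))
    (fun x => by
      simp only [ContinuousMap.smul_apply, ContinuousMap.add_apply, ip_apply,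
        real_inner_self_eq_norm_sq, cst_apply, smul_eq_mul]
      have h1 := (w (n + 1)).norm_coe_le_norm x
      have h2 := two_mul_le 1 ‖w n x‖
      have h3 := norm_nonneg (w n x)
      calc 2 * (‖w n x‖ * ‖w (n + 1) x‖) = ‖w (n + 1) x‖ * (2 * (1 * ‖w n x‖)) := by ring
        _ ≤ ‖w (n + 1)‖ * (1 ^ 2 + ‖w n x‖ ^ 2) := by gcongr
        _ = _ := by ring) x
  rw [map_smul, map_smul, map_add, map_add, smul_eq_mul] at this
  have e : sm ρ (cst (1:ℝ)) = ρ := by ext x; simp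
  rw [e] at this
  exact this

end Static
end GP

set_option linter.unusedSectionVars false
set_option linter.unusedSimpArgs false
set_option linter.unnecessarySeqFocus false
namespace GP
open Set Filter Topology

section Dyn

theorem gronwall_bdd {X : Type} [NormedAddCommGroup X] [NormedSpace ℝ X] {f f' : ℝ → X}
    {t₀ T C C' : ℝ} (hC : 0 ≤ C) (hC' : 0 ≤ C') (h : ∀ t ∈ Ico t₀ T, HasDerivAt f (f' t) t)
    (hb : ∀ t ∈ Ico t₀ T, ‖f' t‖ ≤ C * ‖f t‖ + C') : ∃ B, 0 ≤ B ∧ ∀ t ∈ Ico t₀ T, ‖f t‖ ≤ B := by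
  refine ⟨max 0 (gronwallBound ‖f t₀‖ C C' (T - t₀)), le_max_left _ _, fun t ht => ?_⟩
  have h1 := norm_le_gronwallBound_of_norm_deriv_right_le (f := f) (f' := f') (δ := ‖f t₀‖)
    (K := C) (ε := C') (a := t₀) (b := t)
    (fun s hs => (h s ⟨hs.1, hs.2.trans_lt ht.2⟩).continuousAt.continuousWithinAt)
    (fun s hs => (h s ⟨hs.1, hs.2.trans ht.2⟩).hasDerivWithinAt) le_rfl
    (fun s hs => hb s ⟨hs.1, hs.2.trans ht.2⟩) t ⟨ht.1, le_rfl⟩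
  refine h1.trans (le_trans ?_ (le_max_right _ _))
  exact gronwallBound_mono (norm_nonneg _) hC' hC (by linarith [ht.2])

variable {a : ℕ → ℝ} {n : ℕ} {p : R2} {I : Set ℝ} {ρ : ℝ → C(K, ℝ)} {v q : ℝ → C(K, R2)}
    {w : ℝ → ℕ → C(K, R2)} {m : ℝ → C(K, R2)} {wd : ℝ → ℕ → C(K, R2)} {T : ℝ}

theorem norm_ip_le (f g : C(K, R2)) : ‖ip f g‖ ≤ ‖f‖ * ‖g‖ := by
  rw [ContinuousMap.norm_le _ (by positivity)]
  intro x
  rw [ip_apply]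
  refine (norm_inner_le_norm _ _).trans ?_
  exact mul_le_mul (f.norm_coe_le_norm x) (g.norm_coe_le_norm x) (norm_nonneg _) (norm_nonneg _)

theorem norm_sm_le {E : Type} [NormedAddCommGroup E] [NormedSpace ℝ E] (f : C(K, ℝ)) (g : C(K, E)) :
    ‖sm f g‖ ≤ ‖f‖ * ‖g‖ := by
  rw [ContinuousMap.norm_le _ (by positivity)]
  intro x
  rw [sm_apply, norm_smul]
  exact mul_le_mul (f.norm_coe_le_norm x) (g.norm_coe_le_norm x) (norm_nonneg _) (norm_nonneg _)

theorem Traj.unit (h : Traj a n p I ρ v q w m wd) (hI : Ico 0 T ⊆ I)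
    (h0 : ip (v 0) (v 0) = cst 1) : ∀ t ∈ Ico 0 T, ip (v t) (v t) = cst 1 := by
  intro t ht
  have hd : ∀ s ∈ Ico 0 T, HasDerivAt (fun s => ip (v s) (v s) - cst 1)
      ((-2 : ℝ) • sm (ip (w s 1) (v s)) (ip (v s) (v s) - cst 1)) s := by
    intro s hs
    have h1 := ((ip).hasDerivAt_of_bilinear (fun _ => h.dv s (hI hs))
      (fun _ => h.dv s (hI hs))).sub_const (cst 1)
    refine h1.congr_deriv ?_
    ext x
    simp [inner_sub_left, inner_sub_right, inner_smul_left, inner_smul_right,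
      real_inner_comm]
    ring
  have hc : ContinuousOn (fun s => ip (w s 1) (v s)) (Icc 0 t) := by
    intro s hs
    have hs' : s ∈ Ico 0 T := ⟨hs.1, hs.2.trans_lt ht.2⟩
    have := (ip).hasDerivAt_of_bilinear (fun _ => h.dw s (hI hs') 1) (fun _ => h.dv s (hI hs'))
    exact this.continuousAt.continuousWithinAt
  obtain ⟨B, hB⟩ := isCompact_Icc.exists_bound_of_continuousOn hc
  have h1 := norm_le_gronwallBound_of_norm_deriv_right_le
    (f := fun s => ip (v s) (v s) - cst 1)
    (f' := fun s => (-2 : ℝ) • sm (ip (w s 1) (v s)) (ip (v s) (v s) - cst 1)) (δ := 0)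
    (K := 2 * B) (ε := 0) (a := 0) (b := t)
    (fun s hs => (hd s ⟨hs.1, hs.2.trans_lt ht.2⟩).continuousAt.continuousWithinAt)
    (fun s hs => (hd s ⟨hs.1, hs.2.trans ht.2⟩).hasDerivWithinAt) (by simp [h0])
    (fun s hs => by
      rw [norm_smul, add_zero]
      have h2 := norm_sm_le (ip (w s 1) (v s)) (ip (v s) (v s) - cst 1)
      have h3 := hB s ⟨hs.1, hs.2.le⟩
      have h4 := mul_le_mul_of_nonneg_right h3 (norm_nonneg (ip (v s) (v s) - cst (1:ℝ)))
      have h5 : ‖(-2 : ℝ)‖ = 2 := by norm_num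
      rw [h5]
      linarith) t ⟨ht.1, le_rfl⟩
  rw [gronwallBound_ε0] at h1
  simp only [zero_mul] at h1
  exact sub_eq_zero.1 (norm_le_zero_iff.1 h1)

theorem norm_le_one_of_unit {f : C(K, R2)} (h : ip f f = cst 1) : ‖f‖ ≤ 1 := by
  rw [ContinuousMap.norm_le _ (by positivity)]
  intro x
  have := congrArg (fun F : C(K, ℝ) => F x) h
  simp only [ip_apply, cst_apply, real_inner_self_eq_norm_sq] at this
  nlinarith [norm_nonneg (f x)]

theorem Traj.energy_const (h : Traj a n p I ρ v q w m wd) (hn : 2 ≤ n) (hIo : IsOpen I)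
    (hI : Ico 0 T ⊆ I) : ∀ t ∈ Ico 0 T, En a n (ρ t) (w t) = En a n (ρ 0) (w 0) := by
  intro t ht
  exact constant_of_has_deriv_right_zero (f := fun s => En a n (ρ s) (w s)) (a := 0) (b := t)
    (fun s hs => (h.energy hn hIo (hI ⟨hs.1, hs.2.trans_lt ht.2⟩)).continuousAt.continuousWithinAt)
    (fun s hs => (h.energy hn hIo (hI ⟨hs.1, hs.2.trans ht.2⟩)).hasDerivWithinAt) t ⟨ht.1, le_rfl⟩

theorem norm_le_of_sq {f : C(K, R2)} {B : ℝ} (h : ∀ x, ‖f x‖ ^ 2 ≤ B) : ‖f‖ ≤ Real.sqrt B := by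
  rw [ContinuousMap.norm_le _ (Real.sqrt_nonneg _)]
  intro x
  exact Real.le_sqrt_of_sq_le (h x)

theorem exists_lower {f : C(K, ℝ)} (hf : f ∈ Pos) : ∃ δ > 0, ∀ x, δ ≤ f x := by
  obtain ⟨y, _, hy⟩ := isCompact_univ.exists_isMinOn univ_nonempty f.continuous.continuousOn
  exact ⟨f y, hf y, fun x => hy (mem_univ x)⟩

theorem Wsol_bound {E : Type} [NormedAddCommGroup E] [NormedSpace ℝ E] [FiniteDimensional ℝ E]
    {A : E →L[ℝ] E} (hA : NonRes A) {ρT : C(K, ℝ)} (hρ : ρT ∈ Pos) :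
    ∃ C, 0 ≤ C ∧ ∀ᶠ r in 𝓝 ρT, ‖r‖ ≤ C ∧ ∀ f : C(K, E), ‖Wsol A r f‖ ≤ C * ‖f‖ := by
  have hM : ContinuousAt (Minv A) ρT := (Minv_contDiffAt hA hρ).continuousAt
  refine ⟨(‖ρT‖ + 1) + (‖Minv A ρT‖ + 1) * ‖(Lam : C(K, E) →L[ℝ] C(K, E))‖, by positivity, ?_⟩
  have e1 : ∀ᶠ r in 𝓝 ρT, ‖Minv A r‖ < ‖Minv A ρT‖ + 1 :=
    hM.norm.eventually (gt_mem_nhds (by linarith))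
  have e2 : ∀ᶠ r in 𝓝 ρT, ‖r‖ < ‖ρT‖ + 1 :=
    continuous_norm.continuousAt.eventually (gt_mem_nhds (by linarith))
  filter_upwards [e1, e2] with r h1 h2
  have hp : 0 ≤ (‖Minv A ρT‖ + 1) * ‖(Lam : C(K, E) →L[ℝ] C(K, E))‖ := by positivity
  refine ⟨by linarith, fun f => ?_⟩
  have g1 : ‖Wsol A r f‖ ≤ ‖Minv A r‖ * ‖Lam f‖ := (Minv A r).le_opNorm (Lam f)
  have g2 : ‖Lam f‖ ≤ ‖(Lam : C(K, E) →L[ℝ] C(K, E))‖ * ‖f‖ :=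
    ContinuousLinearMap.le_opNorm (Lam : C(K, E) →L[ℝ] C(K, E)) f
  have g3 : ‖Minv A r‖ * ‖Lam f‖ ≤ (‖Minv A ρT‖ + 1) * (‖(Lam : C(K, E) →L[ℝ] C(K, E))‖ * ‖f‖) :=
    mul_le_mul h1.le g2 (norm_nonneg _) (by positivity)
  have g4 : 0 ≤ (‖ρT‖ + 1) * ‖f‖ := by positivity
  rw [add_mul]
  linarith

theorem clm_bound {X Y : Type} [NormedAddCommGroup X] [NormedSpace ℝ X] [NormedAddCommGroup Y]
    [NormedSpace ℝ Y] (L : X →L[ℝ] Y) : ∃ C, 0 ≤ C ∧ ∀ x, ‖L x‖ ≤ C * ‖x‖ :=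
  ⟨‖L‖, norm_nonneg _, L.le_opNorm⟩

theorem wf_bound1 (hn : 2 ≤ n) (ha : ∀ j ≤ n, 0 ≤ a j) (ha0 : 0 < a 0) (han : 0 < a n)
    {ρT : C(K, ℝ)} (hρ : ρT ∈ Pos) (j : ℕ) :
    ∃ C, 0 ≤ C ∧ ∀ᶠ r in 𝓝 ρT, ∀ Q : C(K, R2), ‖wf a n p r Q j‖ ≤ C * (1 + ‖Q‖) := by
  obtain ⟨M, hM0, hM⟩ := Wsol_bound (nonRes hn ha ha0 han) hρ
  obtain ⟨A2, hA20, hA2⟩ := clm_bound (pc (BB a n))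
  obtain ⟨A3, hA3⟩ : ∃ A3, ‖(cst (beta n p) : C(K, EE n))‖ = A3 := ⟨_, rfl⟩
  have hA30 : 0 ≤ A3 := hA3 ▸ norm_nonneg _
  obtain ⟨A4, hA40, hA4⟩ := clm_bound (pc (pr n j))
  obtain ⟨A5, hA50, hA5⟩ := clm_bound (pc (topL a n))
  obtain ⟨D, hD⟩ : ∃ D, D = M * (M * A2 + A3) := ⟨_, rfl⟩
  have hD0 : 0 ≤ D := by rw [hD]; positivity
  refine ⟨A4 * D + A5 * D + |bb a n|, by positivity, ?_⟩
  filter_upwards [hM] with r h1 Q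
  obtain ⟨h2, h3⟩ := h1
  have hQ := norm_nonneg Q
  have f1 : ‖forc a n p r Q‖ ≤ (M * A2 + A3) * (1 + ‖Q‖) := by
    have g1 := norm_sm_le r (pc (BB a n) Q)
    have g2 := hA2 Q
    have g3 : ‖r‖ * ‖pc (BB a n) Q‖ ≤ M * (A2 * ‖Q‖) :=
      mul_le_mul h2 g2 (norm_nonneg _) hM0
    have g4 : ‖forc a n p r Q‖ ≤ ‖sm r (pc (BB a n) Q)‖ + A3 := hA3 ▸ norm_add_le _ _
    have g5 : 0 ≤ M * A2 := by positivity
    nlinarith [mul_nonneg hA30 hQ]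
  have f2 : ‖Wf a n p r Q‖ ≤ D * (1 + ‖Q‖) := by
    refine (h3 (forc a n p r Q)).trans ?_
    rw [hD, mul_assoc]
    exact mul_le_mul_of_nonneg_left f1 hM0
  have hb : 0 ≤ |bb a n| := abs_nonneg _
  have hp : 0 ≤ D * (1 + ‖Q‖) := by positivity
  have p4 : 0 ≤ A4 * (D * (1 + ‖Q‖)) := by positivity
  have p5 : 0 ≤ A5 * (D * (1 + ‖Q‖)) := by positivity
  have p6 : 0 ≤ |bb a n| * ‖Q‖ := by positivity
  have ex : (A4 * D + A5 * D + |bb a n|) * (1 + ‖Q‖) = A4 * (D * (1 + ‖Q‖)) + A5 * (D * (1 + ‖Q‖))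
    + |bb a n| + |bb a n| * ‖Q‖ := by ring
  rw [wf, rd, ex]
  split_ifs
  · have g1 := (hA4 (Wf a n p r Q)).trans (mul_le_mul_of_nonneg_left f2 hA40)
    linarith
  · have g1 := (hA5 (Wf a n p r Q)).trans (mul_le_mul_of_nonneg_left f2 hA50)
    have g2 := norm_add_le (pc (topL a n) (Wf a n p r Q)) (bb a n • Q)
    rw [norm_smul, Real.norm_eq_abs] at g2
    linarith

theorem wf_bound (hn : 2 ≤ n) (ha : ∀ j ≤ n, 0 ≤ a j) (ha0 : 0 < a 0) (han : 0 < a n)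
    {ρT : C(K, ℝ)} (hρ : ρT ∈ Pos) :
    ∃ C, 0 ≤ C ∧ ∀ᶠ r in 𝓝 ρT, ∀ j ≤ 2 * n - 1, ∀ Q : C(K, R2),
      ‖wf a n p r Q j‖ ≤ C * (1 + ‖Q‖) := by
  choose C hC0 hC using fun j => wf_bound1 (p := p) hn ha ha0 han hρ j
  refine ⟨∑ j ∈ Finset.range (2 * n), C j, Finset.sum_nonneg fun j _ => hC0 j, ?_⟩
  have := (Filter.eventually_all_finset (Finset.range (2 * n))).2 (fun j _ => hC j)
  filter_upwards [this] with r hr j hj Q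
  have hj' : j ∈ Finset.range (2 * n) := by rw [Finset.mem_range]; omega
  refine (hr j hj' Q).trans (mul_le_mul_of_nonneg_right ?_ (by positivity))
  exact Finset.single_le_sum (fun j _ => hC0 j) hj'

/-- constant in the bound of `SS` -/
def cSS (a : ℕ → ℝ) (n : ℕ) : ℝ :=
  |a 0 / 2| + ∑ k ∈ Finset.Icc 1 n, ∑ _j ∈ Finset.Icc 1 (2 * k - 1), |a k / 2|

theorem cSS_nonneg : 0 ≤ cSS a n := by
  unfold cSS; positivity

theorem SS_bound {w : ℕ → C(K, R2)} {M : ℝ} (h0 : ‖ip (w 0) (w 0)‖ ≤ M)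
    (h : ∀ i j, 1 ≤ i → 1 ≤ j → i + j ≤ 2 * n → ‖ip (w i) (w j)‖ ≤ M) :
    ‖SS a n w‖ ≤ cSS a n * M := by
  unfold SS cSS
  rw [add_mul]
  refine (norm_add_le _ _).trans (add_le_add ?_ ?_)
  · rw [norm_smul, Real.norm_eq_abs, abs_neg]
    exact mul_le_mul_of_nonneg_left h0 (abs_nonneg _)
  · rw [Finset.sum_mul]
    refine norm_sum_le_of_le _ fun k hk => ?_
    rw [Finset.sum_mul]
    refine norm_sum_le_of_le _ fun j hj => ?_
    rw [Finset.mem_Icc] at hk hj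
    rw [norm_smul, Real.norm_eq_abs, abs_mul, abs_pow, abs_neg, abs_one, one_pow, one_mul]
    exact mul_le_mul_of_nonneg_left (h _ _ (by omega) (by omega) (by omega)) (abs_nonneg _)

/-- lower bound for the density -/
theorem rho_lower {C : ℝ} {r g : ℝ → C(K, ℝ)} (hr : ∀ t ∈ Ico 0 T, HasDerivAt r (sm (r t) (g t)) t)
    (hp : ∀ t ∈ Ico 0 T, r t ∈ Pos)
    (hg : ∀ t ∈ Ico 0 T, ‖g t‖ ≤ C) (x : K) : ∀ t ∈ Ico 0 T, r 0 x * Real.exp (- C * t) ≤ r t x := by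
  intro t ht
  have hd : ∀ s ∈ Ico 0 T, HasDerivAt (fun s => r s x * Real.exp (C * s))
      (r s x * g s x * Real.exp (C * s) + r s x * (Real.exp (C * s) * C)) s := by
    intro s hs
    have h1 : HasDerivAt (fun s => r s x) (r s x * g s x) s :=
      (ContinuousMap.evalCLM ℝ x : C(K, ℝ) →L[ℝ] ℝ).hasFDerivAt.comp_hasDerivAt s (hr s hs)
    have h2 : HasDerivAt (fun s => Real.exp (C * s)) (Real.exp (C * s) * C) s := by
      have := ((hasDerivAt_id s).const_mul C).exp
      simpa using this
    exact h1.mul h2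
  have hm : MonotoneOn (fun s => r s x * Real.exp (C * s)) (Icc 0 t) := by
    refine monotoneOn_of_deriv_nonneg (convex_Icc 0 t) ?_ ?_ ?_
    · intro s hs
      exact (hd s ⟨hs.1, hs.2.trans_lt ht.2⟩).continuousAt.continuousWithinAt
    · intro s hs
      rw [interior_Icc] at hs
      exact (hd s ⟨hs.1.le, hs.2.trans ht.2⟩).differentiableAt.differentiableWithinAt
    · intro s hs
      rw [interior_Icc] at hs
      have hs' : s ∈ Ico 0 T := ⟨hs.1.le, hs.2.trans ht.2⟩
      rw [(hd s hs').deriv]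
      have h1 := hp s hs' x
      have h2 : -C ≤ g s x := by
        have := (g s).norm_coe_le_norm x
        rw [Real.norm_eq_abs] at this
        have h3 := neg_abs_le (g s x)
        linarith [hg s hs']
      have h3 : 0 ≤ (g s x + C) * (r s x * Real.exp (C * s)) :=
        mul_nonneg (by linarith) (by positivity)
      nlinarith
  have h1 := hm ⟨le_rfl, ht.1⟩ ⟨ht.1, le_rfl⟩ ht.1
  simp only [mul_zero, Real.exp_zero, mul_one] at h1
  have h2 := mul_le_mul_of_nonneg_right h1 (Real.exp_pos (-C * t)).le
  rw [mul_assoc, ← Real.exp_add] at h2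
  simpa using h2

end Dyn
end GP

set_option linter.unusedSectionVars false
set_option linter.unusedSimpArgs false
set_option linter.unnecessarySeqFocus false
namespace GP
open Set Filter Topology

section Lim

variable {a : ℕ → ℝ} {n : ℕ} {p : R2} {I : Set ℝ} {T : ℝ}

theorem sqrt_le_self_add {B x : ℝ} (_hx : 0 ≤ x) (hB : x ^ 2 ≤ B) : x ≤ 1 + B := by
  nlinarith [sq_nonneg (x - 1)]

theorem ip_le_of_sq {f : C(K, R2)} {B : ℝ} (h : ∀ x, ‖f x‖ ^ 2 ≤ B) : ‖ip f f‖ ≤ B := by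
  have hB : 0 ≤ B := (sq_nonneg _).trans (h 0)
  rw [ContinuousMap.norm_le _ hB]
  intro x
  rw [ip_apply, real_inner_self_eq_norm_sq, Real.norm_eq_abs, abs_of_nonneg (sq_nonneg _)]
  exact h x

theorem sol_limit (hn : 2 ≤ n) (ha : ∀ j ≤ n, 0 ≤ a j) (ha0 : 0 < a 0) (han : 0 < a n)
    {z : ℝ → ZZ} {ε : ℝ} (hT : 0 < T) (hε : 0 < ε) (hz : SolOn (VF a n p) UU z (Ioo (-ε) T))
    (h0 : ip (z 0).2.2.1 (z 0).2.2.1 = cst 1) :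
    ∃ x ∈ UU, Tendsto z (𝓝[<] T) (𝓝 x) := by
  obtain ⟨wd, h⟩ := traj_of_sol hn ha ha0 han hz
  have hIo : IsOpen (Ioo (-ε) T) := isOpen_Ioo
  have hI : Ico 0 T ⊆ Ioo (-ε) T := fun t ht => ⟨by linarith [ht.1], ht.2⟩
  have hunit := h.unit hI h0
  have hEn := h.energy_const hn hIo hI
  generalize hρe : (fun t => (z t).2.1) = ρ at h
  generalize hve : (fun t => (z t).2.2.1) = v at h hunit
  generalize hqe : (fun t => (z t).2.2.2) = q at h
  generalize hwe : (fun t => wz a n p (z t)) = w at h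
  have hwq : ∀ t, ∀ j, w t j = wf a n p (ρ t) (q t) j := by
    intro t j; rw [← hwe, ← hρe, ← hqe]; rfl
  have hwe' : ∀ t, wz a n p (z t) = w t := fun t => congrFun hwe t
  have hv1 : ∀ t ∈ Ico 0 T, ‖v t‖ ≤ 1 := fun t ht => norm_le_one_of_unit (by
    have := hunit t ht
    simpa [← hve] using this)
  obtain ⟨X, hX⟩ : ∃ X, X = En a n (ρ 0) (w 0) / a 0 + En a n (ρ 0) (w 0) / a n := ⟨_, rfl⟩
  have hXb : ∀ t ∈ Ico 0 T, ∀ j ≤ n, PP (ρ t) (w t j) (w t j) ≤ X := by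
    intro t ht j hj
    have := (h.sys t (hI ht)).x_bound (h.pos t (hI ht)) hn ha ha0 han j hj
    have e : En a n (ρ t) (w t) = En a n (ρ 0) (w 0) := by rw [← hρe, ← hwe]; exact hEn t ht
    rw [e, ← hX] at this
    exact this
  have hX0 : 0 ≤ X := (PP_self_nonneg (h.pos 0 (hI ⟨le_rfl, hT⟩)) (w 0 0)).trans
    (hXb 0 ⟨le_rfl, hT⟩ 0 (by omega))
  have hmid : ∀ t ∈ Ico 0 T, ∀ j, 1 ≤ j → j + 1 ≤ n → ‖w t j‖ ≤ Real.sqrt (2 * X) := by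
    intro t ht j hj hjn
    refine norm_le_of_sq fun x => ?_
    have := (h.sys t (hI ht)).w_mid (h.pos t (hI ht)) hn hj hjn x
    have h1 := hXb t ht j (by omega)
    have h2 := hXb t ht (j + 1) hjn
    linarith
  obtain ⟨C1, hC1⟩ : ∃ C1, C1 = Real.sqrt (2 * X) := ⟨_, rfl⟩
  rw [← hC1] at hmid
  have hC10 : 0 ≤ C1 := hC1 ▸ Real.sqrt_nonneg _
  have hg : ∀ t ∈ Ico 0 T, ‖ip (w t 1) (v t)‖ ≤ C1 := by
    intro t ht
    have h1 := norm_ip_le (w t 1) (v t)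
    have h2 := hmid t ht 1 le_rfl hn
    have h3 := hv1 t ht
    have := mul_le_mul h2 h3 (norm_nonneg _) hC10
    linarith
  have hρd : ∀ t ∈ Ico 0 T, ‖sm (ρ t) (ip (w t 1) (v t))‖ ≤ C1 * ‖ρ t‖ := by
    intro t ht
    have h1 := norm_sm_le (ρ t) (ip (w t 1) (v t))
    have := mul_le_mul_of_nonneg_left (hg t ht) (norm_nonneg (ρ t))
    linarith
  obtain ⟨R, hR0, hR⟩ := gronwall_bdd (t₀ := 0) (T := T) hC10 le_rfl (fun t ht => h.dρ t (hI ht))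
    (fun t ht => by rw [add_zero]; exact hρd t ht)
  obtain ⟨ρT, hρT⟩ := exists_limit hT (fun t ht => h.dρ t (hI ht)) (C := C1 * R)
    (fun t ht => (hρd t ht).trans (mul_le_mul_of_nonneg_left (hR t ht) hC10))
  obtain ⟨δ, hδ, hδ'⟩ := exists_lower (h.pos 0 (hI ⟨le_rfl, hT⟩))
  obtain ⟨d, hd⟩ : ∃ d, d = δ * Real.exp (- C1 * T) := ⟨_, rfl⟩
  have hd0 : 0 < d := by rw [hd]; positivity
  have hlow : ∀ t ∈ Ico 0 T, ∀ x, d ≤ ρ t x := by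
    intro t ht x
    refine le_trans ?_ (rho_lower (fun t ht => h.dρ t (hI ht)) (fun t ht => h.pos t (hI ht)) hg x t ht)
    rw [hd]
    refine mul_le_mul (hδ' x) (Real.exp_le_exp.2 ?_) (Real.exp_pos _).le (h.pos 0 (hI ⟨le_rfl, hT⟩) x).le
    nlinarith [ht.1, ht.2]
  have hev : ∀ᶠ t in 𝓝[<] T, t ∈ Ico 0 T := Ico_mem_nhdsLT hT
  have hpT : ρT ∈ Pos := by
    intro x
    have h1 : Tendsto (fun t => ρ t x) (𝓝[<] T) (𝓝 (ρT x)) :=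
      ((ContinuousMap.evalCLM ℝ x : C(K, ℝ) →L[ℝ] ℝ).continuous.tendsto ρT).comp hρT
    exact lt_of_lt_of_le hd0 (ge_of_tendsto h1 (hev.mono fun t ht => hlow t ht x))
  obtain ⟨C2, hC20, hC2⟩ := wf_bound (p := p) hn ha ha0 han hpT
  obtain ⟨t₁, ht1, hw⟩ : ∃ t₁ ∈ Ico 0 T, ∀ t ∈ Ico t₁ T, ∀ j ≤ 2 * n - 1,
      ‖w t j‖ ≤ C2 * (1 + ‖q t‖) := by
    have h1 := hev.and (hρT.eventually hC2)
    obtain ⟨l, hl, hl'⟩ := (mem_nhdsLT_iff_exists_Ioo_subset).1 h1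
    have hlT : l < T := hl
    refine ⟨(max l 0 + T) / 2, ⟨by positivity, ?_⟩, fun t ht j hj => ?_⟩
    · have : max l 0 < T := max_lt hlT hT
      linarith
    · have h2 : max l 0 < T := max_lt hlT hT
      have h3 : t ∈ Ioo l T := ⟨by linarith [le_max_left l 0, ht.1], ht.2⟩
      rw [hwq]
      exact (hl' h3).2 j hj (q t)
  have hsub : Ico t₁ T ⊆ Ico 0 T := fun t ht => ⟨ht1.1.trans ht.1, ht.2⟩
  -- bounds on the length
  have hLlow : ∀ t ∈ Ico 0 T, 2 * π * d ≤ intg (ρ t) := by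
    intro t ht
    have := intg_mono (f := cst d) (g := ρ t) (fun x => hlow t ht x)
    rw [intg_apply] at this
    simpa using this
  have hLup : ∀ t ∈ Ico 0 T, intg (ρ t) ≤ 2 * π * R := by
    intro t ht
    have := intg_mono (f := ρ t) (g := cst R) (fun x => (le_abs_self _).trans
      (((ρ t).norm_coe_le_norm x).trans (hR t ht)))
    rw [intg_apply (cst R)] at this
    simpa using this
  obtain ⟨M0, hM0⟩ : ∃ M0, M0 = 2 * X + X / (2 * π * d) := ⟨_, rfl⟩
  have hM00 : 0 ≤ M0 := by rw [hM0]; positivity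
  have hw0 : ∀ t ∈ Ico 0 T, ∀ x, ‖w t 0 x‖ ^ 2 ≤ M0 := by
    intro t ht x
    have h1 := gen_bound (h.pos t (hI ht)) ((h.sys t (hI ht)).dw 0 (by omega)) x
    have h2 := hXb t ht 0 (by omega)
    have h3 := hXb t ht 1 (by omega)
    have h4 := hLlow t ht
    have h5 : 0 < 2 * π * d := by positivity
    by_contra hcon
    push Not at hcon
    have h6 : X / (2 * π * d) < ‖w t 0 x‖ ^ 2 - (PP (ρ t) (w t 0) (w t 0) + PP (ρ t) (w t 1) (w t 1)) := by
      rw [hM0] at hcon; linarith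
    have h7 : 0 ≤ X / (2 * π * d) := by positivity
    have h8 : X < 2 * π * d * (‖w t 0 x‖ ^ 2 - (PP (ρ t) (w t 0) (w t 0) + PP (ρ t) (w t 1) (w t 1))) := by
      rw [div_lt_iff₀ h5] at h6; linarith
    have h9 := mul_le_mul_of_nonneg_right h4 (h7.trans h6.le)
    have h10 : (0 + 1 : ℕ) = 1 := rfl
    rw [h10] at h1
    linarith
  have hwn : ∀ t ∈ Ico t₁ T, ∀ x, ‖w t n x‖ ^ 2 ≤ C2 * (2 * π * R + X) * (1 + ‖q t‖) := by
    intro t ht x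
    have ht' := hsub ht
    have h1 := (h.sys t (hI ht')).w_n (h.pos t (hI ht')) hn x
    have h2 := hw t ht (n + 1) (by omega)
    have h3 := hLup t ht'
    have h4 := hXb t ht' n le_rfl
    have h5 : 0 ≤ C2 * (1 + ‖q t‖) := by positivity
    have h6 : 0 ≤ intg (ρ t) + PP (ρ t) (w t n) (w t n) :=
      add_nonneg (intg_nonneg fun x => (h.pos t (hI ht') x).le) (PP_self_nonneg (h.pos t (hI ht')) _)
    have h7 := mul_le_mul h2 (add_le_add h3 h4) h6 h5
    calc _ ≤ _ := h1
      _ ≤ _ := h7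
      _ = _ := by ring
  obtain ⟨B, hB⟩ : ∃ B, B = M0 + C1 * C2 + C2 * (2 * π * R + X) := ⟨_, rfl⟩
  have hB0 : 0 ≤ B := by rw [hB]; positivity
  have hb1 : 0 ≤ C1 * C2 := by positivity
  have hb2 : 0 ≤ C2 * (2 * π * R + X) := by positivity
  have hSS : ∀ t ∈ Ico t₁ T, ‖SS a n (w t)‖ ≤ cSS a n * (B * (1 + ‖q t‖)) := by
    intro t ht
    have ht' := hsub ht
    have hq1 : 1 ≤ 1 + ‖q t‖ := by linarith [norm_nonneg (q t)]
    refine SS_bound ?_ ?_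
    · have h1 := ip_le_of_sq (hw0 t ht')
      nlinarith
    · intro i j hi hj hij
      have key : ∀ i j, 1 ≤ i → 1 ≤ j → i + j ≤ 2 * n → i + 1 ≤ n →
          ‖ip (w t i) (w t j)‖ ≤ B * (1 + ‖q t‖) := by
        intro i j hi hj hij hin
        have h1 := norm_ip_le (w t i) (w t j)
        have h2 := hmid t ht' i hi hin
        have h3 := hw t ht j (by omega)
        have h4 := mul_le_mul h2 h3 (norm_nonneg _) hC10
        rw [hB]
        nlinarith
      by_cases hin : i + 1 ≤ n
      · exact key i j hi hj hij hin
      by_cases hjn : j + 1 ≤ n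
      · rw [ip_comm]
        exact key j i hj hi (by omega) hjn
      obtain rfl : i = n := by omega
      obtain rfl : j = i := by omega
      have h1 := ip_le_of_sq (hwn t ht)
      rw [hB]
      nlinarith
  have hqd : ∀ t ∈ Ico t₁ T, ‖sm (SS a n (w t)) (v t)‖ ≤ cSS a n * B * ‖q t‖ + cSS a n * B := by
    intro t ht
    have h1 := norm_sm_le (SS a n (w t)) (v t)
    have h2 := hSS t ht
    have h3 := hv1 t (hsub ht)
    have h4 := mul_le_mul_of_nonneg_left h3 (norm_nonneg (SS a n (w t)))
    linarith
  have hcB : 0 ≤ cSS a n * B := mul_nonneg cSS_nonneg hB0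
  obtain ⟨Q, hQ0, hQ⟩ := gronwall_bdd hcB hcB
    (fun t ht => h.dq t (hI (hsub ht))) hqd
  obtain ⟨qT, hqT⟩ := exists_limit ht1.2 (fun t ht => h.dq t (hI (hsub ht)))
    (C := cSS a n * B * Q + cSS a n * B) (fun t ht => (hqd t ht).trans (by
      have := mul_le_mul_of_nonneg_left (hQ t ht) hcB
      linarith))
  obtain ⟨vT, hvT⟩ := exists_limit hT (fun t ht => h.dv t (hI ht)) (C := C1 + C1) (fun t ht => by
    have h1 := norm_sm_le (ip (w t 1) (v t)) (v t)
    have h2 := mul_le_mul (hg t ht) (hv1 t ht) (norm_nonneg _) hC10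
    have h3 := hmid t ht 1 le_rfl hn
    have h4 := norm_sub_le (w t 1) (sm (ip (w t 1) (v t)) (v t))
    linarith)
  have hcd : ∀ t ∈ Ico 0 T, HasDerivAt (fun s => (z s).1) (w t 0) t := by
    intro t ht
    have h1 := (hz t (hI ht)).2.fst
    rw [← hwe' t]
    exact h1
  obtain ⟨cT, hcT⟩ := exists_limit hT hcd (C := 1 + M0) (fun t ht =>
    (norm_le_of_sq (hw0 t ht)).trans (sqrt_le_self_add (Real.sqrt_nonneg _) (Real.sq_sqrt hM00).le))
  refine ⟨(cT, ρT, vT, qT), hpT, ?_⟩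
  rw [← hρe] at hρT
  rw [← hve] at hvT
  rw [← hqe] at hqT
  exact hcT.prodMk_nhds (hρT.prodMk_nhds (hvT.prodMk_nhds hqT))

theorem sol_global (hn : 2 ≤ n) (ha : ∀ j ≤ n, 0 ≤ a j) (ha0 : 0 < a 0) (han : 0 < a n)
    {z₀ : ZZ} (hz₀ : z₀ ∈ UU) (h0 : ip z₀.2.2.1 z₀.2.2.1 = cst 1) :
    ∃ ε > 0, ∃ z : ℝ → ZZ, z 0 = z₀ ∧ SolOn (VF a n p) UU z (Ioi (-ε)) := by
  refine exists_global isOpen_UU (eqVF hn ha ha0 han).one hz₀ ?_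
  intro T hT ε hε z hz0 hz
  exact sol_limit hn ha ha0 han hT hε hz (by rw [hz0]; exact h0)

end Lim
end GP

set_option linter.unusedSectionVars false
set_option linter.unusedSimpArgs false
set_option linter.unnecessarySeqFocus false
namespace GP
open Set Filter Topology

section Init

variable {E : Type} [NormedAddCommGroup E] [NormedSpace ℝ E]

theorem SmoothLoop_deriv {f : ℝ → E} (h : SmoothLoop f) : SmoothLoop (deriv f) := by
  refine ⟨(contDiff_infty_iff_deriv.1 h.1).2, fun x => ?_⟩
  have e : (fun y => f (y + 2 * π)) = f := funext h.2
  rw [← deriv_comp_add_const, e]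

theorem SmoothLoop_speed {c : ℝ → R2} (h : IsImmersion c) : SmoothLoop (speed c) := by
  have h1 := SmoothLoop_deriv h.1
  refine ⟨h1.1.norm ℝ h.2, fun x => ?_⟩
  simp only [speed, h1.2 x]

theorem speed_pos {c : ℝ → R2} (h : IsImmersion c) (x : ℝ) : 0 < speed c x := norm_pos_iff.2 (h.2 x)

theorem SmoothLoop_Ds {c : ℝ → R2} (h : IsImmersion c) {f : ℝ → E} (hf : SmoothLoop f) :
    SmoothLoop (Ds c f) := by
  have h1 := SmoothLoop_deriv hf
  have h2 := SmoothLoop_speed h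
  refine ⟨(h2.1.inv fun x => (speed_pos h x).ne').smul h1.1, fun x => ?_⟩
  simp only [Ds, h1.2 x, h2.2 x]

theorem SmoothLoop_iter {c : ℝ → R2} (h : IsImmersion c) {f : ℝ → E} (hf : SmoothLoop f) (j : ℕ) :
    SmoothLoop ((Ds c)^[j] f) := by
  induction j with
  | zero => exact hf
  | succ j ih => rw [Function.iterate_succ_apply']; exact SmoothLoop_Ds h ih

/-- smooth loop as a function on the circle -/
def mk (f : ℝ → E) (h : SmoothLoop f) : C(K, E) := ofPer f h.1.continuous h.2

@[simp] theorem mk_apply (f : ℝ → E) (h : SmoothLoop f) (θ : ℝ) : mk f h (θ : K) = f θ := rfl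

theorem tr_mk_contDiff [CompleteSpace E] (f : ℝ → E) (h : SmoothLoop f) :
    ContDiff ℝ (⊤ : ℕ∞) fun k => tr k (mk f h) := tr_contDiff h.1

theorem exists_primitive [CompleteSpace E] {g : ℝ → E} (hg : SmoothLoop g)
    (h0 : ∫ θ in (0:ℝ)..(2 * π), g θ = 0) :
    ∃ G : ℝ → E, SmoothLoop G ∧ ∀ θ, HasDerivAt G (g θ) θ := by
  have hd : ∀ θ, HasDerivAt (fun x => ∫ y in (0:ℝ)..x, g y) (g θ) θ := fun θ =>
    intervalIntegral.integral_hasDerivAt_right (hg.1.continuous.intervalIntegrable _ _)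
      (hg.1.continuous.stronglyMeasurableAtFilter _ _) hg.1.continuous.continuousAt
  refine ⟨fun x => ∫ y in (0:ℝ)..x, g y, ⟨?_, ?_⟩, hd⟩
  · refine contDiff_infty_iff_deriv.2 ⟨fun θ => (hd θ).differentiableAt, ?_⟩
    have : deriv (fun x => ∫ y in (0:ℝ)..x, g y) = g := funext fun θ => (hd θ).deriv
    rw [this]
    exact hg.1
  · intro x
    have h1 := intervalIntegral.integral_add_adjacent_intervals (μ := volume) (f := g)
      (hg.1.continuous.intervalIntegrable 0 x) (hg.1.continuous.intervalIntegrable x (x + 2 * π))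
    have h2 := hg.2.intervalIntegral_add_eq x 0
    simp only
    rw [← h1, h2, zero_add, h0, add_zero]

variable {a : ℕ → ℝ} {n : ℕ}

theorem exists_initial_data (hn : 2 ≤ n) (ha : ∀ j ≤ n, 0 ≤ a j) (ha0 : 0 < a 0) (han : 0 < a n)
    {c₀ u₀ : ℝ → R2} (hc₀ : IsImmersion c₀) (hu₀ : SmoothLoop u₀) :
    ∃ (p : R2) (z₀ : ZZ), z₀ ∈ UU ∧ ip z₀.2.2.1 z₀.2.2.1 = cst 1 ∧
      (∀ θ : ℝ, z₀.1 (θ : K) = c₀ θ) ∧ Der z₀.1 (sm z₀.2.1 z₀.2.2.1) ∧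
      (∀ θ : ℝ, wz a n p z₀ 0 (θ : K) = u₀ θ) ∧
      ContDiff ℝ (⊤ : ℕ∞) (fun h => GZ.T h z₀) := by
  have hs := SmoothLoop_speed hc₀
  have hv : SmoothLoop (tangentV c₀) := SmoothLoop_Ds hc₀ hc₀.1
  have hw := SmoothLoop_iter hc₀ hu₀
  -- the constant
  obtain ⟨p, hp⟩ : ∃ p : R2, p = (2 * π)⁻¹ • ∫ θ in (0:ℝ)..(2 * π), a 0 • speed c₀ θ • u₀ θ :=
    ⟨_, rfl⟩
  have hg1 : ContDiff ℝ (⊤ : ℕ∞) (fun θ => a 0 • speed c₀ θ • u₀ θ) := (hs.1.smul hu₀.1).const_smul _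
  have hg : SmoothLoop (fun θ => p - a 0 • speed c₀ θ • u₀ θ) := by
    refine ⟨contDiff_const.sub hg1, fun x => ?_⟩
    simp only [hs.2 x, hu₀.2 x]
  have hg0 : ∫ θ in (0:ℝ)..(2 * π), (p - a 0 • speed c₀ θ • u₀ θ) = 0 := by
    rw [intervalIntegral.integral_sub (by simp) (hg1.continuous.intervalIntegrable _ _),
      intervalIntegral.integral_const, hp, smul_smul, sub_zero,
      mul_inv_cancel₀ (by positivity), one_smul, sub_self]
  obtain ⟨m₀, hm, hmd⟩ := exists_primitive hg hg0
  have hq : SmoothLoop (fun θ => (∑ j ∈ Finset.Icc 1 n,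
      ((-1 : ℝ) ^ j * a j) • (Ds c₀)^[2 * j - 1] u₀ θ) - m₀ θ) := by
    refine ⟨(ContDiff.sum fun j _ => (hw (2 * j - 1)).1.const_smul _).sub hm.1, fun x => ?_⟩
    simp only [hm.2 x]
    congr 1
    exact Finset.sum_congr rfl fun j _ => by rw [(hw (2 * j - 1)).2 x]
  have hpos : mk (speed c₀) hs ∈ Pos := by
    intro x
    obtain ⟨θ, _, rfl⟩ := exists_rep x
    exact speed_pos hc₀ θ
  have hsys : Sys a n (mk (speed c₀) hs) (mk _ hq) p (fun j => mk _ (hw j)) (mk m₀ hm) := by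
    refine ⟨fun j _ θ => ?_, fun θ => ?_, ?_⟩
    · have h1 : HasDerivAt ((Ds c₀)^[j] u₀) (deriv ((Ds c₀)^[j] u₀) θ) θ :=
        ((hw j).1.differentiable (by simp) θ).hasDerivAt
      refine h1.congr_deriv ?_
      simp only [sm_apply, mk_apply]
      rw [Function.iterate_succ_apply', Ds, smul_smul, mul_inv_cancel₀ (speed_pos hc₀ θ).ne', one_smul]
    · exact hmd θ
    · refine ext_lift fun θ => ?_
      simp
  have huniq := (sys_unique hn ha ha0 han hpos hsys).1 0 (by omega)
  refine ⟨p, (mk c₀ hc₀.1, mk _ hs, mk _ hv, mk _ hq), hpos, ?_, fun θ => rfl, ?_, ?_, ?_⟩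
  · refine ext_lift fun θ => ?_
    simp only [ip_apply, mk_apply, cst_apply, real_inner_self_eq_norm_sq, tangentV, norm_smul, norm_inv]
    have := (speed_pos hc₀ θ)
    rw [Real.norm_of_nonneg this.le]
    have e : ‖deriv c₀ θ‖ = speed c₀ θ := rfl
    rw [e, inv_mul_cancel₀ this.ne', one_pow]
  · intro θ
    have h1 : HasDerivAt c₀ (deriv c₀ θ) θ := (hc₀.1.1.differentiable (by simp) θ).hasDerivAt
    refine h1.congr_deriv ?_
    simp only [sm_apply, mk_apply]
    rw [tangentV, smul_smul, mul_inv_cancel₀ (speed_pos hc₀ θ).ne', one_smul]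
  · intro θ
    have : wz a n p (mk c₀ hc₀.1, mk _ hs, mk _ hv, mk _ hq) 0 = mk _ (hw 0) := huniq
    rw [this]; rfl
  · simp only [GZ_T]
    exact (tr_mk_contDiff _ _).prodMk ((tr_mk_contDiff _ _).prodMk
      ((tr_mk_contDiff _ _).prodMk (tr_mk_contDiff _ _)))

end Init
end GP

set_option linter.unusedSectionVars false
set_option linter.unusedSimpArgs false
set_option linter.unnecessarySeqFocus false
namespace GP
open Set Filter Topology

section Final

theorem Der_of_tr_zero {E : Type} [NormedAddCommGroup E] [NormedSpace ℝ E] [CompleteSpace E] {f g : C(K, E)}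
    (h : HasDerivAt (fun k => tr k f) g 0) : Der f g :=
  hasDerivAt_of_tr fun k => (trG E).hasDerivAt_of_zero (x := f) (y := g) h k

theorem Der.smul {E : Type} [NormedAddCommGroup E] [NormedSpace ℝ E] {f g : C(K, E)} (r : ℝ)
    (h : Der f g) : Der (r • f) (r • g) := fun θ => (h θ).const_smul r

theorem Der.sum {E : Type} [NormedAddCommGroup E] [NormedSpace ℝ E] (s : Finset ℕ) {f g : ℕ → C(K, E)}
    (h : ∀ i ∈ s, Der (f i) (g i)) : Der (∑ i ∈ s, f i) (∑ i ∈ s, g i) := by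
  intro θ
  have := HasDerivAt.fun_sum (u := s) (A := fun i (x : ℝ) => f i (x : K)) (A' := fun i => g i (θ : K))
    (x := θ) (fun i hi => h i hi θ)
  simpa using this

variable {a : ℕ → ℝ} {n : ℕ} {p : R2}

/-- geometric facts at a fixed time -/
structure Geo (γ : ℝ → R2) (ρ : C(K, ℝ)) (v : C(K, R2)) : Prop where
  pos : ρ ∈ Pos
  unit : ip v v = cst 1
  der : ∀ θ : ℝ, HasDerivAt γ (ρ (θ : K) • v (θ : K)) θ

theorem Geo.speed {γ : ℝ → R2} {ρ : C(K, ℝ)} {v : C(K, R2)} (h : Geo γ ρ v) (θ : ℝ) :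
    speed γ θ = ρ (θ : K) := by
  have h1 : ‖v (θ : K)‖ = 1 := by
    have := congrArg (fun F : C(K, ℝ) => F (θ : K)) h.unit
    simp only [ip_apply, cst_apply, real_inner_self_eq_norm_sq] at this
    nlinarith [norm_nonneg (v (θ : K))]
  rw [_root_.speed, (h.der θ).deriv, norm_smul, h1, mul_one, Real.norm_of_nonneg (h.pos _).le]

theorem Geo.tangent {γ : ℝ → R2} {ρ : C(K, ℝ)} {v : C(K, R2)} (h : Geo γ ρ v) (θ : ℝ) :
    tangentV γ θ = v (θ : K) := by
  rw [tangentV, h.speed, (h.der θ).deriv, smul_smul, inv_mul_cancel₀ (h.pos _).ne', one_smul]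

theorem Geo.ds {γ : ℝ → R2} {ρ : C(K, ℝ)} {v : C(K, R2)} (h : Geo γ ρ v) {f g : C(K, R2)}
    (hf : Der f (sm ρ g)) : Ds γ (fun θ : ℝ => f (θ : K)) = fun θ : ℝ => g (θ : K) := by
  funext θ
  rw [Ds, h.speed, (hf θ).deriv, sm_apply, smul_smul, inv_mul_cancel₀ (h.pos _).ne', one_smul]

theorem Geo.smul_ds {γ : ℝ → R2} {ρ : C(K, ℝ)} {v : C(K, R2)} (h : Geo γ ρ v) {f g : C(K, R2)}
    (hf : Der f g) (r : ℝ) (θ : ℝ) : (r * _root_.speed γ θ) • Ds γ (fun θ : ℝ => f (θ : K)) θ = r • g (θ : K) := by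
  rw [Ds, smul_smul, mul_assoc, mul_inv_cancel₀ (by rw [h.speed]; exact (h.pos _).ne'), mul_one,
    (hf θ).deriv]

theorem Geo.iter {γ : ℝ → R2} {ρ : C(K, ℝ)} {v q m : C(K, R2)} {w : ℕ → C(K, R2)} (h : Geo γ ρ v)
    (hs : Sys a n ρ q p w m) : ∀ j ≤ 2 * n - 1,
      (Ds γ)^[j] (fun θ : ℝ => w 0 (θ : K)) = fun θ : ℝ => w j (θ : K) := by
  intro j
  induction j with
  | zero => intro _; rfl
  | succ j ih =>
    intro hj
    rw [Function.iterate_succ_apply', ih (by omega), h.ds (hs.dw j hj)]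

theorem range_eq_Icc' (n : ℕ) (f : ℕ → R2) :
    ∑ j ∈ Finset.range (n + 1), f j = f 0 + ∑ j ∈ Finset.Icc 1 n, f j := by
  rw [Finset.sum_range_succ', add_comm]
  congr 1
  rw [Finset.range_eq_Ico, Finset.sum_Ico_add' f 0 n 1]
  rfl

theorem momentum_eq (hn : 2 ≤ n) {c : ℝ → ℝ → R2} {t : ℝ} {ρ : C(K, ℝ)} {v q m q' : C(K, R2)}
    {w w' : ℕ → C(K, R2)} (h : Geo (c t) ρ v) (hs : Sys a n ρ q p w m)
    (ht : tvel c t = fun θ : ℝ => w 0 (θ : K)) (hq : Der q q') (hw : ∀ j, Der (w j) (w' j)) (θ : ℝ) :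
    geodMomentum a n c t θ = p + q' (θ : K) := by
  have h1 : Der (m + q) (∑ j ∈ Finset.Icc 1 n, ((-1 : ℝ) ^ j * a j) • w' (2 * j - 1)) := by
    rw [← hs.alg]
    exact Der.sum _ fun j _ => (hw _).smul _
  have h2 := congrArg (fun F : C(K, R2) => F (θ : K)) (h1.unique (hs.dm.add hq))
  have e : ∀ j ∈ Finset.Icc 1 n, ((-1 : ℝ) ^ j * a j * speed (c t) θ) •
      (Ds (c t))^[2 * j] (tvel c t) θ = (((-1 : ℝ) ^ j * a j) • w' (2 * j - 1)) (θ : K) := by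
    intro j hj
    rw [Finset.mem_Icc] at hj
    obtain ⟨i, hi⟩ : ∃ i, 2 * j = i + 1 := ⟨2 * j - 1, by omega⟩
    rw [hi, Nat.add_sub_cancel, Function.iterate_succ_apply', ht, h.iter hs i (by omega),
      h.smul_ds (hw i)]
    rfl
  rw [geodMomentum, range_eq_Icc', Finset.sum_congr rfl e, ht, h.speed]
  simp only [ContinuousMap.sum_apply, ContinuousMap.add_apply, ContinuousMap.sub_apply, cst_apply,
    ContinuousMap.smul_apply, sm_apply] at h2 ⊢
  rw [h2]
  simp [smul_smul]
  abel

theorem rhs_eq (hn : 2 ≤ n) {c : ℝ → ℝ → R2} {t : ℝ} {ρ : C(K, ℝ)} {v v' q m S' : C(K, R2)}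
    {w w' : ℕ → C(K, R2)} (h : Geo (c t) ρ v) (hs : Sys a n ρ q p w m)
    (ht : tvel c t = fun θ : ℝ => w 0 (θ : K)) (hv : Der v v') (hw : ∀ j, Der (w j) (w' j))
    (hS : Der (sm (SS a n w) v) S') (θ : ℝ) :
    geodRHS a n c t θ = S' (θ : K) := by
  have hex : ∀ i j, ∃ g, Der (sm (ip (w i) (w j)) v) g := fun i j =>
    ⟨_, Der.bl _ (Der.bl (innerSL ℝ) (hw i) (hw j)) hv⟩
  choose G hG using hex
  have e : sm (SS a n w) v = (-(a 0 / 2)) • sm (ip (w 0) (w 0)) v +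
      ∑ k ∈ Finset.Icc 1 n, ∑ j ∈ Finset.Icc 1 (2 * k - 1),
        ((-1 : ℝ) ^ (k + j) * (a k / 2)) • sm (ip (w (2 * k - j)) (w j)) v := by
    ext1 x
    simp only [SS, sm_apply, ContinuousMap.sum_apply, ContinuousMap.add_apply,
      ContinuousMap.smul_apply, add_smul, Finset.sum_smul, smul_assoc]
  have h1 : Der (sm (SS a n w) v) ((-(a 0 / 2)) • G 0 0 +
      ∑ k ∈ Finset.Icc 1 n, ∑ j ∈ Finset.Icc 1 (2 * k - 1),
        ((-1 : ℝ) ^ (k + j) * (a k / 2)) • G (2 * k - j) j) := by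
    rw [e]
    exact ((hG 0 0).smul _).add (Der.sum _ fun k _ => Der.sum _ fun j _ => (hG _ _).smul _)
  rw [hS.unique h1, geodRHS, ht]
  have f : ∀ i ≤ 2 * n - 1, ∀ j ≤ 2 * n - 1, ∀ r : ℝ, (r * speed (c t) θ) • Ds (c t) (fun x =>
      (⟪(Ds (c t))^[i] (fun θ : ℝ => w 0 (θ : K)) x, (Ds (c t))^[j] (fun θ : ℝ => w 0 (θ : K)) x⟫ : ℝ) •
              tangentV (c t) x) θ = r • G i j (θ : K) := by
    intro i hi j hj r
    rw [h.iter hs i hi, h.iter hs j hj]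
    simp only [h.tangent]
    exact h.smul_ds (hG i j) r θ
  simp only [ContinuousMap.sum_apply, ContinuousMap.add_apply, ContinuousMap.smul_apply]
  refine congrArg₂ (· + ·) (f 0 (by omega) 0 (by omega) _) ?_
  refine Finset.sum_congr rfl fun k hk => Finset.sum_congr rfl fun j hj => ?_
  rw [Finset.mem_Icc] at hk hj
  exact f _ (by omega) _ (by omega) _

end Final
end GP

set_option linter.unusedSectionVars false
set_option linter.unusedSimpArgs false
set_option linter.unnecessarySeqFocus false
namespace GP
open Set Filter Topology

section Main

variable {a : ℕ → ℝ} {n : ℕ} {p : R2}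

theorem der_preserved (hn : 2 ≤ n) (ha : ∀ j ≤ n, 0 ≤ a j) (ha0 : 0 < a 0) (han : 0 < a n)
    {z : ℝ → ZZ} {ε : ℝ} (hε : 0 < ε) (hz : SolOn (VF a n p) UU z (Ioi (-ε)))
    (h0 : Der (z 0).1 (sm (z 0).2.1 (z 0).2.2.1)) {t : ℝ} (ht : 0 ≤ t) :
    Der (z t).1 (sm (z t).2.1 (z t).2.2.1) := by
  have hI : ∀ s, 0 ≤ s → s ∈ Ioi (-ε) := fun s hs => by simp only [mem_Ioi]; linarith
  have hd : ∀ s, 0 ≤ s → HasDerivAt (fun s => (z s).1 - Lam (sm (z s).2.1 (z s).2.2.1 - (z s).1)) 0 s := by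
    intro s hs
    obtain ⟨hU, hzd⟩ := hz s (hI s hs)
    have h1 : HasDerivAt (fun s => (z s).1) (VF a n p (z s)).1 s := hzd.fst
    have h2 : HasDerivAt (fun s => (z s).2.1) (VF a n p (z s)).2.1 s := hzd.snd.fst
    have h3 : HasDerivAt (fun s => (z s).2.2.1) (VF a n p (z s)).2.2.1 s := hzd.snd.snd.fst
    have h4 := (sm (E := R2)).hasDerivAt_of_bilinear (fun _ => h2) (fun _ => h3)
    have h5 := HasDerivAt.sub h1 ((Lam (E := R2)).hasFDerivAt.comp_hasDerivAt s (HasDerivAt.sub h4 h1))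
    refine h5.congr_deriv ?_
    have hw := (sys_wf (q := (z s).2.2.2) (p := p) hn ha ha0 han hU).dw 0 (by omega)
    rw [der_iff] at hw
    have e : sm (z s).2.1 (VF a n p (z s)).2.2.1 + sm (VF a n p (z s)).2.1 (z s).2.2.1
        = sm (z s).2.1 (wf a n p (z s).2.1 (z s).2.2.2 1) := by
      ext1 x
      simp only [VF, sm_apply, ContinuousMap.add_apply, ContinuousMap.sub_apply, wz, smul_sub,
        smul_smul, smul_eq_mul]
      abel
    rw [e]
    exact sub_eq_zero.2 hw
  have := constant_of_has_deriv_right_zero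
    (f := fun s => (z s).1 - Lam (sm (z s).2.1 (z s).2.2.1 - (z s).1)) (a := 0) (b := t)
    (fun s hs => (hd s hs.1).continuousAt.continuousWithinAt)
    (fun s hs => (hd s hs.1).hasDerivWithinAt) t ⟨ht, le_rfl⟩
  rw [der_iff] at h0 ⊢
  exact sub_eq_zero.1 (this.trans (sub_eq_zero.2 h0))

theorem main_geod (hn : 2 ≤ n) (ha : ∀ j ≤ n, 0 ≤ a j) (ha0 : 0 < a 0) (han : 0 < a n)
    (c₀ u₀ : ℝ → R2) (hc₀ : IsImmersion c₀) (hu₀ : SmoothLoop u₀) :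
    ∃ c : ℝ → ℝ → R2,
      ContDiffOn ℝ (⊤ : ℕ∞) (fun p : ℝ × ℝ => c p.1 p.2) (Set.Ici 0 ×ˢ Set.univ) ∧
      (∀ t : ℝ, 0 ≤ t → IsImmersion (c t)) ∧
      c 0 = c₀ ∧
      tvel c 0 = u₀ ∧
      ∀ t : ℝ, 0 ≤ t → ∀ θ : ℝ,
        derivWithin (fun τ => geodMomentum a n c τ θ) (Set.Ici 0) t = geodRHS a n c t θ := by
  obtain ⟨p, z₀, hU, hunit, hc, hder, hu, hsm⟩ := exists_initial_data hn ha ha0 han hc₀ hu₀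
  obtain ⟨ε, hε, z, hz0, hz⟩ := sol_global (p := p) hn ha ha0 han hU hunit
  have hI : ∀ s, 0 ≤ s → s ∈ Ioi (-ε) := fun s hs => by simp only [mem_Ioi]; linarith
  have hF := eqVF (p := p) hn ha ha0 han
  -- tangent flow
  have hy0 : DifferentiableAt ℝ (fun h => GZ.T h (z 0)) 0 := by
    rw [hz0]; exact hsm.differentiable (by simp) 0
  obtain ⟨ε', hε', y, hyi, hy⟩ := exists_tangent hF hε hz (deriv (fun h => GZ.T h (z 0)) 0)
  have hI' : ∀ s, 0 ≤ s → s ∈ Ioi (-ε') := fun s hs => by simp only [mem_Ioi]; linarith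
  have horb : ∀ t, 0 ≤ t → HasDerivAt (fun k => GZ.T k (z t)) (y t) 0 := fun t ht =>
    hasDerivAt_orbit hF hε' hy (by rw [hyi]; exact hy0.hasDerivAt) ht
  -- geometry
  have hgeo : ∀ t, 0 ≤ t → Geo (fun θ : ℝ => (z t).1 (θ : K)) (z t).2.1 (z t).2.2.1 := by
    intro t ht
    refine ⟨(hz t (hI t ht)).1, ?_, ?_⟩
    · obtain ⟨wd, h⟩ := traj_of_sol hn ha ha0 han hz
      exact h.unit (T := t + 1) (fun s hs => hI s hs.1) (by simp only [hz0]; exact hunit) t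
        ⟨ht, by linarith⟩
    · intro θ
      exact der_preserved hn ha ha0 han hε hz (by rw [hz0]; exact hder) ht θ
  have hsys : ∀ t, 0 ≤ t → Sys a n (z t).2.1 (z t).2.2.2 p (wz a n p (z t))
      (mf a n p (z t).2.1 (z t).2.2.2) := fun t ht => sys_wf hn ha ha0 han (hz t (hI t ht)).1
  have hcd : ∀ t, 0 ≤ t → ∀ θ : ℝ, HasDerivAt (fun s => (z s).1 (θ : K)) (wz a n p (z t) 0 (θ : K)) t := by
    intro t ht θ
    exact (ContinuousMap.evalCLM ℝ (θ : K) : C(K, R2) →L[ℝ] R2).hasFDerivAt.comp_hasDerivAt t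
      (hz t (hI t ht)).2.fst
  have htv : ∀ t, 0 ≤ t → tvel (fun t θ => (z t).1 (θ : K)) t = fun θ : ℝ => wz a n p (z t) 0 (θ : K) := by
    intro t ht
    funext θ
    exact (hcd t ht θ).hasDerivWithinAt.derivWithin (uniqueDiffOn_Ici 0 t ht)
  have hreg := reg hF hε hz (by rw [hz0]; exact hsm)
  have hc2 : ContDiffOn ℝ (⊤ : ℕ∞) (fun q : ℝ × ℝ => (z q.1).1 (q.2 : K)) (Ici 0 ×ˢ univ) := by
    have h1 := (((ContinuousMap.evalCLM ℝ (0 : K) : C(K, R2) →L[ℝ] R2).comp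
      (ContinuousLinearMap.fst ℝ C(K, R2) (C(K, ℝ) × C(K, R2) × C(K, R2)))).contDiff
        (n := ((⊤ : ℕ∞) : WithTop ℕ∞))).comp_contDiffOn hreg
    refine h1.congr fun q _ => ?_
    exact (tr_zero_apply q.2 (z q.1).1).symm
  -- spatial derivatives
  have hwd : ∀ t, 0 ≤ t → ∀ j, ∃ g, Der (wz a n p (z t) j) g := by
    intro t ht j
    have hUt := (hz t (hI t ht)).1
    have h1 := ((wz_contDiffAt (p := p) hn ha ha0 han hUt j).differentiableAt (by simp)).hasFDerivAt
    have h0 : GZ.T 0 (z t) = z t := GZ.zero _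
    have h2 := HasFDerivAt.comp_hasDerivAt (f := fun k => GZ.T k (z t)) (l := fun z => wz a n p z j)
      (0 : ℝ) (by rw [h0]; exact h1) (horb t ht)
    refine ⟨_, Der_of_tr_zero (h2.congr_of_eventuallyEq (Eventually.of_forall fun k => ?_))⟩
    exact (wz_tr hn ha ha0 han hUt k j).symm
  have hVd : ∀ t, 0 ≤ t → HasDerivAt (fun k => GZ.T k (VF a n p (z t)))
      (fderiv ℝ (VF a n p) (z t) (y t)) 0 := by
    intro t ht
    have hUt := (hz t (hI t ht)).1
    have h1 := hF.diffAt hUt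
    have h0 : GZ.T 0 (z t) = z t := GZ.zero _
    have h2 := HasFDerivAt.comp_hasDerivAt (f := fun k => GZ.T k (z t)) (l := VF a n p)
      (0 : ℝ) (by rw [h0]; exact h1) (horb t ht)
    refine h2.congr_of_eventuallyEq (Eventually.of_forall fun k => ?_)
    exact (hF.eqv k _ hUt).symm
  have hSd : ∀ t, 0 ≤ t → Der (sm (SS a n (wz a n p (z t))) (z t).2.2.1)
      (fderiv ℝ (VF a n p) (z t) (y t)).2.2.2 := fun t ht =>
    Der_of_tr_zero (hVd t ht).snd.snd.snd
  have hvd : ∀ t, 0 ≤ t → Der (z t).2.2.1 (y t).2.2.1 := fun t ht =>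
    Der_of_tr_zero (horb t ht).snd.snd.fst
  have hqd : ∀ t, 0 ≤ t → Der (z t).2.2.2 (y t).2.2.2 := fun t ht =>
    Der_of_tr_zero (horb t ht).snd.snd.snd
  refine ⟨fun t θ => (z t).1 (θ : K), hc2, ?_, ?_, ?_, ?_⟩
  · intro t ht
    refine ⟨⟨?_, lift_periodic _⟩, fun θ => ?_⟩
    · have h1 : ContDiff ℝ (⊤ : ℕ∞) (fun θ : ℝ => (t, θ)) := contDiff_const.prodMk contDiff_id
      exact contDiffOn_univ.1 (hc2.comp (contDiffOn_univ.2 h1) (fun θ _ => ⟨ht, mem_univ _⟩))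
    · have h1 := (hgeo t ht).speed θ
      have h2 := (hgeo t ht).pos (θ : K)
      rw [← h1] at h2
      exact norm_pos_iff.1 h2
  · funext θ
    simp only [hz0]
    exact hc θ
  · rw [htv 0 le_rfl, hz0]
    exact funext hu
  · intro t ht θ
    have hm : ∀ s, 0 ≤ s → geodMomentum a n (fun t θ => (z t).1 (θ : K)) s θ
        = p + (y s).2.2.2 (θ : K) := by
      intro s hs
      choose w' hw' using hwd s hs
      exact momentum_eq hn (c := fun t θ => (z t).1 (θ : K)) (hgeo s hs) (hsys s hs) (htv s hs)
        (hqd s hs) hw' θ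
    choose w' hw' using hwd t ht
    rw [rhs_eq hn (c := fun t θ => (z t).1 (θ : K)) (hgeo t ht) (hsys t ht) (htv t ht) (hvd t ht) hw'
      (hSd t ht) θ]
    have h1 : HasDerivAt (fun s => p + (y s).2.2.2 (θ : K))
        ((fderiv ℝ (VF a n p) (z t) (y t)).2.2.2 (θ : K)) t := by
      have h2 := (hy t (hI' t ht)).2.snd.snd.snd.snd
      have h3 := (ContinuousMap.evalCLM ℝ (θ : K) : C(K, R2) →L[ℝ] R2).hasFDerivAt.comp_hasDerivAt t h2
      exact h3.const_add p
    refine (derivWithin_congr (s := Ici 0) (fun s hs => hm s hs) (hm t ht)).trans ?_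
    exact h1.hasDerivWithinAt.derivWithin (uniqueDiffOn_Ici 0 t ht)

end Main
end GP

/-- global existence of geodesics for constant-coefficient Sobolev metrics of
order `n ≥ 2`. -/
theorem statement_0 (n : ℕ) (hn : 2 ≤ n) (a : ℕ → ℝ) (ha : ∀ j ≤ n, 0 ≤ a j)
    (ha0 : 0 < a 0) (han : 0 < a n)
    (c₀ u₀ : ℝ → R2) (hc₀ : IsImmersion c₀) (hu₀ : SmoothLoop u₀) :
    ∃ c : ℝ → ℝ → R2,
      ContDiffOn ℝ (⊤ : ℕ∞) (fun p : ℝ × ℝ => c p.1 p.2) (Set.Ici 0 ×ˢ Set.univ) ∧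
      (∀ t : ℝ, 0 ≤ t → IsImmersion (c t)) ∧
      c 0 = c₀ ∧
      tvel c 0 = u₀ ∧
      ∀ t : ℝ, 0 ≤ t → ∀ θ : ℝ,
        derivWithin (fun τ => geodMomentum a n c τ θ) (Set.Ici 0) t = geodRHS a n c t θ := by
  exact GP.main_geod hn ha ha0 han c₀ u₀ hc₀ hu₀
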